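/- Assume the Riemann hypothesis: every nontrivial zero of the Riemann zeta function ζ(s) has real part 1/2. Assume moreover that all nontrivial zeros of ζ are simple and that there exists θ with 1 ≤ θ < 3 − √3 such that J_{−1}(T) := ∑_{0<γ≤T} |ζ′(1/2+iγ)|^{−2} ≪ T^θ, the sum being over nontrivial zeros ρ = 1/2+iγ with 0 < γ ≤ T. Then for every α ∈ [0,1] the function E_2(y,α) possesses a limiting distribution on ℝ, where M_α(x) = ∑_{n≤x} μ(n)/n^α with μ the Möbius function, and E_2(y,α) = e^{y(α−1/2)} M_α(e^y) if 0 ≤ α ≤ 1/2, and E_2(y,α) = e^{y(α−1/2)} (M_α(e^y) − 1/ζ(α)) if 1/2 < α ≤ 1. -/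

import Mathlib

open MeasureTheory Filter Topology

/-- `φ` possesses a limiting distribution on `ℝ`. -/
def HasLimitingDist (φ : ℝ → ℝ) : Prop :=
  ∃ μ : Measure ℝ, IsProbabilityMeasure μ ∧
    ∀ f : BoundedContinuousFunction ℝ ℝ,
      Tendsto (fun Y : ℝ => (1 / Y) * ∫ y in (0:ℝ)..Y, f (φ y)) atTop
        (𝓝 (∫ x, f x ∂μ))

/-- `M_α(x) = ∑_{n ≤ x} μ(n)/n^α`, the weighted summatory function of the Möbius
function. -/
noncomputable def Mweight (α x : ℝ) : ℝ :=
  ∑ n ∈ Finset.Icc 1 ⌊x⌋₊, (ArithmeticFunction.moebius n : ℝ) / (n : ℝ) ^ α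

/-- The error term `E₂(y, α)`; for `1/2 < α ≤ 1` the constant `1/ζ(α)` is subtracted
(interpreted as `0` at `α = 1`, where `ζ` has its pole). -/
noncomputable def E₂ (α y : ℝ) : ℝ :=
  if α ≤ 1 / 2 then Real.exp (y * (α - 1 / 2)) * Mweight α (Real.exp y)
  else Real.exp (y * (α - 1 / 2)) *
    (Mweight α (Real.exp y) - if α = 1 then 0 else (1 / riemannZeta α).re)

open scoped ENNReal

/-- Holomorphic dependence of an integral on a complex parameter, under local domination. -/
theorem differentiableAt_integral_of_dominated {X : Type*} [MeasurableSpace X] {μ : Measure X}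
    {F : ℂ → X → ℂ} {bound : X → ℝ} {z₀ : ℂ} {r : ℝ} (hr : 0 < r)
    (hmeas : ∀ z ∈ Metric.ball z₀ r, AEStronglyMeasurable (F z) μ)
    (hb : ∀ᵐ x ∂μ, ∀ z ∈ Metric.ball z₀ r, ‖F z x‖ ≤ bound x)
    (hbi : Integrable bound μ)
    (hd : ∀ᵐ x ∂μ, DifferentiableOn ℂ (fun z => F z x) (Metric.ball z₀ r)) :
    DifferentiableAt ℂ (fun z => ∫ x, F z x ∂μ) z₀ := by
  have hsub : ∀ {z}, z ∈ Metric.ball z₀ (r / 2) →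
      Metric.closedBall z (r / 4) ⊆ Metric.ball z₀ r := by
    intro z hz w hw
    rw [Metric.mem_ball] at *
    rw [Metric.mem_closedBall] at hw
    linarith [dist_triangle w z z₀]
  have hz₀ : z₀ ∈ Metric.ball z₀ r := Metric.mem_ball_self hr
  have hmem : Metric.ball z₀ (r / 2) ∈ 𝓝 z₀ := Metric.ball_mem_nhds _ (by linarith)
  have hderiv : ∀ᵐ x ∂μ, ∀ z ∈ Metric.ball z₀ (r / 2),
      HasDerivAt (fun z => F z x) (deriv (fun z => F z x) z) z := by
    filter_upwards [hd] with x hx z hz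
    exact (hx.differentiableAt (Metric.isOpen_ball.mem_nhds
      (hsub hz (Metric.mem_closedBall_self (by linarith))))).hasDerivAt
  have hF'meas : AEStronglyMeasurable (fun x => deriv (fun z => F z x) z₀) μ := by
    set u : ℕ → ℂ := fun n => ((r / 2 / ((n : ℝ) + 1) : ℝ) : ℂ) with hu
    have hupos : ∀ n : ℕ, 0 < r / 2 / ((n : ℝ) + 1) := fun n =>
      div_pos (half_pos hr) (Nat.cast_add_one_pos n)
    have hu0 : Tendsto u atTop (𝓝 0) := by
      have h1 : Tendsto (fun n : ℕ => r / 2 / ((n : ℝ) + 1)) atTop (𝓝 0) :=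
        tendsto_const_nhds.div_atTop (tendsto_atTop_add_const_right _ _ tendsto_natCast_atTop_atTop)
      simpa [hu, Function.comp_def] using (Complex.continuous_ofReal.tendsto 0).comp h1
    have huball : ∀ n, z₀ + u n ∈ Metric.ball z₀ r := by
      intro n
      rw [Metric.mem_ball, dist_eq_norm, add_sub_cancel_left, hu, Complex.norm_real,
        Real.norm_of_nonneg (hupos n).le, div_lt_iff₀ (by positivity)]
      have : (0 : ℝ) ≤ n := Nat.cast_nonneg n
      nlinarith
    refine aestronglyMeasurable_of_tendsto_ae (f := fun n x => (u n)⁻¹ • (F (z₀ + u n) x - F z₀ x))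
      atTop (fun n => ?_) ?_
    · exact ((hmeas _ (huball n)).sub (hmeas _ hz₀)).const_smul (u n)⁻¹
    · filter_upwards [hderiv] with x hx
      have h := (hx z₀ (Metric.mem_ball_self (by linarith))).tendsto_slope_zero
      refine h.comp (tendsto_nhdsWithin_iff.2 ⟨hu0, Eventually.of_forall fun n => ?_⟩)
      exact Complex.ofReal_ne_zero.2 (hupos n).ne'
  refine (hasDerivAt_integral_of_dominated_loc_of_deriv_le (μ := μ) (F := F)
    (F' := fun z x => deriv (fun z => F z x) z) (bound := fun x => bound x / (r / 4)) hmem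
    ?_ ?_ hF'meas ?_ (hbi.div_const _) hderiv).2.differentiableAt
  · filter_upwards [Metric.ball_mem_nhds z₀ hr] with z hz using hmeas z hz
  · exact hbi.mono' (hmeas _ hz₀) (by filter_upwards [hb] with x hx using hx _ hz₀)
  · filter_upwards [hd, hb] with x hx hbx z hz
    refine Complex.norm_deriv_le_of_forall_mem_sphere_norm_le (by linarith)
      (hx.diffContOnCl_ball (hsub hz)) fun w hw => hbx w (hsub hz
        (Metric.sphere_subset_closedBall hw))

theorem norm_fract_mul_cpow_le {s : ℂ} {t : ℝ} (ht : 1 < t) :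
    ‖((Int.fract t : ℝ) : ℂ) * (t : ℂ) ^ (-(s + 1))‖ ≤ t ^ (-(s.re + 1)) := by
  rw [norm_mul, Complex.norm_real, Complex.norm_cpow_eq_rpow_re_of_pos (by linarith),
    Real.norm_of_nonneg (Int.fract_nonneg t)]
  simp only [Complex.neg_re, Complex.add_re, Complex.one_re]
  have := (Int.fract_lt_one t).le
  have h2 : 0 ≤ t ^ (-(s.re + 1)) := Real.rpow_nonneg (by linarith) _
  nlinarith

theorem aestronglyMeasurable_fract_mul_cpow (s : ℂ) :
    AEStronglyMeasurable (fun t : ℝ => ((Int.fract t : ℝ) : ℂ) * (t : ℂ) ^ (-(s + 1)))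
      (volume.restrict (Set.Ioi 1)) := by
  apply Measurable.aestronglyMeasurable
  have : Measurable (fun t : ℝ => Int.fract t) := measurable_fract
  fun_prop

theorem integrableOn_fract_mul_cpow {s : ℂ} (hs : 0 < s.re) :
    IntegrableOn (fun t : ℝ => ((Int.fract t : ℝ) : ℂ) * (t : ℂ) ^ (-(s + 1))) (Set.Ioi 1) := by
  refine (integrableOn_Ioi_rpow_of_lt (a := -(s.re + 1)) (by linarith) one_pos).mono'
    (aestronglyMeasurable_fract_mul_cpow s) ?_
  filter_upwards [ae_restrict_mem measurableSet_Ioi] with t ht using norm_fract_mul_cpow_le ht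

theorem norm_integral_fract_le {s : ℂ} (hs : 0 < s.re) :
    ‖∫ t in Set.Ioi (1 : ℝ), ((Int.fract t : ℝ) : ℂ) * (t : ℂ) ^ (-(s + 1))‖ ≤ 1 / s.re := by
  have h := norm_integral_le_of_norm_le
    (integrableOn_Ioi_rpow_of_lt (a := -(s.re + 1)) (by linarith) one_pos)
    ((ae_restrict_mem measurableSet_Ioi).mono fun t ht => norm_fract_mul_cpow_le (s := s) ht)
  rw [integral_Ioi_rpow_of_lt (by linarith) one_pos] at h
  convert h using 1
  rw [Real.one_rpow]
  rw [show -(s.re + 1) + 1 = -s.re by ring, neg_div_neg_eq]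

theorem differentiableOn_integral_fract :
    DifferentiableOn ℂ
      (fun s : ℂ => ∫ t in Set.Ioi (1 : ℝ), ((Int.fract t : ℝ) : ℂ) * (t : ℂ) ^ (-(s + 1)))
      {s | 0 < s.re} := by
  intro s hs
  have hs : 0 < s.re := hs
  refine (differentiableAt_integral_of_dominated (r := s.re / 2)
    (bound := fun t : ℝ => t ^ (-(s.re / 2 + 1))) (by positivity)
    (fun z _ => aestronglyMeasurable_fract_mul_cpow z) ?_
    (integrableOn_Ioi_rpow_of_lt (by linarith) one_pos) ?_).differentiableWithinAt
  · filter_upwards [ae_restrict_mem measurableSet_Ioi] with t ht z hz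
    refine (norm_fract_mul_cpow_le ht).trans
      (Real.rpow_le_rpow_of_exponent_le (le_of_lt ht) ?_)
    have h1 := Complex.abs_re_le_norm (z - s)
    rw [Metric.mem_ball, dist_eq_norm] at hz
    rw [Complex.sub_re] at h1
    have := abs_le.1 h1
    linarith [this.1]
  · filter_upwards [ae_restrict_mem measurableSet_Ioi] with t ht z hz
    have ht : (1 : ℝ) < t := ht
    have : (t : ℂ) ≠ 0 := Complex.ofReal_ne_zero.2 (by linarith)
    refine (DifferentiableAt.const_mul ?_ _).differentiableWithinAt
    exact DifferentiableAt.const_cpow (by fun_prop) (Or.inl this)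

theorem riemannZeta₁_eq_of_ne_one {s : ℂ} (hs : s ≠ 1) :
    riemannZeta₁ s = (s - 1) * riemannZeta s := by
  have : s - 1 ≠ 0 := sub_ne_zero.2 hs
  rw [riemannZeta_eq_inv_sub_mul hs]
  field_simp

theorem riemannZeta₁_eq_of_one_lt_re {s : ℂ} (hs : 1 < s.re) :
    riemannZeta₁ s = s - s * (s - 1) *
      ∫ t in Set.Ioi (1 : ℝ), ((Int.fract t : ℝ) : ℂ) * (t : ℂ) ^ (-(s + 1)) := by
  have hs1 : s ≠ 1 := by rintro rfl; simp at hs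
  have hs1' : s - 1 ≠ 0 := sub_ne_zero.2 hs1
  have hO : (fun n : ℕ ↦ ∑ k ∈ Finset.Icc 1 n, ‖(1 : ℕ → ℂ) k‖) =O[atTop]
      fun n ↦ (n : ℝ) ^ (1 : ℝ) := by
    simpa using Asymptotics.isBigO_refl (fun n : ℕ => (n : ℝ)) atTop
  have h1 := LSeries_eq_mul_integral' (1 : ℕ → ℂ) zero_le_one hs hO
  rw [LSeries_one_eq_riemannZeta hs] at h1
  have h2 : ∫ t in Set.Ioi (1 : ℝ), (∑ k ∈ Finset.Icc 1 ⌊t⌋₊, (1 : ℕ → ℂ) k) * (t : ℂ) ^ (-(s + 1))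
      = ∫ t in Set.Ioi (1 : ℝ), ((t : ℂ) ^ (-s) -
        ((Int.fract t : ℝ) : ℂ) * (t : ℂ) ^ (-(s + 1))) := by
    refine setIntegral_congr_fun measurableSet_Ioi fun t ht => ?_
    have ht : (1 : ℝ) < t := ht
    have ht0 : (t : ℂ) ≠ 0 := Complex.ofReal_ne_zero.2 (by linarith)
    have h3 : (t : ℂ) ^ (-s) = t * (t : ℂ) ^ (-(s + 1)) := by
      rw [show -s = 1 + -(s + 1) by ring, Complex.cpow_add _ _ ht0, Complex.cpow_one]
    have h4 : ((⌊t⌋₊ : ℕ) : ℂ) = t - ((Int.fract t : ℝ) : ℂ) := by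
      have : ((⌊t⌋₊ : ℕ) : ℝ) = t - Int.fract t := by
        rw [natCast_floor_eq_intCast_floor (by linarith)]
        linarith [Int.floor_add_fract t]
      exact_mod_cast this
    simp only [Pi.one_apply, Finset.sum_const, Nat.card_Icc, add_tsub_cancel_right, nsmul_eq_mul,
      mul_one, h3, h4]
    ring
  rw [h2, integral_sub (integrableOn_Ioi_cpow_of_lt (by simpa using hs) one_pos)
    (integrableOn_fract_mul_cpow (by linarith)),
    integral_Ioi_cpow_of_lt (by simpa using hs) one_pos] at h1
  rw [riemannZeta₁_eq_of_ne_one hs1, h1, Complex.ofReal_one, Complex.one_cpow]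
  have h5 : -s + 1 ≠ 0 := by
    rw [show -s + 1 = -(s - 1) by ring]; exact neg_ne_zero.2 hs1'
  field_simp
  ring

theorem riemannZeta₁_eq {s : ℂ} (hs : 0 < s.re) :
    riemannZeta₁ s = s - s * (s - 1) *
      ∫ t in Set.Ioi (1 : ℝ), ((Int.fract t : ℝ) : ℂ) * (t : ℂ) ^ (-(s + 1)) := by
  have hopen : IsOpen {s : ℂ | 0 < s.re} := isOpen_lt continuous_const Complex.continuous_re
  have h1 : AnalyticOnNhd ℂ riemannZeta₁ {s : ℂ | 0 < s.re} :=
    differentiable_riemannZeta₁.differentiableOn.analyticOnNhd hopen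
  have h2 : AnalyticOnNhd ℂ (fun s : ℂ => s - s * (s - 1) *
      ∫ t in Set.Ioi (1 : ℝ), ((Int.fract t : ℝ) : ℂ) * (t : ℂ) ^ (-(s + 1)))
      {s : ℂ | 0 < s.re} := by
    refine DifferentiableOn.analyticOnNhd ?_ hopen
    exact differentiableOn_id.sub (DifferentiableOn.mul (by fun_prop)
      differentiableOn_integral_fract)
  refine h1.eqOn_of_preconnected_of_eventuallyEq h2
    (convex_halfSpace_re_gt 0).isPreconnected (z₀ := 2) (by simp) ?_ hs
  have : {s : ℂ | 1 < s.re} ∈ 𝓝 (2 : ℂ) :=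
    (isOpen_lt continuous_const Complex.continuous_re).mem_nhds (by simp)
  filter_upwards [this] with z hz using riemannZeta₁_eq_of_one_lt_re hz

theorem norm_riemannZeta₁_le {s : ℂ} (hs : 1 / 4 ≤ s.re) :
    ‖riemannZeta₁ s‖ ≤ 5 * (1 + ‖s‖) ^ 2 := by
  have hs0 : 0 < s.re := by linarith
  rw [riemannZeta₁_eq hs0]
  have h1 := norm_integral_fract_le hs0
  have h2 : 1 / s.re ≤ 4 := by rw [div_le_iff₀ hs0]; linarith
  have h3 : ‖s - 1‖ ≤ ‖s‖ + 1 := by simpa using norm_sub_le s 1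
  refine (norm_sub_le _ _).trans ?_
  rw [norm_mul, norm_mul]
  have h4 : ‖s‖ * ‖s - 1‖ ≤ ‖s‖ * (‖s‖ + 1) := by gcongr
  have h5 := mul_le_mul h4 (h1.trans h2) (norm_nonneg _) (by positivity)
  nlinarith [norm_nonneg s]

theorem riemannZeta_half_ne_zero : riemannZeta (1 / 2) ≠ 0 := by
  intro h0
  have hne : (1 / 2 : ℂ) ≠ 1 := by norm_num
  have h1 : riemannZeta₁ (1 / 2) = 0 := by rw [riemannZeta₁_eq_of_ne_one hne, h0, mul_zero]
  rw [riemannZeta₁_eq (by norm_num)] at h1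
  have h2 : ∫ t in Set.Ioi (1 : ℝ), ((Int.fract t : ℝ) : ℂ) * (t : ℂ) ^ (-((1 / 2 : ℂ) + 1))
      = ((∫ t in Set.Ioi (1 : ℝ), Int.fract t * t ^ (-((1 / 2 : ℝ) + 1)) : ℝ) : ℂ) := by
    rw [← integral_complex_ofReal]
    refine setIntegral_congr_fun measurableSet_Ioi fun t ht => ?_
    have ht : (1 : ℝ) < t := ht
    rw [Complex.ofReal_mul, Complex.ofReal_cpow (by linarith)]
    push_cast
    rfl
  have h3 : 0 ≤ ∫ t in Set.Ioi (1 : ℝ), Int.fract t * t ^ (-((1 / 2 : ℝ) + 1)) := by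
    refine setIntegral_nonneg measurableSet_Ioi fun t ht => ?_
    have ht : (1 : ℝ) < t := ht
    exact mul_nonneg (Int.fract_nonneg t) (Real.rpow_nonneg (by linarith) _)
  rw [h2] at h1
  generalize (∫ t in Set.Ioi (1 : ℝ), Int.fract t * t ^ (-((1 / 2 : ℝ) + 1))) = J at h1 h3
  have h4 : (1 / 2 : ℝ) + 1 / 4 * J = 0 := by
    have : (((1 / 2 : ℝ) + 1 / 4 * J : ℝ) : ℂ) = 0 := by
      push_cast; rw [← h1]; ring
    exact_mod_cast this
  linarith

/-- The algebra of trigonometric polynomials on `ℝ`. -/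
def trigPoly : Subalgebra ℂ (ℝ → ℂ) :=
  Algebra.adjoin ℂ (Set.range fun (l : ℝ) (y : ℝ) => Complex.exp (l * y * Complex.I))

theorem exp_mem_trigPoly (l : ℝ) : (fun y : ℝ => Complex.exp (l * y * Complex.I)) ∈ trigPoly :=
  Algebra.subset_adjoin ⟨l, rfl⟩

theorem norm_exp_ofReal_mul_ofReal_mul_I (l y : ℝ) :
    ‖Complex.exp (l * y * Complex.I)‖ = 1 := by
  rw [← Complex.ofReal_mul, Complex.norm_exp_ofReal_mul_I]

theorem continuous_of_mem_trigPoly {p : ℝ → ℂ} (hp : p ∈ trigPoly) : Continuous p := by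
  induction hp using Algebra.adjoin_induction with
  | mem x hx => obtain ⟨l, rfl⟩ := hx; fun_prop
  | algebraMap r => exact continuous_const
  | add x y _ _ hx hy => exact hx.add hy
  | mul x y _ _ hx hy => exact hx.mul hy

theorem exists_norm_le_of_mem_trigPoly {p : ℝ → ℂ} (hp : p ∈ trigPoly) :
    ∃ B, ∀ y, ‖p y‖ ≤ B := by
  induction hp using Algebra.adjoin_induction with
  | mem x hx =>
    obtain ⟨l, rfl⟩ := hx
    exact ⟨1, fun y => (norm_exp_ofReal_mul_ofReal_mul_I l y).le⟩
  | algebraMap r => exact ⟨‖r‖, fun y => le_rfl⟩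
  | add x y _ _ hx hy =>
    obtain ⟨A, hA⟩ := hx
    obtain ⟨B, hB⟩ := hy
    exact ⟨A + B, fun t => (norm_add_le _ _).trans (add_le_add (hA t) (hB t))⟩
  | mul x y _ _ hx hy =>
    obtain ⟨A, hA⟩ := hx
    obtain ⟨B, hB⟩ := hy
    exact ⟨A * B, fun t => (norm_mul_le _ _).trans
      (mul_le_mul (hA t) (hB t) (norm_nonneg _) ((norm_nonneg _).trans (hA t)))⟩

theorem conj_mem_trigPoly {p : ℝ → ℂ} (hp : p ∈ trigPoly) :
    (fun y => (starRingEnd ℂ) (p y)) ∈ trigPoly := by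
  induction hp using Algebra.adjoin_induction with
  | mem x hx =>
    obtain ⟨l, rfl⟩ := hx
    convert! exp_mem_trigPoly (-l) using 2 with y
    rw [← Complex.exp_conj]
    simp
  | algebraMap r => exact trigPoly.algebraMap_mem ((starRingEnd ℂ) r)
  | add x y _ _ hx hy =>
    convert! trigPoly.add_mem hx hy using 2
    simp
  | mul x y _ _ hx hy =>
    convert! trigPoly.mul_mem hx hy using 2
    simp

theorem re_mem_trigPoly {p : ℝ → ℂ} (hp : p ∈ trigPoly) :
    (fun y => ((p y).re : ℂ)) ∈ trigPoly := by
  convert! trigPoly.smul_mem (trigPoly.add_mem hp (conj_mem_trigPoly hp)) (1 / 2 : ℂ) using 2 with y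
  rw [Pi.smul_apply, Pi.add_apply, Complex.add_conj, smul_eq_mul]
  push_cast
  ring

/-- The function `g` has a mean value on the half-line. -/
def HasMean (g : ℝ → ℂ) : Prop :=
  ∃ m : ℂ, Tendsto (fun Y : ℝ => (1 / Y : ℂ) * ∫ y in (0 : ℝ)..Y, g y) atTop (𝓝 m)

theorem hasMean_exp (l : ℝ) : HasMean fun y : ℝ => Complex.exp (l * y * Complex.I) := by
  rcases eq_or_ne l 0 with rfl | hl
  · refine ⟨1, (tendsto_congr' ?_).mpr tendsto_const_nhds⟩
    filter_upwards [eventually_gt_atTop 0] with Y hY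
    have : (Y : ℂ) ≠ 0 := by exact_mod_cast hY.ne'
    simp [this]
  · refine ⟨0, ?_⟩
    rw [tendsto_zero_iff_norm_tendsto_zero]
    have h1 : Tendsto (fun Y : ℝ => Y⁻¹ * (2 / |l|)) atTop (𝓝 0) := by
      simpa using tendsto_inv_atTop_zero.mul_const (2 / |l|)
    refine squeeze_zero' (Eventually.of_forall fun _ => norm_nonneg _) ?_ h1
    filter_upwards [eventually_gt_atTop 0] with Y hY
    have hc : ((l : ℂ) * Complex.I) ≠ 0 := by simp [hl]
    have h2 : ∫ y in (0 : ℝ)..Y, Complex.exp (l * y * Complex.I)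
        = (Complex.exp (l * Y * Complex.I) - 1) / (l * Complex.I) := by
      have := integral_exp_mul_complex (a := 0) (b := Y) hc
      simp only [mul_right_comm _ Complex.I, Complex.ofReal_zero, mul_zero, zero_mul,
        Complex.exp_zero] at this
      exact this
    rw [h2, norm_mul, norm_div, norm_div, norm_mul]
    simp only [norm_one, Complex.norm_real, Complex.norm_I, mul_one, Real.norm_eq_abs,
      abs_of_pos hY, one_div]
    gcongr
    refine (norm_sub_le _ _).trans ?_
    rw [norm_exp_ofReal_mul_ofReal_mul_I]
    norm_num

theorem hasMean_of_mem_trigPoly {p : ℝ → ℂ} (hp : p ∈ trigPoly) : HasMean p := by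
  have hsub : (Submonoid.closure
      (Set.range fun (l : ℝ) (y : ℝ) => Complex.exp (l * y * Complex.I)) : Set (ℝ → ℂ))
      ⊆ Set.range fun (l : ℝ) (y : ℝ) => Complex.exp (l * y * Complex.I) := by
    intro q hq
    induction hq using Submonoid.closure_induction with
    | mem x hx => exact hx
    | one => exact ⟨0, by funext y; simp⟩
    | mul x y _ _ hx hy =>
      obtain ⟨l, rfl⟩ := hx
      obtain ⟨k, rfl⟩ := hy
      refine ⟨l + k, ?_⟩
      funext y
      rw [Pi.mul_apply, ← Complex.exp_add]
      push_cast
      ring_nf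
  have hp' : p ∈ Submodule.span ℂ
      (Set.range fun (l : ℝ) (y : ℝ) => Complex.exp (l * y * Complex.I)) := by
    have : p ∈ Subalgebra.toSubmodule trigPoly := hp
    rw [trigPoly, Algebra.adjoin_eq_span] at this
    exact Submodule.span_mono hsub this
  clear hp
  have hc : Continuous p ∧ HasMean p := by
    induction hp' using Submodule.span_induction with
    | mem x hx =>
      obtain ⟨l, rfl⟩ := hx
      exact ⟨by fun_prop, hasMean_exp l⟩
    | zero => exact ⟨continuous_zero, 0, by simp⟩
    | add x y _ _ hx hy =>
      obtain ⟨hxc, m, hm⟩ := hx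
      obtain ⟨hyc, k, hk⟩ := hy
      refine ⟨hxc.add hyc, m + k, (hm.add hk).congr fun Y => ?_⟩
      simp only [Pi.add_apply]
      rw [intervalIntegral.integral_add (hxc.intervalIntegrable _ _)
        (hyc.intervalIntegrable _ _), mul_add]
    | smul a x _ hx =>
      obtain ⟨hxc, m, hm⟩ := hx
      refine ⟨hxc.const_smul a, a * m, (hm.const_mul a).congr fun Y => ?_⟩
      simp only [Pi.smul_apply, smul_eq_mul]
      rw [intervalIntegral.integral_const_mul]
      ring
  exact hc.2

theorem exists_tendsto_of_forall_exists_norm_sub_le {c : ℝ → ℂ}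
    (h : ∀ ε > 0, ∃ (g : ℝ → ℂ) (m : ℂ), Tendsto g atTop (𝓝 m) ∧
      ∀ᶠ Y in atTop, ‖c Y - g Y‖ ≤ ε) :
    ∃ m, Tendsto c atTop (𝓝 m) := by
  refine cauchySeq_tendsto_of_complete (Metric.cauchySeq_iff'.mpr fun ε hε => ?_)
  obtain ⟨g, m, hg, hcg⟩ := h (ε / 5) (by positivity)
  have h1 := Metric.tendsto_nhds.mp hg (ε / 5) (by positivity)
  obtain ⟨N, hN⟩ := eventually_atTop.mp (h1.and hcg)
  refine ⟨N, fun n hn => ?_⟩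
  have a1 := hN n hn
  have a2 := hN N le_rfl
  rw [← dist_eq_norm] at a1 a2
  have := dist_triangle4 (c n) (g n) (g N) (c N)
  have := dist_triangle_right (g n) (g N) m
  rw [dist_comm (g N) (c N)] at *
  linarith [a1.1, a1.2, a2.1, a2.2]

theorem hasMean_of_forall_exists_norm_sub_le {q : ℝ → ℂ} (hq : Continuous q)
    (h : ∀ ε > 0, ∃ p ∈ trigPoly, ∀ y, ‖q y - p y‖ ≤ ε) : HasMean q := by
  refine exists_tendsto_of_forall_exists_norm_sub_le fun ε hε => ?_
  obtain ⟨p, hp, hpq⟩ := h ε hε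
  obtain ⟨m, hm⟩ := hasMean_of_mem_trigPoly hp
  refine ⟨_, m, hm, ?_⟩
  filter_upwards [eventually_gt_atTop 0] with Y hY
  rw [← mul_sub, ← intervalIntegral.integral_sub (hq.intervalIntegrable _ _)
    ((continuous_of_mem_trigPoly hp).intervalIntegrable _ _), norm_mul]
  have h1 := intervalIntegral.norm_integral_le_of_norm_le_const (a := 0) (b := Y)
    (f := fun y => q y - p y) (C := ε) fun y _ => hpq y
  rw [sub_zero, abs_of_pos hY] at h1
  have h2 : ‖(1 / Y : ℂ)‖ = 1 / Y := by
    rw [norm_div, norm_one, Complex.norm_real, Real.norm_eq_abs, abs_of_pos hY]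
  rw [h2, div_mul_eq_mul_div, one_mul, div_le_iff₀ hY]
  exact h1

theorem hasMean_cexp_of_mem_trigPoly {p : ℝ → ℂ} (hp : p ∈ trigPoly) :
    HasMean fun y => Complex.exp (p y) := by
  refine hasMean_of_forall_exists_norm_sub_le
    (Complex.continuous_exp.comp (continuous_of_mem_trigPoly hp)) fun ε hε => ?_
  obtain ⟨B, hB⟩ := exists_norm_le_of_mem_trigPoly hp
  have hB0 : 0 ≤ B := (norm_nonneg _).trans (hB 0)
  have h1 : Tendsto (fun n : ℕ => B ^ n / n.factorial * 2) atTop (𝓝 0) := by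
    simpa using (FloorSemiring.tendsto_pow_div_factorial_atTop B).mul_const 2
  obtain ⟨n, hn, hn2⟩ := ((h1.eventually_lt_const hε).and
    (eventually_ge_atTop ⌈2 * B⌉₊)).exists
  refine ⟨∑ m ∈ Finset.range n, (1 / m.factorial : ℂ) • p ^ m, ?_, fun y => ?_⟩
  · exact trigPoly.sum_mem fun m _ => trigPoly.smul_mem (trigPoly.pow_mem hp m) _
  · have h2 : ‖p y‖ / n.succ ≤ 1 / 2 := by
      rw [div_le_iff₀ (by positivity)]
      have := Nat.le_of_ceil_le hn2
      have := hB y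
      push_cast
      linarith
    have h3 := Complex.exp_bound' h2
    have h4 : (∑ m ∈ Finset.range n, (1 / m.factorial : ℂ) • p ^ m) y
        = ∑ m ∈ Finset.range n, p y ^ m / m.factorial := by
      rw [Finset.sum_apply]
      refine Finset.sum_congr rfl fun m _ => ?_
      rw [Pi.smul_apply, Pi.pow_apply, smul_eq_mul]
      ring
    rw [h4]
    refine h3.trans (le_trans ?_ hn.le)
    gcongr
    exact hB y

theorem exists_probabilityMeasure_charFun_eq {μ : ℕ → ProbabilityMeasure ℝ} {f : ℝ → ℂ}
    (hf : ContinuousAt f 0)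
    (h : ∀ t, Tendsto (fun n => charFun (μ n : Measure ℝ) t) atTop (𝓝 (f t))) :
    ∃ μ₀ : ProbabilityMeasure ℝ, ∀ t, charFun (μ₀ : Measure ℝ) t = f t := by
  have h_tight : IsTightMeasureSet (Set.range fun n => (μ n : Measure ℝ)) :=
    isTightMeasureSet_of_tendsto_charFun hf h
  have h_compact : IsCompact (closure (Set.range μ)) := by
    refine isCompact_closure_of_isTightMeasureSet ?_
    convert! h_tight using 1
    ext ν
    simp
  obtain ⟨μ', -, hμ'⟩ := h_compact.ultrafilter_le_nhds ((Filter.hyperfilter ℕ).map μ)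
    (le_principal_iff.mpr (mem_of_superset (image_mem_map univ_mem)
      (Set.image_univ.le.trans subset_closure)))
  refine ⟨μ', fun t => ?_⟩
  have hU : (Filter.hyperfilter ℕ : Filter ℕ) ≤ atTop := by
    rw [← Nat.cofinite_eq_atTop]
    exact Filter.hyperfilter_le_cofinite
  have hμ'' : Tendsto μ (Filter.hyperfilter ℕ) (𝓝 μ') := hμ'
  rw [ProbabilityMeasure.tendsto_iff_forall_integral_rclike_tendsto ℂ] at hμ''
  refine tendsto_nhds_unique ?_ ((h t).mono_left hU)
  simp_rw [charFun_eq_integral_innerProbChar]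
  exact hμ'' _

/-- The distribution of `φ` on `(0, Y]`. -/
noncomputable def distOn (φ : ℝ → ℝ) (Y : ℝ) : Measure ℝ :=
  (ENNReal.ofReal (1 / Y) • volume.restrict (Set.Ioc 0 Y)).map φ

theorem isProbabilityMeasure_distOn {φ : ℝ → ℝ} (hφ : Measurable φ) {Y : ℝ} (hY : 0 < Y) :
    IsProbabilityMeasure (distOn φ Y) := by
  refine ⟨?_⟩
  rw [distOn, Measure.map_apply hφ MeasurableSet.univ, Set.preimage_univ, Measure.smul_apply,
    Measure.restrict_apply_univ, Real.volume_Ioc, smul_eq_mul,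
    ← ENNReal.ofReal_mul (by positivity), sub_zero, one_div_mul_cancel hY.ne', ENNReal.ofReal_one]

theorem integral_distOn {E : Type*} [NormedAddCommGroup E] [NormedSpace ℝ E] {φ : ℝ → ℝ}
    (hφ : Measurable φ) {Y : ℝ} (hY : 0 < Y) {f : ℝ → E} (hf : StronglyMeasurable f) :
    ∫ x, f x ∂(distOn φ Y) = (1 / Y) • ∫ y in (0 : ℝ)..Y, f (φ y) := by
  rw [distOn, integral_map_of_stronglyMeasurable hφ hf, integral_smul_measure,
    intervalIntegral.integral_of_le hY.le, ENNReal.toReal_ofReal (by positivity)]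

theorem hasLimitingDist_of_tendsto {φ : ℝ → ℝ} (hφ : Measurable φ) {c : ℝ → ℂ}
    (hc0 : ContinuousAt c 0)
    (hc : ∀ t : ℝ, Tendsto (fun Y : ℝ => (1 / Y : ℂ) *
      ∫ y in (0 : ℝ)..Y, Complex.exp (t * φ y * Complex.I)) atTop (𝓝 (c t))) :
    HasLimitingDist φ := by
  classical
  let ν : ℝ → ProbabilityMeasure ℝ := fun Y =>
    if hY : 0 < Y then ⟨distOn φ Y, isProbabilityMeasure_distOn hφ hY⟩
    else ⟨Measure.dirac 0, inferInstance⟩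
  have hν : ∀ Y, 0 < Y → (ν Y : Measure ℝ) = distOn φ Y := fun Y hY => by simp [ν, hY]
  have hchar : ∀ t : ℝ, Tendsto (fun Y => charFun (ν Y : Measure ℝ) t) atTop (𝓝 (c t)) := by
    intro t
    refine (hc t).congr' ?_
    filter_upwards [eventually_gt_atTop 0] with Y hY
    rw [hν Y hY, charFun_apply_real, integral_distOn hφ hY
      (Continuous.stronglyMeasurable (by fun_prop)), Complex.real_smul]
    push_cast
    rfl
  obtain ⟨μ₀, hμ₀⟩ := exists_probabilityMeasure_charFun_eq hc0
    fun t => (hchar t).comp tendsto_natCast_atTop_atTop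
  refine ⟨μ₀, inferInstance, fun f => ?_⟩
  refine tendsto_of_seq_tendsto fun u hu => ?_
  have h1 : Tendsto (fun n => ν (u n)) atTop (𝓝 μ₀) :=
    ProbabilityMeasure.tendsto_of_tendsto_charFun fun t => by
      rw [hμ₀]
      exact (hchar t).comp hu
  rw [ProbabilityMeasure.tendsto_iff_forall_integral_tendsto] at h1
  refine (h1 f).congr' ?_
  filter_upwards [hu.eventually_gt_atTop 0] with n hn
  rw [hν _ hn, integral_distOn hφ hn f.continuous.stronglyMeasurable, smul_eq_mul]
  rfl

theorem norm_cexp_ofReal_mul_I_sub_le (a b : ℝ) :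
    ‖Complex.exp (a * Complex.I) - Complex.exp (b * Complex.I)‖ ≤ |a - b| := by
  have h : Complex.exp (a * Complex.I) - Complex.exp (b * Complex.I)
      = Complex.exp (b * Complex.I) * (Complex.exp (Complex.I * ((a - b : ℝ) : ℂ)) - 1) := by
    rw [mul_sub, ← Complex.exp_add, mul_one]
    push_cast
    ring_nf
  rw [h, norm_mul, Complex.norm_exp_ofReal_mul_I, one_mul]
  exact Real.norm_exp_I_mul_ofReal_sub_one_le

theorem intervalIntegrable_of_measurable_of_bounded {φ : ℝ → ℝ} (hφ : Measurable φ)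
    (hloc : ∀ Y, ∃ B, ∀ y ∈ Set.Ioc 0 Y, |φ y| ≤ B) {Y : ℝ} (hY : 0 ≤ Y) :
    IntervalIntegrable φ volume 0 Y := by
  obtain ⟨B, hB⟩ := hloc Y
  rw [intervalIntegrable_iff_integrableOn_Ioc_of_le hY]
  exact IntegrableOn.of_bound measure_Ioc_lt_top hφ.aestronglyMeasurable B
    ((ae_restrict_iff' measurableSet_Ioc).mpr (Eventually.of_forall fun y hy => hB y hy))

theorem norm_mean_cexp_sub_le {φ ψ : ℝ → ℝ} (hφm : Measurable φ) (hψm : Measurable ψ) {Y : ℝ}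
    (hY : 0 < Y) (hφ : IntervalIntegrable φ volume 0 Y) (hψ : IntervalIntegrable ψ volume 0 Y)
    {η : ℝ} (h : ∫ y in (0 : ℝ)..Y, |φ y - ψ y| ≤ η * Y) (t : ℝ) :
    ‖(1 / Y : ℂ) * (∫ y in (0 : ℝ)..Y, Complex.exp (t * φ y * Complex.I))
      - (1 / Y : ℂ) * ∫ y in (0 : ℝ)..Y, Complex.exp (t * ψ y * Complex.I)‖ ≤ |t| * η := by
  have hint : ∀ f : ℝ → ℝ, Measurable f →
      IntervalIntegrable (fun y => Complex.exp (t * f y * Complex.I)) volume 0 Y := fun f hf => by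
    rw [intervalIntegrable_iff_integrableOn_Ioc_of_le hY.le]
    refine IntegrableOn.of_bound measure_Ioc_lt_top (by fun_prop) 1
      (Eventually.of_forall fun y => (norm_exp_ofReal_mul_ofReal_mul_I _ _).le)
  rw [← mul_sub, ← intervalIntegral.integral_sub (hint φ hφm) (hint ψ hψm), norm_mul]
  have h2 : ‖(1 / Y : ℂ)‖ = 1 / Y := by
    rw [norm_div, norm_one, Complex.norm_real, Real.norm_eq_abs, abs_of_pos hY]
  have h3 : ‖∫ y in (0 : ℝ)..Y,
      (Complex.exp (t * φ y * Complex.I) - Complex.exp (t * ψ y * Complex.I))‖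
      ≤ ∫ y in (0 : ℝ)..Y, |t| * |φ y - ψ y| := by
    refine intervalIntegral.norm_integral_le_of_norm_le hY.le
      (Eventually.of_forall fun y _ => ?_) ((hφ.sub hψ).abs.const_mul _)
    have := norm_cexp_ofReal_mul_I_sub_le (t * φ y) (t * ψ y)
    rw [← mul_sub, abs_mul] at this
    simpa only [Complex.ofReal_mul] using this
  rw [intervalIntegral.integral_const_mul] at h3
  rw [h2, div_mul_eq_mul_div, one_mul, div_le_iff₀ hY]
  refine h3.trans ?_
  rw [mul_assoc]
  gcongr

/-- A function that can be approximated by trigonometric polynomials in mean square possesses a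
limiting distribution. -/
theorem hasLimitingDist_of_forall_trigPoly {φ : ℝ → ℝ} (hφ : Measurable φ)
    (hloc : ∀ Y, ∃ B, ∀ y ∈ Set.Ioc 0 Y, |φ y| ≤ B)
    (h : ∀ ε > 0, ∃ p ∈ trigPoly, ∀ᶠ Y : ℝ in atTop,
      ∫ y in (0 : ℝ)..Y, ‖(φ y : ℂ) - p y‖ ^ 2 ≤ ε * Y) :
    HasLimitingDist φ := by
  have hint : ∀ {Y : ℝ}, 0 ≤ Y → IntervalIntegrable φ volume 0 Y := fun hY =>
    intervalIntegrable_of_measurable_of_bounded hφ hloc hY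
  have h1 : ∀ η > 0, ∃ p ∈ trigPoly, ∀ᶠ Y : ℝ in atTop,
      ∫ y in (0 : ℝ)..Y, |φ y - (p y).re| ≤ η * Y := by
    intro η hη
    obtain ⟨p, hp, hpY⟩ := h (η ^ 2) (by positivity)
    refine ⟨p, hp, ?_⟩
    have hpc := continuous_of_mem_trigPoly hp
    filter_upwards [hpY, eventually_gt_atTop 0] with Y hY hY0
    have hint2 : IntervalIntegrable (fun y => ‖(φ y : ℂ) - p y‖ ^ 2) volume 0 Y := by
      obtain ⟨B, hB⟩ := hloc Y
      obtain ⟨A, hA⟩ := exists_norm_le_of_mem_trigPoly hp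
      rw [intervalIntegrable_iff_integrableOn_Ioc_of_le hY0.le]
      refine IntegrableOn.of_bound measure_Ioc_lt_top
        (((Complex.measurable_ofReal.comp hφ).sub hpc.measurable).norm.pow_const
          2).aestronglyMeasurable ((B + A) ^ 2)
        ((ae_restrict_iff' measurableSet_Ioc).mpr (Eventually.of_forall fun y hy => ?_))
      rw [norm_pow, norm_norm]
      gcongr
      refine (norm_sub_le _ _).trans (add_le_add ?_ (hA y))
      rw [Complex.norm_real]
      exact hB y hy
    have h2 : ∫ y in (0 : ℝ)..Y, |φ y - (p y).re|
        ≤ ∫ y in (0 : ℝ)..Y, (η / 2 + (1 / (2 * η)) * ‖(φ y : ℂ) - p y‖ ^ 2) := by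
      refine intervalIntegral.integral_mono_on hY0.le
        ((hint hY0.le).sub ((Complex.continuous_re.comp hpc).intervalIntegrable _ _)).abs
        (intervalIntegrable_const.add (hint2.const_mul _)) fun y _ => ?_
      have h3 : |φ y - (p y).re| ≤ ‖(φ y : ℂ) - p y‖ := by
        simpa using Complex.abs_re_le_norm ((φ y : ℂ) - p y)
      refine h3.trans ?_
      set x := ‖(φ y : ℂ) - p y‖
      have h4 : η / 2 + 1 / (2 * η) * x ^ 2 - x = (η - x) ^ 2 / (2 * η) := by
        field_simp
        ring
      have h5 : 0 ≤ (η - x) ^ 2 / (2 * η) := by positivity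
      linarith
    refine h2.trans ?_
    rw [intervalIntegral.integral_add intervalIntegrable_const (hint2.const_mul _),
      intervalIntegral.integral_const_mul, intervalIntegral.integral_const, smul_eq_mul, sub_zero]
    have h6 : 1 / (2 * η) * ∫ y in (0 : ℝ)..Y, ‖(φ y : ℂ) - p y‖ ^ 2
        ≤ 1 / (2 * η) * (η ^ 2 * Y) := by gcongr
    have h7 : 1 / (2 * η) * (η ^ 2 * Y) = η / 2 * Y := by field_simp
    linarith
  have hc : ∀ t : ℝ, ∃ c : ℂ, Tendsto (fun Y : ℝ => (1 / Y : ℂ) *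
      ∫ y in (0 : ℝ)..Y, Complex.exp (t * φ y * Complex.I)) atTop (𝓝 c) := by
    intro t
    refine exists_tendsto_of_forall_exists_norm_sub_le fun ε hε => ?_
    obtain ⟨p, hp, hpY⟩ := h1 (ε / (|t| + 1)) (by positivity)
    have hpc := continuous_of_mem_trigPoly hp
    obtain ⟨m, hm⟩ := hasMean_cexp_of_mem_trigPoly
      (trigPoly.smul_mem (re_mem_trigPoly hp) (t * Complex.I))
    refine ⟨_, m, hm, ?_⟩
    filter_upwards [hpY, eventually_gt_atTop 0] with Y hY hY0
    have h2 := norm_mean_cexp_sub_le hφ (Complex.continuous_re.comp hpc).measurable hY0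
      (hint hY0.le) ((Complex.continuous_re.comp hpc).intervalIntegrable _ _) hY t
    have h3 : |t| * (ε / (|t| + 1)) ≤ ε := by
      rw [mul_div_assoc', div_le_iff₀ (by positivity)]
      nlinarith [abs_nonneg t]
    refine le_trans (le_of_eq ?_) (h2.trans h3)
    simp only [Pi.smul_apply, smul_eq_mul, Function.comp_apply, mul_right_comm _ Complex.I]
  choose c hc using hc
  refine hasLimitingDist_of_tendsto hφ ?_ hc
  obtain ⟨p, hp, hpY⟩ := h1 1 one_pos
  obtain ⟨B, hB⟩ := exists_norm_le_of_mem_trigPoly hp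
  have hpc := continuous_of_mem_trigPoly hp
  have hB0 : 0 ≤ B := (norm_nonneg _).trans (hB 0)
  have hc1 : ∀ t, ‖c t - 1‖ ≤ |t| * (1 + B) := by
    intro t
    refine le_of_tendsto ((hc t).sub_const 1).norm ?_
    filter_upwards [hpY, eventually_gt_atTop 0] with Y hY hY0
    have h2 : ∫ y in (0 : ℝ)..Y, |φ y - 0| ≤ (1 + B) * Y := by
      have hi1 : IntervalIntegrable (fun y => |φ y - (p y).re|) volume 0 Y :=
        ((hint hY0.le).sub ((Complex.continuous_re.comp hpc).intervalIntegrable _ _)).abs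
      have h3 : ∫ y in (0 : ℝ)..Y, |φ y - 0|
          ≤ ∫ y in (0 : ℝ)..Y, (|φ y - (p y).re| + B) := by
        refine intervalIntegral.integral_mono_on hY0.le
          ((hint hY0.le).sub intervalIntegrable_const).abs
          (hi1.add intervalIntegrable_const) fun y _ => ?_
        have h4 := (Complex.abs_re_le_norm (p y)).trans (hB y)
        have h5 := abs_add_le (φ y - (p y).re) (p y).re
        rw [sub_add_cancel] at h5
        rw [sub_zero]
        linarith
      rw [intervalIntegral.integral_add hi1 intervalIntegrable_const,
        intervalIntegral.integral_const, smul_eq_mul, sub_zero] at h3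
      linarith
    have h6 := norm_mean_cexp_sub_le hφ (measurable_const (a := (0 : ℝ))) hY0 (hint hY0.le)
      intervalIntegrable_const h2 t
    have hY' : (Y : ℂ) ≠ 0 := by exact_mod_cast hY0.ne'
    simpa [hY'] using h6
  have hc2 : c 0 = 1 := by
    have := hc1 0
    simpa [sub_eq_zero] using this
  rw [Metric.continuousAt_iff]
  intro ε hε
  refine ⟨ε / (1 + B), by positivity, fun {t} ht => ?_⟩
  rw [dist_eq_norm, sub_zero, Real.norm_eq_abs, lt_div_iff₀ (by positivity)] at ht
  rw [hc2, dist_eq_norm]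
  exact (hc1 t).trans_lt ht

theorem lintegral_le_of_ae_tendsto {α : Type*} [MeasurableSpace α] {μ : Measure α}
    {f : ℕ → α → ℝ≥0∞} {g : α → ℝ≥0∞} {K : ℝ≥0∞} (hf : ∀ n, AEMeasurable (f n) μ)
    (hfg : ∀ᵐ x ∂μ, Tendsto (fun n => f n x) atTop (𝓝 (g x))) (hK : ∀ n, ∫⁻ x, f n x ∂μ ≤ K) :
    ∫⁻ x, g x ∂μ ≤ K := by
  calc ∫⁻ x, g x ∂μ = ∫⁻ x, liminf (fun n => f n x) atTop ∂μ :=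
        lintegral_congr_ae (hfg.mono fun x hx => hx.liminf_eq.symm)
    _ ≤ liminf (fun n => ∫⁻ x, f n x ∂μ) atTop := lintegral_liminf_le' hf
    _ ≤ liminf (fun _ => K) atTop := liminf_le_liminf (Eventually.of_forall hK)
    _ = K := by simp

/-- The Fourier transform of the Gaussian `exp (-b τ²)`. -/
noncomputable def gaussKernel (b x : ℝ) : ℝ :=
  Real.sqrt (Real.pi / b) * Real.exp (-(1 / (4 * b)) * x ^ 2)

theorem integral_exp_mul_gaussian {b : ℝ} (hb : 0 < b) (x : ℝ) :
    ∫ t : ℝ, Complex.exp (t * x * Complex.I) * Real.exp (-b * t ^ 2) = gaussKernel b x := by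
  have h := fourierIntegral_gaussian (b := (b : ℂ)) (by simpa using hb) (x : ℂ)
  have h1 : (Real.pi / b : ℂ) ^ (1 / 2 : ℂ) = ((Real.sqrt (Real.pi / b) : ℝ) : ℂ) := by
    rw [Real.sqrt_eq_rpow, Complex.ofReal_cpow (by positivity)]
    push_cast
    rfl
  rw [h1] at h
  rw [gaussKernel, Complex.ofReal_mul]
  convert h using 3 with t
  · push_cast
    ring_nf
  · push_cast
    ring_nf

theorem gaussKernel_nonneg (b x : ℝ) : 0 ≤ gaussKernel b x := by
  unfold gaussKernel; positivity

theorem continuous_gaussKernel (b : ℝ) : Continuous (gaussKernel b) := by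
  unfold gaussKernel; fun_prop

theorem integrable_gaussKernel {b : ℝ} (hb : 0 < b) : Integrable (gaussKernel b) :=
  (integrable_exp_neg_mul_sq (b := 1 / (4 * b)) (by positivity)).const_mul _

theorem integral_gaussKernel {b : ℝ} (hb : 0 < b) : ∫ x, gaussKernel b x = 2 * Real.pi := by
  unfold gaussKernel
  rw [integral_const_mul, integral_gaussian, ← Real.sqrt_mul (by positivity),
    show Real.pi / b * (Real.pi / (1 / (4 * b))) = (2 * Real.pi) ^ 2 by field_simp; ring,
    Real.sqrt_sq (by positivity)]

theorem lintegral_gaussKernel {b : ℝ} (hb : 0 < b) :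
    ∫⁻ x, ENNReal.ofReal (gaussKernel b x) = ENNReal.ofReal (2 * Real.pi) := by
  rw [← ofReal_integral_eq_lintegral_ofReal (integrable_gaussKernel hb)
    (Eventually.of_forall (gaussKernel_nonneg b)), integral_gaussKernel hb]

theorem continuous_integral_mul_exp {G : ℝ → ℂ} (hG : Integrable G) :
    Continuous fun v : ℝ => ∫ t : ℝ, G t * Complex.exp (t * v * Complex.I) := by
  refine continuous_of_dominated (bound := fun t => ‖G t‖) ?_ ?_ hG.norm ?_
  · exact fun v => hG.1.mul (Continuous.aestronglyMeasurable (by fun_prop))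
  · exact fun v => Eventually.of_forall fun t => by
      rw [norm_mul, norm_exp_ofReal_mul_ofReal_mul_I, mul_one]
  · exact Eventually.of_forall fun t => by fun_prop

theorem integral_normSq_fourier_mul_gaussian {G : ℝ → ℂ} (hG : Integrable G) {b : ℝ} (hb : 0 < b) :
    ∫ v : ℝ, ((‖∫ t : ℝ, G t * Complex.exp (t * v * Complex.I)‖ ^ 2
        * Real.exp (-b * v ^ 2) : ℝ) : ℂ)
      = ∫ p : ℝ × ℝ, G p.1 * (starRingEnd ℂ) (G p.2) * gaussKernel b (p.1 - p.2) := by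
  have hc : Integrable (fun t => (starRingEnd ℂ) (G t)) :=
    Complex.conjCLE.toContinuousLinearMap.integrable_comp hG
  have h1 : ∀ v : ℝ,
      ((‖∫ t : ℝ, G t * Complex.exp (t * v * Complex.I)‖ ^ 2 * Real.exp (-b * v ^ 2) : ℝ) : ℂ)
      = ∫ p : ℝ × ℝ, G p.1 * (starRingEnd ℂ) (G p.2) *
        (Complex.exp (v * (p.1 - p.2 : ℝ) * Complex.I) * Real.exp (-b * v ^ 2)) := by
    intro v
    have h2 : (starRingEnd ℂ) (∫ t : ℝ, G t * Complex.exp (t * v * Complex.I))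
        = ∫ t : ℝ, (starRingEnd ℂ) (G t) * Complex.exp (-(t * v * Complex.I)) := by
      rw [← integral_conj]
      refine integral_congr_ae (Eventually.of_forall fun t => ?_)
      simp only [map_mul, ← Complex.exp_conj, Complex.conj_ofReal, Complex.conj_I, mul_neg]
    rw [Complex.ofReal_mul, Complex.ofReal_pow, ← Complex.mul_conj', h2,
      ← integral_prod_mul, ← integral_mul_const]
    refine integral_congr_ae (Eventually.of_forall fun p => ?_)
    have h3 : Complex.exp (v * (p.1 - p.2 : ℝ) * Complex.I)
        = Complex.exp (p.1 * v * Complex.I) * Complex.exp (-(p.2 * v * Complex.I)) := by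
      rw [← Complex.exp_add]
      push_cast
      ring_nf
    simp only [h3]
    ring
  simp_rw [h1]
  have hint : Integrable (Function.uncurry fun (v : ℝ) (p : ℝ × ℝ) =>
      G p.1 * (starRingEnd ℂ) (G p.2) *
        (Complex.exp (v * (p.1 - p.2 : ℝ) * Complex.I) * Real.exp (-b * v ^ 2)))
      ((volume : Measure ℝ).prod (volume : Measure (ℝ × ℝ))) := by
    have h4 : Integrable (fun v : ℝ => ((Real.exp (-b * v ^ 2) : ℝ) : ℂ)) :=
      (integrable_exp_neg_mul_sq hb).ofReal
    have h5 := h4.mul_prod (hG.mul_prod hc)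
    refine (h5.bdd_mul (c := 1)
      (f := fun q : ℝ × ℝ × ℝ => Complex.exp (q.1 * (q.2.1 - q.2.2 : ℝ) * Complex.I))
      (Continuous.aestronglyMeasurable (by fun_prop))
      (Eventually.of_forall fun q => (norm_exp_ofReal_mul_ofReal_mul_I _ _).le)).congr
      (Eventually.of_forall fun q => ?_)
    simp only [Function.uncurry]
    ring
  rw [integral_integral_swap hint]
  simp_rw [integral_const_mul, integral_exp_mul_gaussian hb]

theorem lintegral_normSq_fourier_mul_gaussian_le {G : ℝ → ℂ} (hG : Integrable G) {b : ℝ}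
    (hb : 0 < b) :
    ∫⁻ v : ℝ, ‖∫ t : ℝ, G t * Complex.exp (t * v * Complex.I)‖ₑ ^ 2
        * ENNReal.ofReal (Real.exp (-b * v ^ 2))
      ≤ ENNReal.ofReal (2 * Real.pi) * ∫⁻ t, ‖G t‖ₑ ^ 2 := by
  set Φ : ℝ → ℂ := fun v => ∫ t : ℝ, G t * Complex.exp (t * v * Complex.I) with hΦ
  have hΦc : Continuous Φ := continuous_integral_mul_exp hG
  have hΦb : ∀ v, ‖Φ v‖ ≤ ∫ t, ‖G t‖ := fun v =>
    (norm_integral_le_integral_norm _).trans_eq (by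
      simp_rw [norm_mul, norm_exp_ofReal_mul_ofReal_mul_I, mul_one])
  have hint : Integrable fun v => ‖Φ v‖ ^ 2 * Real.exp (-b * v ^ 2) := by
    refine (integrable_exp_neg_mul_sq hb).bdd_mul (c := (∫ t, ‖G t‖) ^ 2)
      (Continuous.aestronglyMeasurable (by fun_prop)) (Eventually.of_forall fun v => ?_)
    rw [norm_pow, norm_norm]
    gcongr
    exact hΦb v
  have h1 : ∫⁻ v : ℝ, ‖Φ v‖ₑ ^ 2 * ENNReal.ofReal (Real.exp (-b * v ^ 2))
      = ‖∫ p : ℝ × ℝ, G p.1 * (starRingEnd ℂ) (G p.2) * gaussKernel b (p.1 - p.2)‖ₑ := by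
    rw [← integral_normSq_fourier_mul_gaussian hG hb, integral_complex_ofReal,
      ← ofReal_norm, Complex.norm_real, Real.norm_eq_abs,
      abs_of_nonneg (integral_nonneg fun v => by positivity),
      ofReal_integral_eq_lintegral_ofReal hint (Eventually.of_forall fun v => by positivity)]
    refine lintegral_congr fun v => ?_
    rw [ENNReal.ofReal_mul (by positivity), ENNReal.ofReal_pow (norm_nonneg _),
      ofReal_norm]
  rw [h1]
  refine (enorm_integral_le_lintegral_enorm _).trans ?_
  have h2 : ∀ p : ℝ × ℝ, 2 * ‖G p.1 * (starRingEnd ℂ) (G p.2) * gaussKernel b (p.1 - p.2)‖ₑ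
      ≤ ‖G p.1‖ₑ ^ 2 * ENNReal.ofReal (gaussKernel b (p.1 - p.2))
        + ‖G p.2‖ₑ ^ 2 * ENNReal.ofReal (gaussKernel b (p.1 - p.2)) := by
    intro p
    have h3 : ‖(gaussKernel b (p.1 - p.2) : ℂ)‖ₑ
        = ENNReal.ofReal (gaussKernel b (p.1 - p.2)) := by
      rw [← ofReal_norm, Complex.norm_real, Real.norm_eq_abs,
        abs_of_nonneg (gaussKernel_nonneg _ _)]
    have h4 : ‖(starRingEnd ℂ) (G p.2)‖ₑ = ‖G p.2‖ₑ := by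
      rw [← ofReal_norm, RCLike.norm_conj, ofReal_norm]
    rw [enorm_mul, enorm_mul, h3, h4, ← add_mul, ← mul_assoc, ← mul_assoc]
    gcongr
    rw [enorm_eq_nnnorm, enorm_eq_nnnorm]
    exact_mod_cast two_mul_le_add_sq ‖G p.1‖₊ ‖G p.2‖₊
  have hm : AEMeasurable (fun t => ‖G t‖ₑ ^ 2) := hG.1.enorm.pow_const 2
  have hk : Measurable fun p : ℝ × ℝ => ENNReal.ofReal (gaussKernel b (p.1 - p.2)) :=
    ((continuous_gaussKernel b).comp (by fun_prop)).measurable.ennreal_ofReal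
  have h5 : ∫⁻ p : ℝ × ℝ, ‖G p.1‖ₑ ^ 2 * ENNReal.ofReal (gaussKernel b (p.1 - p.2))
      = ENNReal.ofReal (2 * Real.pi) * ∫⁻ t, ‖G t‖ₑ ^ 2 := by
    rw [Measure.volume_eq_prod, lintegral_prod (fun p : ℝ × ℝ =>
      ‖G p.1‖ₑ ^ 2 * ENNReal.ofReal (gaussKernel b (p.1 - p.2))) (hm.comp_fst.mul hk.aemeasurable)]
    simp only
    have : ∀ x : ℝ, ∫⁻ y : ℝ, ‖G x‖ₑ ^ 2 * ENNReal.ofReal (gaussKernel b (x - y))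
        = ENNReal.ofReal (2 * Real.pi) * ‖G x‖ₑ ^ 2 := fun x => by
      rw [lintegral_const_mul' _ _ (by finiteness),
        lintegral_sub_left_eq_self (fun y => ENNReal.ofReal (gaussKernel b y)) x,
        lintegral_gaussKernel hb, mul_comm]
    simp_rw [this]
    rw [lintegral_const_mul' _ _ ENNReal.ofReal_ne_top]
  have h6 : ∫⁻ p : ℝ × ℝ, ‖G p.2‖ₑ ^ 2 * ENNReal.ofReal (gaussKernel b (p.1 - p.2))
      = ENNReal.ofReal (2 * Real.pi) * ∫⁻ t, ‖G t‖ₑ ^ 2 := by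
    rw [Measure.volume_eq_prod, lintegral_prod_symm (fun p : ℝ × ℝ =>
      ‖G p.2‖ₑ ^ 2 * ENNReal.ofReal (gaussKernel b (p.1 - p.2))) (hm.comp_snd.mul hk.aemeasurable)]
    simp only
    have : ∀ y : ℝ, ∫⁻ x : ℝ, ‖G y‖ₑ ^ 2 * ENNReal.ofReal (gaussKernel b (x - y))
        = ENNReal.ofReal (2 * Real.pi) * ‖G y‖ₑ ^ 2 := fun y => by
      rw [lintegral_const_mul' _ _ (by finiteness),
        lintegral_sub_right_eq_self (fun x => ENNReal.ofReal (gaussKernel b x)) y,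
        lintegral_gaussKernel hb, mul_comm]
    simp_rw [this]
    rw [lintegral_const_mul' _ _ ENNReal.ofReal_ne_top]
  have h7 := lintegral_mono (μ := volume) h2
  rw [lintegral_const_mul' _ _ (by finiteness), lintegral_add_left'
    (by rw [Measure.volume_eq_prod]; exact hm.comp_fst.mul hk.aemeasurable), h5, h6,
    ← two_mul] at h7
  exact (ENNReal.mul_le_mul_iff_right two_ne_zero ENNReal.ofNat_ne_top).mp h7

/-- Plancherel's inequality for integrable functions. -/
theorem lintegral_normSq_fourier_le {G : ℝ → ℂ} (hG : Integrable G) :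
    ∫⁻ v : ℝ, ‖∫ t : ℝ, G t * Complex.exp (t * v * Complex.I)‖ₑ ^ 2
      ≤ ENNReal.ofReal (2 * Real.pi) * ∫⁻ t, ‖G t‖ₑ ^ 2 := by
  have hc := continuous_integral_mul_exp hG
  refine lintegral_le_of_ae_tendsto (f := fun (n : ℕ) (v : ℝ) =>
    ‖∫ t : ℝ, G t * Complex.exp (t * v * Complex.I)‖ₑ ^ 2
        * ENNReal.ofReal (Real.exp (-(1 / ((n : ℝ) + 1)) * v ^ 2))) ?_ ?_ ?_
  · intro n
    exact ((hc.measurable.enorm.pow_const 2).mul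
      (Continuous.measurable (by fun_prop)).ennreal_ofReal).aemeasurable
  · refine Eventually.of_forall fun v => ?_
    have h1 : Tendsto (fun n : ℕ => Real.exp (-(1 / ((n : ℝ) + 1)) * v ^ 2)) atTop (𝓝 1) := by
      have := (tendsto_one_div_add_atTop_nhds_zero_nat (𝕜 := ℝ)).neg.mul_const (v ^ 2)
      rw [neg_zero, zero_mul] at this
      simpa [Function.comp_def] using (Real.continuous_exp.tendsto 0).comp this
    have h2 := ENNReal.tendsto_ofReal h1
    rw [ENNReal.ofReal_one] at h2
    simpa using ENNReal.Tendsto.const_mul h2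
      (a := ‖∫ t : ℝ, G t * Complex.exp (t * v * Complex.I)‖ₑ ^ 2) (Or.inl one_ne_zero)
  · exact fun n => lintegral_normSq_fourier_mul_gaussian_le hG (by positivity)

theorem integrable_exp_mul_gaussKernel {b : ℝ} (hb : 0 < b) (c v : ℝ) :
    Integrable fun u => Real.exp (c * u) * gaussKernel b (v - u) := by
  have h := (integrable_cexp_quadratic' (b := ((-(1 / (4 * b)) : ℝ) : ℂ))
    (by rw [Complex.ofReal_re, neg_lt_zero]; positivity)
    ((c + v / (2 * b) : ℝ) : ℂ) ((-(v ^ 2 / (4 * b)) : ℝ) : ℂ)).norm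
  refine (h.const_mul (Real.sqrt (Real.pi / b))).congr (Eventually.of_forall fun u => ?_)
  simp only [Complex.norm_exp, gaussKernel]
  rw [mul_left_comm, ← Real.exp_add]
  congr 2
  rw [← Complex.ofReal_pow, ← Complex.ofReal_mul, ← Complex.ofReal_mul, ← Complex.ofReal_add,
    ← Complex.ofReal_add, Complex.ofReal_re]
  field_simp
  ring

theorem norm_mul_cexp_neg_mul_le {h : ℝ → ℂ} {A C : ℝ}
    (hb : ∀ u > 0, ‖h u‖ ≤ C * Real.exp (A * u)) (z : ℂ) {u : ℝ} (hu : 0 < u) :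
    ‖h u * Complex.exp (-z * u)‖ ≤ C * Real.exp ((A - z.re) * u) := by
  have h1 : ‖Complex.exp (-z * u)‖ = Real.exp (-z.re * u) := by
    rw [Complex.norm_exp]; simp
  rw [norm_mul, h1, sub_mul, sub_eq_add_neg, Real.exp_add, ← mul_assoc, neg_mul]
  gcongr
  exact hb u hu

theorem differentiable_integral_mul_gaussKernel {h : ℝ → ℂ} {A C : ℝ} (hm : Measurable h)
    (hb : ∀ u > 0, ‖h u‖ ≤ C * Real.exp (A * u)) {b : ℝ} (hb0 : 0 < b) (v : ℝ) :
    Differentiable ℂ fun z : ℂ =>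
      ∫ u in Set.Ioi (0 : ℝ), h u * Complex.exp (-z * u) * gaussKernel b (v - u) := by
  intro z₀
  refine differentiableAt_integral_of_dominated (r := 1)
    (bound := fun u => C * (Real.exp ((A - z₀.re + 1) * u) * gaussKernel b (v - u)))
    one_pos (fun z _ => ?_) ?_ ?_ ?_
  · exact (((hm.mul (by fun_prop)).mul
      (Complex.measurable_ofReal.comp ((continuous_gaussKernel b).measurable.comp
        (by fun_prop))))).aestronglyMeasurable
  · refine (ae_restrict_iff' measurableSet_Ioi).mpr (Eventually.of_forall fun u hu z hz => ?_)
    have hu : 0 < u := hu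
    have hC : 0 ≤ C := by
      have := (norm_nonneg _).trans (hb 1 one_pos)
      exact nonneg_of_mul_nonneg_left this (Real.exp_pos _)
    rw [norm_mul, Complex.norm_real, Real.norm_eq_abs, abs_of_nonneg (gaussKernel_nonneg _ _),
      ← mul_assoc]
    refine mul_le_mul_of_nonneg_right ((norm_mul_cexp_neg_mul_le hb z hu).trans ?_)
      (gaussKernel_nonneg _ _)
    have h2 : |(z - z₀).re| ≤ 1 := (Complex.abs_re_le_norm _).trans (by
      rw [Metric.mem_ball, dist_eq_norm] at hz; exact hz.le)
    rw [Complex.sub_re] at h2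
    have h3 := (abs_le.mp h2).1
    gcongr
    linarith
  · exact ((integrable_exp_mul_gaussKernel hb0 _ v).const_mul C).integrableOn
  · exact Eventually.of_forall fun u => by fun_prop

theorem differentiableOn_integral_gaussian_mul {H : ℂ → ℂ}
    (hH : DifferentiableOn ℂ H {z | 0 < z.re})
    (hHb : ∀ δ > 0, ∃ K, ∀ z : ℂ, δ ≤ z.re → ‖H z‖ ≤ K) {b : ℝ} (hb : 0 < b) (v : ℝ) :
    DifferentiableOn ℂ (fun z : ℂ => ∫ t : ℝ, H (z + t * Complex.I) * Real.exp (-b * t ^ 2)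
      * Complex.exp (t * v * Complex.I)) {z | 0 < z.re} := by
  intro z₀ hz₀
  have hz₀ : 0 < z₀.re := hz₀
  refine DifferentiableAt.differentiableWithinAt ?_
  obtain ⟨K, hK⟩ := hHb (z₀.re / 2) (by positivity)
  have hball : ∀ z ∈ Metric.ball z₀ (z₀.re / 2), ∀ t : ℝ,
      z₀.re / 2 ≤ (z + t * Complex.I).re := fun z hz t => by
    have h2 := (Complex.abs_re_le_norm (z - z₀))
    rw [Metric.mem_ball, dist_eq_norm] at hz
    rw [Complex.sub_re] at h2
    have := (abs_le.mp (h2.trans hz.le)).1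
    simp
    linarith
  refine differentiableAt_integral_of_dominated (r := z₀.re / 2)
    (bound := fun t => K * Real.exp (-b * t ^ 2))
    (by positivity) (fun z hz => ?_) ?_ ?_ ?_
  · refine Continuous.aestronglyMeasurable ?_
    have : Continuous fun t : ℝ => H (z + t * Complex.I) :=
      hH.continuousOn.comp_continuous (by fun_prop) fun t =>
        lt_of_lt_of_le (by positivity) (hball z hz t)
    exact (this.mul (by fun_prop)).mul (by fun_prop)
  · refine Eventually.of_forall fun t z hz => ?_
    rw [norm_mul, norm_mul, norm_exp_ofReal_mul_ofReal_mul_I, mul_one, Complex.norm_real,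
      Real.norm_eq_abs, abs_of_pos (Real.exp_pos _)]
    gcongr
    exact hK _ (hball z hz t)
  · exact (integrable_exp_neg_mul_sq hb).const_mul K
  · refine Eventually.of_forall fun t => ?_
    have : DifferentiableOn ℂ (fun z => H (z + t * Complex.I)) (Metric.ball z₀ (z₀.re / 2)) :=
      hH.comp (by fun_prop) fun z hz => lt_of_lt_of_le (by positivity) (hball z hz t)
    exact (this.mul_const _).mul_const _

theorem integrableOn_mul_cexp_neg_mul {h : ℝ → ℂ} {A C : ℝ} (hm : Measurable h)
    (hb : ∀ u > 0, ‖h u‖ ≤ C * Real.exp (A * u)) {z : ℂ} (hz : A < z.re) :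
    IntegrableOn (fun u : ℝ => h u * Complex.exp (-z * u)) (Set.Ioi 0) := by
  have h1 : IntegrableOn (fun u : ℝ => C * Real.exp ((A - z.re) * u)) (Set.Ioi 0) :=
    (integrableOn_exp_mul_Ioi (by linarith) 0).const_mul C
  refine Integrable.mono' h1 (hm.mul (by fun_prop)).aestronglyMeasurable
    ((ae_restrict_iff' measurableSet_Ioi).mpr (Eventually.of_forall fun u hu => ?_))
  exact norm_mul_cexp_neg_mul_le hb z hu

theorem integral_laplace_mul_gaussian {h : ℝ → ℂ} {A C : ℝ} (hm : Measurable h)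
    (hb : ∀ u > 0, ‖h u‖ ≤ C * Real.exp (A * u)) {z : ℂ} (hz : A < z.re) {b : ℝ} (hb0 : 0 < b)
    (v : ℝ) :
    ∫ t : ℝ, (∫ u in Set.Ioi (0 : ℝ), h u * Complex.exp (-(z + t * Complex.I) * u))
        * Real.exp (-b * t ^ 2) * Complex.exp (t * v * Complex.I)
      = ∫ u in Set.Ioi (0 : ℝ), h u * Complex.exp (-z * u) * gaussKernel b (v - u) := by
  have h0 := integrableOn_mul_cexp_neg_mul hm hb hz
  have hint : Integrable (Function.uncurry fun (t u : ℝ) => h u * Complex.exp (-z * u) *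
      (Complex.exp (t * (v - u : ℝ) * Complex.I) * Real.exp (-b * t ^ 2)))
      (volume.prod (volume.restrict (Set.Ioi (0 : ℝ)))) := by
    have h4 : Integrable (fun v : ℝ => ((Real.exp (-b * v ^ 2) : ℝ) : ℂ)) :=
      (integrable_exp_neg_mul_sq hb0).ofReal
    refine ((h4.mul_prod h0).bdd_mul (c := 1)
      (f := fun q : ℝ × ℝ => Complex.exp (q.1 * (v - q.2 : ℝ) * Complex.I))
      (Continuous.aestronglyMeasurable (by fun_prop))
      (Eventually.of_forall fun q => (norm_exp_ofReal_mul_ofReal_mul_I _ _).le)).congr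
      (Eventually.of_forall fun q => ?_)
    simp only [Function.uncurry]
    ring
  have h1 := integral_integral_swap hint
  simp_rw [integral_const_mul, integral_exp_mul_gaussian hb0] at h1
  rw [← h1]
  refine integral_congr_ae (Eventually.of_forall fun t => ?_)
  simp only
  rw [← integral_mul_const, ← integral_mul_const]
  refine integral_congr_ae (Eventually.of_forall fun u => ?_)
  have h3 : Complex.exp (-(z + t * Complex.I) * u) * Complex.exp (t * v * Complex.I)
      = Complex.exp (-z * u) * Complex.exp (t * (v - u : ℝ) * Complex.I) := by
    rw [← Complex.exp_add, ← Complex.exp_add]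
    push_cast
    ring_nf
  simp only
  linear_combination (h u * Real.exp (-b * t ^ 2)) * h3

theorem integral_mul_gaussKernel_eq {h : ℝ → ℂ} {H : ℂ → ℂ} {A C : ℝ} (hm : Measurable h)
    (hA : 0 ≤ A) (hb : ∀ u > 0, ‖h u‖ ≤ C * Real.exp (A * u))
    (hH : DifferentiableOn ℂ H {z | 0 < z.re})
    (hHb : ∀ δ > 0, ∃ K, ∀ z : ℂ, δ ≤ z.re → ‖H z‖ ≤ K)
    (hL : ∀ z : ℂ, A < z.re → H z = ∫ u in Set.Ioi (0 : ℝ), h u * Complex.exp (-z * u))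
    {b : ℝ} (hb0 : 0 < b) (v : ℝ) {z : ℂ} (hz : 0 < z.re) :
    ∫ t : ℝ, H (z + t * Complex.I) * Real.exp (-b * t ^ 2) * Complex.exp (t * v * Complex.I)
      = ∫ u in Set.Ioi (0 : ℝ), h u * Complex.exp (-z * u) * gaussKernel b (v - u) := by
  have hopen : IsOpen {z : ℂ | 0 < z.re} := isOpen_lt continuous_const Complex.continuous_re
  have h1 := (differentiableOn_integral_gaussian_mul hH hHb hb0 v).analyticOnNhd hopen
  have h2 := (differentiable_integral_mul_gaussKernel hm hb hb0 v).differentiableOn.analyticOnNhd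
    hopen
  have h0 : ((A + 1 : ℝ) : ℂ) ∈ {z : ℂ | 0 < z.re} := by
    simp only [Set.mem_ofPred_eq, Complex.ofReal_re]; linarith
  refine h1.eqOn_of_preconnected_of_eventuallyEq h2
    (convex_halfSpace_re_gt 0).isPreconnected h0 ?_ hz
  have h3 : {z : ℂ | A < z.re} ∈ 𝓝 ((A + 1 : ℝ) : ℂ) :=
    (isOpen_lt continuous_const Complex.continuous_re).mem_nhds (by simp)
  filter_upwards [h3] with w hw
  have hw : A < w.re := hw
  rw [← integral_laplace_mul_gaussian hm hb hw hb0 v]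
  refine integral_congr_ae (Eventually.of_forall fun t => ?_)
  simp only
  rw [hL (w + t * Complex.I) (by simpa using hw)]

theorem integral_mul_gaussKernel_eq_comp (f : ℝ → ℂ) {s : ℝ} (hs : 0 < s) (v : ℝ) :
    ∫ u, f u * gaussKernel (s ^ 2) (v - u)
      = ∫ x, f (v - 2 * s * x) * ((2 * Real.sqrt Real.pi * Real.exp (-x ^ 2) : ℝ) : ℂ) := by
  have h1 := integral_sub_left_eq_self (μ := (volume : Measure ℝ))
    (fun u => f u * (gaussKernel (s ^ 2) (v - u) : ℂ)) v
  have h2 := Measure.integral_comp_mul_left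
    (fun x => f (v - x) * (gaussKernel (s ^ 2) (v - (v - x)) : ℂ)) (2 * s)
  rw [← h1]
  have h3 : |(2 * s)⁻¹| = (2 * s)⁻¹ := abs_of_pos (by positivity)
  rw [h3, eq_comm, inv_smul_eq_iff₀ (by positivity), ← integral_smul] at h2
  rw [h2]
  refine integral_congr_ae (Eventually.of_forall fun x => ?_)
  simp only [sub_sub_cancel, Complex.real_smul]
  rw [mul_left_comm, ← Complex.ofReal_mul]
  congr 2
  have h4 : Real.sqrt (Real.pi / s ^ 2) = Real.sqrt Real.pi / s := by
    rw [Real.sqrt_div' _ (by positivity), Real.sqrt_sq hs.le]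
  rw [gaussKernel, h4, show -(1 / (4 * s ^ 2)) * (2 * s * x) ^ 2 = -x ^ 2 by field_simp; ring]
  field_simp

theorem tendsto_integral_mul_gaussKernel {f : ℝ → ℂ} {A C : ℝ} (hA : 0 ≤ A) (hm : Measurable f)
    (hb : ∀ u, ‖f u‖ ≤ C * Real.exp (A * |u|)) {v : ℝ} (hv : ContinuousAt f v) :
    Tendsto (fun n : ℕ => ∫ u, f u * gaussKernel ((1 / ((n : ℝ) + 1)) ^ 2) (v - u)) atTop
      (𝓝 (f v * (2 * Real.pi : ℝ))) := by
  have hC : 0 ≤ C := nonneg_of_mul_nonneg_left ((norm_nonneg _).trans (hb 0)) (Real.exp_pos _)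
  have h0 : ∫ x, f v * ((2 * Real.sqrt Real.pi * Real.exp (-x ^ 2) : ℝ) : ℂ)
      = f v * (2 * Real.pi : ℝ) := by
    rw [integral_const_mul, integral_complex_ofReal, integral_const_mul]
    have := integral_gaussian 1
    simp only [div_one, neg_mul, one_mul] at this
    rw [this, mul_assoc, Real.mul_self_sqrt Real.pi_pos.le]
  rw [← h0]
  simp_rw [fun n : ℕ => integral_mul_gaussKernel_eq_comp f
    (show (0 : ℝ) < 1 / ((n : ℝ) + 1) by positivity) v]
  refine tendsto_integral_of_dominated_convergence
    (fun x => (C * Real.exp (A * |v| + 2 * A ^ 2) * (2 * Real.sqrt Real.pi)) *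
      Real.exp (-(1 / 2) * x ^ 2)) ?_ ?_ ?_ ?_
  · intro n
    exact ((hm.comp (by fun_prop)).mul (by fun_prop)).aestronglyMeasurable
  · exact (integrable_exp_neg_mul_sq (by norm_num)).const_mul _
  · intro n
    refine Eventually.of_forall fun x => ?_
    have hn : (1 : ℝ) / ((n : ℝ) + 1) ≤ 1 := by
      rw [div_le_one (by positivity)]; linarith [(Nat.cast_nonneg n : (0 : ℝ) ≤ n)]
    have hn0 : (0 : ℝ) ≤ 1 / ((n : ℝ) + 1) := by positivity
    have h1 : |v - 2 * (1 / ((n : ℝ) + 1)) * x| ≤ |v| + 2 * |x| := by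
      refine (abs_sub _ _).trans ?_
      rw [abs_mul, abs_mul, abs_of_nonneg hn0, abs_two]
      have := mul_le_mul_of_nonneg_right hn (abs_nonneg x)
      nlinarith
    rw [norm_mul, Complex.norm_real, Real.norm_eq_abs, abs_of_nonneg (by positivity)]
    have h2 : A * |v - 2 * (1 / ((n : ℝ) + 1)) * x| + -x ^ 2
        ≤ (A * |v| + 2 * A ^ 2) + -(1 / 2) * x ^ 2 := by
      have := mul_le_mul_of_nonneg_left h1 hA
      nlinarith [sq_nonneg (|x| - 2 * A), sq_abs x]
    have h3 := Real.exp_le_exp.mpr h2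
    rw [Real.exp_add, Real.exp_add _ (-(1 / 2) * x ^ 2)] at h3
    calc _ ≤ C * Real.exp (A * |v - 2 * (1 / ((n : ℝ) + 1)) * x|) *
          (2 * Real.sqrt Real.pi * Real.exp (-x ^ 2)) := by gcongr; exact hb _
      _ = (C * (2 * Real.sqrt Real.pi)) *
          (Real.exp (A * |v - 2 * (1 / ((n : ℝ) + 1)) * x|) * Real.exp (-x ^ 2)) := by ring
      _ ≤ (C * (2 * Real.sqrt Real.pi)) *
          (Real.exp (A * |v| + 2 * A ^ 2) * Real.exp (-(1 / 2) * x ^ 2)) := by gcongr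
      _ = _ := by ring
  · refine Eventually.of_forall fun x => Tendsto.mul_const _ (hv.tendsto.comp ?_)
    have := ((tendsto_one_div_add_atTop_nhds_zero_nat (𝕜 := ℝ)).const_mul 2).mul_const x
    simpa using this.const_sub v

/-- Plancherel's inequality for a Laplace transform on a vertical line to which the transform
extends analytically. -/
theorem lintegral_normSq_le_of_laplace {h : ℝ → ℂ} {H : ℂ → ℂ} {A C : ℝ} (hm : Measurable h)
    (hA : 0 ≤ A) (hb : ∀ u > 0, ‖h u‖ ≤ C * Real.exp (A * u))
    (hcont : ∀ᵐ u : ℝ, 0 < u → ContinuousAt h u)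
    (hH : DifferentiableOn ℂ H {z | 0 < z.re})
    (hHb : ∀ δ > 0, ∃ K, ∀ z : ℂ, δ ≤ z.re → ‖H z‖ ≤ K)
    (hL : ∀ z : ℂ, A < z.re → H z = ∫ u in Set.Ioi (0 : ℝ), h u * Complex.exp (-z * u))
    {δ : ℝ} (hδ : 0 < δ) :
    ∫⁻ u in Set.Ioi (0 : ℝ), ‖h u * Complex.exp (-δ * u)‖ₑ ^ 2
      ≤ ∫⁻ t : ℝ, ‖H (δ + t * Complex.I)‖ₑ ^ 2 := by
  have hC : 0 ≤ C := nonneg_of_mul_nonneg_left ((norm_nonneg _).trans (hb 1 one_pos))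
    (Real.exp_pos _)
  set f : ℝ → ℂ := (Set.Ioi (0 : ℝ)).indicator fun u => h u * Complex.exp (-δ * u) with hf
  have hfm : Measurable f := (hm.mul (by fun_prop)).indicator measurableSet_Ioi
  have hfb : ∀ u, ‖f u‖ ≤ C * Real.exp (A * |u|) := by
    intro u
    by_cases hu : 0 < u
    · rw [hf, Set.indicator_of_mem (by exact hu), abs_of_pos hu]
      refine (norm_mul_cexp_neg_mul_le hb (δ : ℂ) hu).trans ?_
      gcongr
      simpa using hδ.le
    · rw [hf, Set.indicator_of_notMem (by simpa using hu), norm_zero]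
      positivity
  have hHc : Continuous fun t : ℝ => H (δ + t * Complex.I) :=
    hH.continuousOn.comp_continuous (by fun_prop) fun t => by simpa using hδ
  obtain ⟨K, hK⟩ := hHb δ hδ
  set F : ℕ → ℝ → ℂ := fun n v => ∫ u, f u * gaussKernel ((1 / ((n : ℝ) + 1)) ^ 2) (v - u)
  have hFeq : ∀ n v, F n v = ∫ t : ℝ, H (δ + t * Complex.I)
      * Real.exp (-((1 / ((n : ℝ) + 1)) ^ 2) * t ^ 2) * Complex.exp (t * v * Complex.I) := by
    intro n v
    rw [integral_mul_gaussKernel_eq hm hA hb hH hHb hL (by positivity) v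
      (show 0 < (δ : ℂ).re by simpa using hδ), ← integral_indicator measurableSet_Ioi]
    refine integral_congr_ae (Eventually.of_forall fun u => ?_)
    simp only [hf]
    by_cases hu : u ∈ Set.Ioi (0 : ℝ)
    · rw [Set.indicator_of_mem hu, Set.indicator_of_mem hu]
    · rw [Set.indicator_of_notMem hu, Set.indicator_of_notMem hu, zero_mul]
  have hGint : ∀ n : ℕ, Integrable fun t : ℝ => H (δ + t * Complex.I)
      * Real.exp (-((1 / ((n : ℝ) + 1)) ^ 2) * t ^ 2) := fun n =>
    (integrable_exp_neg_mul_sq (b := (1 / ((n : ℝ) + 1)) ^ 2) (by positivity)).ofReal.bdd_mul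
      (c := K) hHc.aestronglyMeasurable (Eventually.of_forall fun t => hK _ (by simp))
  have hF2 : ∀ n, ∫⁻ v, ‖F n v‖ₑ ^ 2
      ≤ ENNReal.ofReal (2 * Real.pi) * ∫⁻ t : ℝ, ‖H (δ + t * Complex.I)‖ₑ ^ 2 := by
    intro n
    simp_rw [hFeq]
    refine (lintegral_normSq_fourier_le (hGint n)).trans ?_
    gcongr with t
    rw [enorm_mul]
    refine mul_le_of_le_one_right' ?_
    rw [← ofReal_norm, Complex.norm_real, Real.norm_eq_abs, abs_of_pos (Real.exp_pos _),
      ENNReal.ofReal_le_one, Real.exp_le_one_iff, neg_mul, neg_nonpos]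
    positivity
  have hlim : ∫⁻ u in Set.Ioi (0 : ℝ), ‖h u * Complex.exp (-δ * u) * (2 * Real.pi : ℝ)‖ₑ ^ 2
      ≤ ENNReal.ofReal (2 * Real.pi) * ∫⁻ t : ℝ, ‖H (δ + t * Complex.I)‖ₑ ^ 2 := by
    refine lintegral_le_of_ae_tendsto (f := fun n v => ‖F n v‖ₑ ^ 2) ?_ ?_ fun n =>
      (setLIntegral_le_lintegral _ _).trans (hF2 n)
    · intro n
      have : F n = fun v : ℝ => ∫ t : ℝ, H (δ + t * Complex.I)
          * Real.exp (-((1 / ((n : ℝ) + 1)) ^ 2) * t ^ 2) * Complex.exp (t * v * Complex.I) :=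
        funext (hFeq n)
      rw [this]
      exact ((continuous_integral_mul_exp (hGint n)).measurable.enorm.pow_const 2).aemeasurable
    · refine (ae_restrict_iff' measurableSet_Ioi).mpr ?_
      filter_upwards [hcont] with v hv hv0
      have hv0' : 0 < v := hv0
      have hfv : f v = h v * Complex.exp (-δ * v) := by rw [hf, Set.indicator_of_mem hv0]
      have hcf : ContinuousAt f v := by
        have h1 : ContinuousAt (fun u : ℝ => h u * Complex.exp (-δ * u)) v :=
          (hv hv0').mul (by fun_prop)
        refine h1.congr ?_
        filter_upwards [Ioi_mem_nhds hv0'] with u hu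
        rw [hf, Set.indicator_of_mem hu]
      rw [← hfv]
      exact ((ENNReal.continuous_pow 2).tendsto _).comp ((continuous_enorm.tendsto _).comp
        (tendsto_integral_mul_gaussKernel hA hfm hfb hcf))
  have h2 : ∀ u : ℝ, ENNReal.ofReal (2 * Real.pi) * ‖h u * Complex.exp (-δ * u)‖ₑ ^ 2
      ≤ ‖h u * Complex.exp (-δ * u) * (2 * Real.pi : ℝ)‖ₑ ^ 2 := by
    intro u
    have h3 : ‖((2 * Real.pi : ℝ) : ℂ)‖ₑ = ENNReal.ofReal (2 * Real.pi) := by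
      rw [← ofReal_norm, Complex.norm_real, Real.norm_eq_abs, abs_of_pos (by positivity)]
    rw [enorm_mul _ ((2 * Real.pi : ℝ) : ℂ), mul_pow, h3, mul_comm]
    gcongr
    refine le_self_pow₀ ?_ two_ne_zero
    rw [ENNReal.one_le_ofReal]
    linarith [Real.pi_gt_three]
  have h4 := (lintegral_mono h2).trans hlim
  rw [lintegral_const_mul' _ _ ENNReal.ofReal_ne_top] at h4
  exact (ENNReal.mul_le_mul_iff_right (ENNReal.ofReal_pos.mpr (by positivity)).ne'
    ENNReal.ofReal_ne_top).mp h4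

/-- The trigonometric polynomial with frequencies `s` and coefficients `r`. -/
noncomputable def trigSum (s : Finset ℝ) (r : ℝ → ℂ) (y : ℝ) : ℂ :=
  ∑ l ∈ s, r l * Complex.exp (l * y * Complex.I)

theorem trigSum_mem_trigPoly (s : Finset ℝ) (r : ℝ → ℂ) : trigSum s r ∈ trigPoly := by
  have : trigSum s r = ∑ l ∈ s, r l • fun y : ℝ => Complex.exp (l * y * Complex.I) := by
    funext y
    simp [trigSum, Finset.sum_apply]
  rw [this]
  exact trigPoly.sum_mem fun l _ => trigPoly.smul_mem (exp_mem_trigPoly l) _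

theorem norm_trigSum_le (s : Finset ℝ) (r : ℝ → ℂ) (y : ℝ) :
    ‖trigSum s r y‖ ≤ ∑ l ∈ s, ‖r l‖ :=
  (norm_sum_le _ _).trans_eq (Finset.sum_congr rfl fun l _ => by
    rw [norm_mul, norm_exp_ofReal_mul_ofReal_mul_I, mul_one])

theorem integral_trigSum_mul_cexp (s : Finset ℝ) (r : ℝ → ℂ) {z : ℂ} (hz : 0 < z.re) :
    ∫ u in Set.Ioi (0 : ℝ), trigSum s r u * Complex.exp (-z * u)
      = ∑ l ∈ s, r l / (z - l * Complex.I) := by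
  have hre : ∀ l : ℝ, (-(z - l * Complex.I)).re < 0 := fun l => by simpa using hz
  have h1 : ∀ u : ℝ, trigSum s r u * Complex.exp (-z * u)
      = ∑ l ∈ s, r l * Complex.exp (-(z - l * Complex.I) * u) := fun u => by
    rw [trigSum, Finset.sum_mul]
    refine Finset.sum_congr rfl fun l _ => ?_
    rw [mul_assoc, ← Complex.exp_add]
    ring_nf
  simp_rw [h1]
  rw [integral_finsetSum _ fun l _ => (integrableOn_exp_mul_complex_Ioi (hre l) 0).const_mul _]
  refine Finset.sum_congr rfl fun l _ => ?_
  rw [integral_const_mul, integral_exp_mul_complex_Ioi (hre l)]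
  simp only [Complex.ofReal_zero, mul_zero, Complex.exp_zero, neg_div_neg_eq, mul_one_div]

theorem setIntegral_normSq_le_of_lintegral_le {h : ℝ → ℂ} (hm : Measurable h) {Y K : ℝ}
    (hY : 0 < Y) (hK : 0 ≤ K)
    (hle : ∫⁻ u in Set.Ioi (0 : ℝ), ‖h u * Complex.exp (-((1 / Y : ℝ) : ℂ) * u)‖ₑ ^ 2
      ≤ ENNReal.ofReal K) :
    ∫ u in (0 : ℝ)..Y, ‖h u‖ ^ 2 ≤ Real.exp 2 * K := by
  rw [intervalIntegral.integral_of_le hY.le,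
    integral_eq_lintegral_of_nonneg_ae (Eventually.of_forall fun u => by positivity)
      (hm.norm.pow_const 2).aestronglyMeasurable]
  refine ENNReal.toReal_le_of_le_ofReal (by positivity) ?_
  rw [ENNReal.ofReal_mul (Real.exp_pos _).le]
  refine le_trans ?_ (mul_le_mul_right hle _)
  rw [← lintegral_const_mul' _ _ ENNReal.ofReal_ne_top]
  refine le_trans (setLIntegral_mono' measurableSet_Ioc fun u hu => ?_)
    (lintegral_mono_set Set.Ioc_subset_Ioi_self)
  have h1 : ‖Complex.exp (-((1 / Y : ℝ) : ℂ) * u)‖ = Real.exp (-(u / Y)) := by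
    rw [Complex.norm_exp]
    congr 1
    rw [← Complex.ofReal_neg, ← Complex.ofReal_mul, Complex.ofReal_re]
    ring
  rw [← ofReal_norm, ← ENNReal.ofReal_pow (norm_nonneg _), ← ENNReal.ofReal_mul
    (Real.exp_pos _).le, norm_mul, mul_pow, h1]
  refine ENNReal.ofReal_le_ofReal ?_
  have h2 : 1 ≤ Real.exp 2 * Real.exp (-(u / Y)) ^ 2 := by
    rw [← Real.exp_nat_mul, ← Real.exp_add, Real.one_le_exp_iff]
    have : u / Y ≤ 1 := (div_le_one hY).mpr hu.2
    push_cast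
    linarith
  nlinarith [sq_nonneg ‖h u‖]

/-- A real function possesses a limiting distribution if its Laplace transform is approximated in
the mean square on vertical lines close to the imaginary axis by finite sums of simple poles. -/
theorem hasLimitingDist_of_laplace {φ : ℝ → ℝ} {F : ℂ → ℂ} {A C : ℝ} (hm : Measurable φ)
    (hA : 0 ≤ A) (hb : ∀ u > 0, |φ u| ≤ C * Real.exp (A * u))
    (hcont : ∀ᵐ u : ℝ, 0 < u → ContinuousAt φ u)
    (hF : DifferentiableOn ℂ F {z | 0 < z.re})
    (hFb : ∀ δ > 0, ∃ K, ∀ z : ℂ, δ ≤ z.re → ‖F z‖ ≤ K)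
    (hL : ∀ z : ℂ, A < z.re → F z = ∫ u in Set.Ioi (0 : ℝ), (φ u : ℂ) * Complex.exp (-z * u))
    (happ : ∀ ε > (0 : ℝ), ∃ (s : Finset ℝ) (r : ℝ → ℂ), ∀ᶠ δ : ℝ in 𝓝[>] 0,
      ENNReal.ofReal δ * ∫⁻ t : ℝ, ‖F (δ + t * Complex.I)
        - ∑ l ∈ s, r l / (δ + t * Complex.I - l * Complex.I)‖ₑ ^ 2 ≤ ENNReal.ofReal ε) :
    HasLimitingDist φ := by
  have hC : 0 ≤ C := nonneg_of_mul_nonneg_left ((abs_nonneg _).trans (hb 1 one_pos))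
    (Real.exp_pos _)
  refine hasLimitingDist_of_forall_trigPoly hm (fun Y => ⟨C * Real.exp (A * Y), fun y hy =>
    (hb y hy.1).trans (by have := hy.2; gcongr)⟩) fun ε hε => ?_
  obtain ⟨s, r, hsr⟩ := happ (ε / Real.exp 2) (by positivity)
  refine ⟨trigSum s r, trigSum_mem_trigPoly s r, ?_⟩
  have hq := continuous_of_mem_trigPoly (trigSum_mem_trigPoly s r)
  have hY := (tendsto_inv_atTop_nhdsGT_zero (𝕜 := ℝ)).eventually hsr
  filter_upwards [hY, eventually_gt_atTop 0] with Y hY hY0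
  set h : ℝ → ℂ := fun u => (φ u : ℂ) - trigSum s r u
  set H : ℂ → ℂ := fun z => F z - ∑ l ∈ s, r l / (z - l * Complex.I)
  have hhm : Measurable h := (Complex.measurable_ofReal.comp hm).sub hq.measurable
  have hφb : ∀ u > 0, ‖(φ u : ℂ)‖ ≤ C * Real.exp (A * u) := fun u hu => by
    rw [Complex.norm_real]; exact hb u hu
  have hhb : ∀ u > 0, ‖h u‖ ≤ (C + ∑ l ∈ s, ‖r l‖) * Real.exp (A * u) := by
    intro u hu
    have h1 : 1 ≤ Real.exp (A * u) := Real.one_le_exp (by positivity)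
    have h2 : 0 ≤ ∑ l ∈ s, ‖r l‖ := Finset.sum_nonneg fun _ _ => norm_nonneg _
    refine (norm_sub_le _ _).trans ?_
    nlinarith [hφb u hu, norm_trigSum_le s r u]
  have hne : ∀ z : ℂ, 0 < z.re → ∀ l : ℝ, z - l * Complex.I ≠ 0 := fun z hz l h0 => by
    have := congrArg Complex.re h0
    simp at this
    linarith
  have hHd : DifferentiableOn ℂ H {z | 0 < z.re} :=
    hF.sub (DifferentiableOn.fun_sum fun l _ => (differentiableOn_const _).div (by fun_prop)
      fun z hz => hne z hz l)
  have hHb : ∀ δ > 0, ∃ K, ∀ z : ℂ, δ ≤ z.re → ‖H z‖ ≤ K := by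
    intro δ hδ
    obtain ⟨K, hK⟩ := hFb δ hδ
    refine ⟨K + ∑ l ∈ s, ‖r l‖ / δ, fun z hz => (norm_sub_le _ _).trans (add_le_add (hK z hz)
      ((norm_sum_le _ _).trans (Finset.sum_le_sum fun l _ => ?_)))⟩
    rw [norm_div]
    gcongr
    have := (le_abs_self _).trans (Complex.abs_re_le_norm (z - l * Complex.I))
    simp at this
    linarith
  have hHL : ∀ z : ℂ, A < z.re → H z = ∫ u in Set.Ioi (0 : ℝ), h u * Complex.exp (-z * u) := by
    intro z hz
    have h1 : IntegrableOn (fun u : ℝ => (φ u : ℂ) * Complex.exp (-z * u)) (Set.Ioi 0) :=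
      integrableOn_mul_cexp_neg_mul (Complex.measurable_ofReal.comp hm) hφb hz
    have h2 := integrableOn_mul_cexp_neg_mul (A := 0) (C := ∑ l ∈ s, ‖r l‖) hq.measurable
      (fun u _ => by simpa using norm_trigSum_le s r u) (z := z) (by linarith)
    simp only [H, h, sub_mul]
    rw [integral_sub h1 h2, ← hL z hz, integral_trigSum_mul_cexp s r (by linarith)]
  have hhc : ∀ᵐ u : ℝ, 0 < u → ContinuousAt h u := by
    filter_upwards [hcont] with u hu hu0
    exact (Complex.continuous_ofReal.continuousAt.comp (hu hu0)).sub hq.continuousAt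
  have hpl := lintegral_normSq_le_of_laplace hhm hA hhb hhc hHd hHb hHL
    (δ := 1 / Y) (by positivity)
  have hfin : ∫⁻ t : ℝ, ‖H (((1 / Y : ℝ) : ℂ) + t * Complex.I)‖ₑ ^ 2
      ≤ ENNReal.ofReal (ε / Real.exp 2 * Y) := by
    rw [mul_comm, ENNReal.ofReal_mul hY0.le]
    have h1 : ENNReal.ofReal Y * ENNReal.ofReal Y⁻¹ = 1 := by
      rw [← ENNReal.ofReal_mul hY0.le, mul_inv_cancel₀ hY0.ne', ENNReal.ofReal_one]
    have h2 := mul_le_mul_right hY (ENNReal.ofReal Y)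
    rw [← mul_assoc, h1, one_mul, ← one_div] at h2
    exact h2
  have := setIntegral_normSq_le_of_lintegral_le hhm hY0 (by positivity) (hpl.trans hfin)
  refine this.trans_eq ?_
  field_simp

/-- The function `1 / ζ`, with value `0` at the pole `s = 1` of `ζ`. -/
noncomputable def zetaInv (s : ℂ) : ℂ := (s - 1) / riemannZeta₁ s

theorem zetaInv_eq_inv {s : ℂ} (hs : s ≠ 1) : zetaInv s = (riemannZeta s)⁻¹ := by
  rw [zetaInv, riemannZeta₁_eq_of_ne_one hs, div_mul_cancel_left₀ (sub_ne_zero.2 hs)]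

theorem zetaInv_eq_LSeries {s : ℂ} (hs : 1 < s.re) :
    zetaInv s = LSeries (fun n => (ArithmeticFunction.moebius n : ℂ)) s := by
  have h := ArithmeticFunction.LSeries_zeta_mul_Lseries_moebius hs
  rw [ArithmeticFunction.LSeries_zeta_eq_riemannZeta hs] at h
  have h1 : s ≠ 1 := by rintro rfl; simp at hs
  rw [zetaInv_eq_inv h1]
  exact (eq_inv_of_mul_eq_one_right h).symm

theorem exists_norm_zetaInv_le_of_le_re {a : ℝ} (ha : 1 < a) :
    ∃ K : ℝ, 0 < K ∧ ∀ s : ℂ, a ≤ s.re → ‖zetaInv s‖ ≤ K := by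
  have hsum : LSeriesSummable (fun n => (ArithmeticFunction.moebius n : ℂ)) (a : ℂ) :=
    ArithmeticFunction.LSeriesSummable_moebius_iff.2 (by simpa using ha)
  refine ⟨(∑' n, ‖LSeries.term (fun n => (ArithmeticFunction.moebius n : ℂ)) a n‖) + 1,
    by positivity, fun s hs => ?_⟩
  rw [zetaInv_eq_LSeries (by linarith)]
  have hle : ∀ n, ‖LSeries.term (fun n => (ArithmeticFunction.moebius n : ℂ)) s n‖
      ≤ ‖LSeries.term (fun n => (ArithmeticFunction.moebius n : ℂ)) a n‖ := fun n =>
    LSeries.norm_term_le_of_re_le_re _ (by simpa using hs) n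
  have h1 : Summable fun n =>
      ‖LSeries.term (fun n => (ArithmeticFunction.moebius n : ℂ)) s n‖ :=
    Summable.of_nonneg_of_le (fun _ => norm_nonneg _) hle hsum.norm
  have h2 := norm_tsum_le_tsum_norm h1
  have h3 := h1.tsum_le_tsum hle hsum.norm
  rw [LSeries]
  linarith

theorem zetaInv_functional_equation {w : ℂ} (hn : ∀ n : ℕ, w ≠ -n) (hw : w ≠ 1)
    (hz : riemannZeta (1 - w) ≠ 0) :
    zetaInv w = 2 * (2 * Real.pi : ℂ) ^ (-w) * Complex.Gamma w * Complex.cos (Real.pi * w / 2)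
      * zetaInv (1 - w) := by
  have h := riemannZeta_one_sub hn hw
  have h0 : w ≠ 0 := by simpa using hn 0
  rw [zetaInv_eq_inv hw, zetaInv_eq_inv (by simpa using h0)]
  have hw0 : riemannZeta w ≠ 0 := by
    intro h1; rw [h1, mul_zero] at h; exact hz h
  field_simp
  rw [h]
  ring

theorem norm_two_pi_cpow (w : ℂ) : ‖(2 * Real.pi : ℂ) ^ (-w)‖ = (2 * Real.pi) ^ (-w.re) := by
  have : (2 * Real.pi : ℂ) = ((2 * Real.pi : ℝ) : ℂ) := by push_cast; ring
  rw [this, Complex.norm_cpow_eq_rpow_re_of_pos Real.two_pi_pos]; simp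

theorem normSq_Gamma_mul_cos (t : ℝ) :
    Complex.normSq (Complex.Gamma (-(1 / 2 : ℂ) + t * Complex.I)
      * Complex.cos (Real.pi * (-(1 / 2 : ℂ) + t * Complex.I) / 2)) ≤ 2 * Real.pi := by
  set w : ℂ := -(1 / 2 : ℂ) + t * Complex.I with hw
  have hc : (starRingEnd ℂ) w = -(1 / 2 : ℂ) - t * Complex.I := by
    rw [hw]; simp [Complex.conj_ofReal, sub_eq_add_neg, Complex.conj_ofNat]
  have hw0 : w ≠ 0 := fun h => by have := congrArg Complex.re h; norm_num [hw] at this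
  have hG : Complex.Gamma (w + 1) = w * Complex.Gamma w := Complex.Gamma_add_one w hw0
  have hGc : Complex.Gamma ((starRingEnd ℂ) (w + 1))
      = (starRingEnd ℂ) (w * Complex.Gamma w) := by rw [Complex.Gamma_conj, hG]
  have hr := Complex.Gamma_mul_Gamma_one_sub (w + 1)
  have he : 1 - (w + 1) = (starRingEnd ℂ) (w + 1) := by
    rw [map_add, hc, hw, map_one]; ring
  rw [he, hGc, hG, Complex.mul_conj] at hr
  have hsin : Complex.sin (Real.pi * (w + 1)) = Complex.cos (Real.pi * t * Complex.I) := by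
    rw [← Complex.sin_add_pi_div_two]; congr 1; rw [hw]; ring
  have hcos : (Complex.normSq (Complex.cos (Real.pi * w / 2)) : ℂ)
      = Complex.cos (Real.pi * t * Complex.I) / 2 := by
    rw [← Complex.mul_conj, ← Complex.cos_conj]
    have hcc : (starRingEnd ℂ) (Real.pi * w / 2)
        = Real.pi * (-(1 / 2 : ℂ) - t * Complex.I) / 2 := by
      rw [map_div₀, map_mul, hc, Complex.conj_ofReal, Complex.conj_ofNat]
    rw [hcc]
    have h1 := Complex.cos_add (Real.pi * w / 2) (Real.pi * (-(1 / 2 : ℂ) - t * Complex.I) / 2)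
    have h2 := Complex.cos_sub (Real.pi * w / 2) (Real.pi * (-(1 / 2 : ℂ) - t * Complex.I) / 2)
    have h3 : (Real.pi * w / 2 + Real.pi * (-(1 / 2 : ℂ) - t * Complex.I) / 2 : ℂ)
        = -(Real.pi / 2) := by rw [hw]; ring
    have h4 : (Real.pi * w / 2 - Real.pi * (-(1 / 2 : ℂ) - t * Complex.I) / 2 : ℂ)
        = Real.pi * t * Complex.I := by rw [hw]; ring
    rw [h3, Complex.cos_neg, Complex.cos_pi_div_two] at h1
    rw [h4] at h2
    linear_combination (-1 / 2 : ℂ) * h1 - (1 / 2 : ℂ) * h2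
  have hch : Complex.cos (Real.pi * t * Complex.I) = ((Real.cosh (Real.pi * t) : ℝ) : ℂ) := by
    rw [Complex.cos_mul_I]; push_cast; rfl
  rw [hch] at hsin hcos
  rw [hsin] at hr
  have hr' : Complex.normSq (w * Complex.Gamma w) = Real.pi / Real.cosh (Real.pi * t) := by
    exact_mod_cast hr
  have hcos' : Complex.normSq (Complex.cos (Real.pi * w / 2)) = Real.cosh (Real.pi * t) / 2 := by
    exact_mod_cast hcos
  have hpos := Real.cosh_pos (Real.pi * t)
  have hwn : 1 / 4 ≤ Complex.normSq w := by
    rw [Complex.normSq_apply, hw]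
    simp
    nlinarith [mul_self_nonneg t]
  rw [Complex.normSq_mul] at hr' ⊢
  rw [hcos']
  have hN := Complex.normSq_nonneg (Complex.Gamma w)
  have h5 : Complex.normSq w * Complex.normSq (Complex.Gamma w) * Real.cosh (Real.pi * t)
      = Real.pi := by rw [hr']; field_simp
  nlinarith [mul_nonneg hN hpos.le]

theorem exists_norm_zetaInv_left_le :
    ∃ K : ℝ, 0 < K ∧ ∀ t : ℝ, ‖zetaInv (-(1 / 2 : ℂ) + t * Complex.I)‖ ≤ K := by
  obtain ⟨K, hK, h⟩ := exists_norm_zetaInv_le_of_le_re (a := 3 / 2) (by norm_num)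
  refine ⟨2 * (2 * Real.pi) ^ (1 / 2 : ℝ) * Real.sqrt (2 * Real.pi) * K, by positivity,
    fun t => ?_⟩
  set w : ℂ := -(1 / 2 : ℂ) + t * Complex.I with hw
  have hre : w.re = -(1 / 2) := by simp [hw]
  have h1 : (1 - w).re = 3 / 2 := by rw [Complex.sub_re, hre]; norm_num
  rw [zetaInv_functional_equation]
  · rw [mul_assoc (2 * _), norm_mul, norm_mul, norm_mul, norm_two_pi_cpow, hre]
    have h2 : ‖Complex.Gamma w * Complex.cos (Real.pi * w / 2)‖ ≤ Real.sqrt (2 * Real.pi) := by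
      apply Real.le_sqrt_of_sq_le
      rw [← Complex.normSq_eq_norm_sq]
      exact normSq_Gamma_mul_cos t
    have h3 := h (1 - w) h1.ge
    simp only [Complex.norm_ofNat, neg_neg]
    gcongr
  · intro n hn
    have := congrArg Complex.re hn
    rw [hre] at this
    simp at this
    have h4 : (2 : ℝ)⁻¹ * 2 = n * 2 := by rw [this]
    norm_num at h4
    have h5 : 1 = n * 2 := by exact_mod_cast h4
    omega
  · intro h4; rw [h4] at hre; norm_num at hre
  · exact riemannZeta_ne_zero_of_one_le_re (by rw [h1]; norm_num)

theorem norm_cos_le_exp (z : ℂ) : ‖Complex.cos z‖ ≤ Real.exp |z.im| := by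
  rw [Complex.cos, norm_div, Complex.norm_ofNat, div_le_iff₀ (by norm_num)]
  refine (norm_add_le _ _).trans ?_
  rw [Complex.norm_exp, Complex.norm_exp]
  have h1 : Real.exp (z * Complex.I).re ≤ Real.exp |z.im| := by
    apply Real.exp_le_exp.2; simp [neg_le_abs]
  have h2 : Real.exp (-z * Complex.I).re ≤ Real.exp |z.im| := by
    apply Real.exp_le_exp.2; simp [le_abs_self]
  linarith

theorem norm_Gamma_le {s : ℂ} (hs : 0 < s.re) : ‖Complex.Gamma s‖ ≤ Real.Gamma s.re := by
  rw [Complex.Gamma_eq_integral hs, Real.Gamma_eq_integral hs, Complex.GammaIntegral]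
  refine (norm_integral_le_integral_norm _).trans_eq ?_
  refine setIntegral_congr_fun measurableSet_Ioi fun x hx => ?_
  simp only [norm_mul, Complex.norm_cpow_eq_rpow_re_of_pos (Set.mem_Ioi.1 hx), Complex.norm_real,
    Real.norm_eq_abs, Real.abs_exp]
  simp

theorem exists_norm_zetaInv_le_reflect :
    ∃ K : ℝ, 0 < K ∧ ∀ w : ℂ, |w.re| ≤ 1 / 2 → 1 ≤ |w.im| → riemannZeta (1 - w) ≠ 0 →
      ‖zetaInv w‖ ≤ K * Real.exp (2 * |w.im|) * ‖zetaInv (1 - w)‖ := by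
  obtain ⟨B, hB⟩ : ∃ B, ∀ x ∈ Set.Icc (1 / 2 : ℝ) (3 / 2), Real.Gamma x ≤ B := by
    have hc : ContinuousOn Real.Gamma (Set.Icc (1 / 2 : ℝ) (3 / 2)) := fun x hx =>
      (Real.differentiableAt_Gamma fun m hm => by
        have := hx.1; rw [hm] at this
        have h0 : (0 : ℝ) ≤ m := m.cast_nonneg
        linarith).continuousAt.continuousWithinAt
    obtain ⟨B, hB⟩ := isCompact_Icc.bddAbove_image hc
    exact ⟨B, fun x hx => hB ⟨x, hx, rfl⟩⟩
  have hB0 : 0 < B := (Real.Gamma_pos_of_pos (by norm_num)).trans_le (hB 1 (by norm_num))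
  refine ⟨2 * (2 * Real.pi) ^ (1 / 2 : ℝ) * B, by positivity, fun w hre him hz => ?_⟩
  have hre' := abs_le.1 hre
  have him0 : w.im ≠ 0 := by intro h; rw [h] at him; norm_num at him
  have hn : ∀ n : ℕ, w ≠ -n := fun n h => him0 (by rw [h]; simp)
  have hw0 : w ≠ 0 := fun h => him0 (by rw [h]; simp)
  rw [zetaInv_functional_equation hn (fun h => him0 (by rw [h]; simp)) hz]
  rw [norm_mul, norm_mul, norm_mul, norm_mul, norm_two_pi_cpow, Complex.norm_ofNat]
  have h1 : (2 * Real.pi) ^ (-w.re) ≤ (2 * Real.pi) ^ (1 / 2 : ℝ) :=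
    Real.rpow_le_rpow_of_exponent_le (by linarith [Real.pi_gt_three]) (by linarith)
  have h2 : ‖Complex.Gamma w‖ ≤ B := by
    have h3 : ‖Complex.Gamma (w + 1)‖ ≤ B := by
      refine (norm_Gamma_le (by simp; linarith)).trans (hB _ ⟨?_, ?_⟩) <;> simp <;> linarith
    rw [Complex.Gamma_add_one w hw0, norm_mul] at h3
    have h4 : 1 ≤ ‖w‖ := him.trans (Complex.abs_im_le_norm w)
    nlinarith [norm_nonneg (Complex.Gamma w)]
  have h5 : ‖Complex.cos (Real.pi * w / 2)‖ ≤ Real.exp (2 * |w.im|) := by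
    refine (norm_cos_le_exp _).trans (Real.exp_le_exp.2 ?_)
    have : (Real.pi * w / 2 : ℂ).im = Real.pi / 2 * w.im := by
      have : (Real.pi * w / 2 : ℂ) = ((Real.pi / 2 : ℝ) : ℂ) * w := by push_cast; ring
      rw [this, Complex.im_ofReal_mul]
    rw [this, abs_mul, abs_of_pos (by positivity)]
    gcongr
    linarith [Real.pi_le_four]
  gcongr

theorem card_zeros_le_of_norm_le {f : ℂ → ℂ} {c : ℂ} {r R M : ℝ} (hf : Differentiable ℂ f)
    (hr : 0 < r) (hrR : r < R) (hM : 1 ≤ M) (hc : f c ≠ 0)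
    (hb : ∀ z ∈ Metric.sphere c R, ‖f z‖ ≤ M) (S : Finset ℂ)
    (hS : ∀ z ∈ S, z ∈ Metric.closedBall c r ∧ f z = 0) :
    (S.card : ℝ) ≤ Real.log (M / ‖f c‖) / Real.log (R / r) := by
  have hA : AnalyticOnNhd ℂ f Set.univ := fun z _ => hf.analyticAt z
  have hR : 0 < R := hr.trans hrR
  have h := AnalyticOnNhd.sum_divisor_le (c := c) (r := r) (R := R) (M := M) (f := f)
    (abs_pos.2 hr.ne') (by rwa [abs_of_pos hr, abs_of_pos hR]) hM
    (hA.mono (Set.subset_univ _)) hc (by rwa [abs_of_pos hR])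
  rw [abs_of_pos hr] at h
  refine le_trans ?_ h
  set D := MeromorphicOn.divisor f (Metric.closedBall c r) with hD
  have hAb : AnalyticOnNhd ℂ f (Metric.closedBall c r) := hA.mono (Set.subset_univ _)
  have hfin : D.support.Finite := D.finiteSupport (isCompact_closedBall c r)
  have hnn : ∀ z, 0 ≤ D z := fun z => MeromorphicOn.AnalyticOnNhd.divisor_nonneg hAb z
  have hone : ∀ z ∈ S, 1 ≤ D z := by
    intro z hz
    obtain ⟨hzb, hz0⟩ := hS z hz
    rw [hD, MeromorphicOn.AnalyticOnNhd.divisor_apply hAb hzb]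
    have h1 : analyticOrderAt f z ≠ 0 := fun h0 =>
      ((hf.analyticAt z).analyticOrderAt_eq_zero.1 h0) hz0
    have h2 : analyticOrderAt f z ≠ ⊤ := by
      intro ht
      have := hA.eqOn_zero_of_preconnected_of_eventuallyEq_zero isPreconnected_univ
        (Set.mem_univ z) (analyticOrderAt_eq_top.1 ht)
      exact hc (this (Set.mem_univ c))
    obtain ⟨n, hn⟩ := ENat.ne_top_iff_exists.1 h2
    rw [← hn] at h1 ⊢
    have h3 : 1 ≤ n := Nat.one_le_iff_ne_zero.2 (by exact_mod_cast h1)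
    simpa using h3
  have hsub : S ⊆ hfin.toFinset := fun z hz => by
    rw [Set.Finite.mem_toFinset, Function.mem_support]
    have := hone z hz
    omega
  rw [finsum_eq_sum_of_support_subset D (s := hfin.toFinset) (by simp)]
  have h5 : (S.card : ℤ) ≤ ∑ z ∈ hfin.toFinset, D z := by
    calc (S.card : ℤ) = ∑ z ∈ S, 1 := by simp
      _ ≤ ∑ z ∈ S, D z := Finset.sum_le_sum hone
      _ ≤ _ := Finset.sum_le_sum_of_subset_of_nonneg hsub fun z _ _ => hnn z
  exact_mod_cast h5

theorem exists_eq_prod_sub_mul {f : ℂ → ℂ} (hf : Differentiable ℂ f) (S : Finset ℂ)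
    (hS : ∀ z ∈ S, f z = 0) :
    ∃ g : ℂ → ℂ, Differentiable ℂ g ∧ ∀ s, f s = (∏ ρ ∈ S, (s - ρ)) * g s := by
  classical
  induction S using Finset.induction_on with
  | empty => exact ⟨f, hf, by simp⟩
  | insert a S ha ih =>
    obtain ⟨g, hg, hfg⟩ := ih fun z hz => hS z (Finset.mem_insert_of_mem hz)
    have hga : g a = 0 := by
      have h := hfg a
      rw [hS a (Finset.mem_insert_self _ _)] at h
      refine (mul_eq_zero.1 h.symm).resolve_left (Finset.prod_ne_zero_iff.2 fun ρ hρ => ?_)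
      exact sub_ne_zero.2 fun h => ha (h ▸ hρ)
    refine ⟨dslope g a, ?_, fun s => ?_⟩
    · rw [← differentiableOn_univ] at hg ⊢
      exact (Complex.differentiableOn_dslope univ_mem).2 hg
    · have h := sub_smul_dslope g a s
      rw [hga, sub_zero, smul_eq_mul] at h
      rw [Finset.prod_insert ha, hfg s, ← h]
      ring

theorem norm_ge_of_ne_zero_on_ball {g : ℂ → ℂ} {c s : ℂ} {r r' M : ℝ}
    (hg : Differentiable ℂ g) (hr : 0 < r) (hs : ‖s - c‖ ≤ r') (hr' : r' < r)
    (h0 : ∀ z ∈ Metric.ball c r, g z ≠ 0) (hM : ∀ z ∈ Metric.ball c r, ‖g z‖ ≤ M) :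
    ‖g c‖ * Real.exp (-(2 * (Real.log (M / ‖g c‖) + 1) * r' / (r - r'))) ≤ ‖g s‖ := by
  have hcb : c ∈ Metric.ball c r := Metric.mem_ball_self hr
  have hgc : 0 < ‖g c‖ := norm_pos_iff.2 (h0 c hcb)
  have hsb : s ∈ Metric.ball c r := by rw [mem_ball_iff_norm]; linarith
  have hd : DifferentiableOn ℂ (fun z => deriv g z / g z) (Metric.ball c r) := by
    have h1 : Differentiable ℂ (deriv g) := by
      rw [← differentiableOn_univ] at hg ⊢
      exact hg.deriv isOpen_univ
    exact fun z hz => ((h1 z).div (hg z) (h0 z hz)).differentiableWithinAt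
  obtain ⟨L, hL⟩ := hd.isExactOn_ball
  have hconst : ∀ z ∈ Metric.ball c r, g z = g c * Complex.exp (L z - L c) := by
    have hder : ∀ z ∈ Metric.ball c r,
        HasDerivAt (fun z => g z * Complex.exp (-(L z - L c))) 0 z := by
      intro z hz
      have h1 := (hg z).hasDerivAt.mul (((hL z hz).sub_const (L c)).neg.cexp)
      have h2 : deriv g z * Complex.exp (-(L z - L c))
          + g z * (Complex.exp (-(L z - L c)) * -(deriv g z / g z)) = 0 := by
        have := h0 z hz
        field_simp
        ring
      rw [← h2]
      exact h1
    intro z hz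
    have h2 := (convex_ball c r).is_const_of_fderivWithin_eq_zero (𝕜 := ℂ)
      (f := fun z => g z * Complex.exp (-(L z - L c)))
      (fun w hw => (hder w hw).differentiableAt.differentiableWithinAt)
      (fun w hw => by
        rw [fderivWithin_of_isOpen Metric.isOpen_ball hw]
        rw [(hder w hw).hasFDerivAt.fderiv]
        simp) hz hcb
    simp only [sub_self, neg_zero, Complex.exp_zero, mul_one] at h2
    rw [← h2, mul_assoc, ← Complex.exp_add]
    simp
  have hnorm : ∀ z ∈ Metric.ball c r, ‖g z‖ = ‖g c‖ * Real.exp (L z - L c).re := by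
    intro z hz
    rw [hconst z hz, norm_mul, Complex.norm_exp]
  have hMc : ‖g c‖ ≤ M := hM c hcb
  have hlog : 0 < Real.log (M / ‖g c‖) + 1 := by
    have : 0 ≤ Real.log (M / ‖g c‖) := Real.log_nonneg ((one_le_div hgc).2 hMc)
    linarith
  have hmem : ∀ z ∈ Metric.ball (0 : ℂ) r, z + c ∈ Metric.ball c r := by
    intro z hz
    rw [mem_ball_iff_norm, add_sub_cancel_right]
    exact mem_ball_zero_iff.1 hz
  have hBC := Complex.borelCaratheodory_zero (f := fun z => L (z + c) - L c) (z := s - c)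
    (M := Real.log (M / ‖g c‖) + 1) (R := r) hlog
    (fun z hz => by
      have h1 := ((hL (z + c) (hmem z hz)).comp_add_const z c)
      exact (h1.sub_const _).differentiableAt.differentiableWithinAt)
    (fun z hz => by
      have h1 := hM _ (hmem z hz)
      rw [hnorm _ (hmem z hz), mul_comm, ← le_div_iff₀ hgc] at h1
      have h2 : (L (z + c) - L c).re ≤ Real.log (M / ‖g c‖) :=
        (Real.le_log_iff_exp_le ((Real.exp_pos _).trans_le h1)).2 h1
      show (L (z + c) - L c).re ≤ _
      linarith) hr (by rw [mem_ball_zero_iff]; linarith) (by simp)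
  simp only [sub_add_cancel] at hBC
  rw [hnorm s hsb]
  gcongr
  have hr'0 : 0 ≤ r' := (norm_nonneg _).trans hs
  have h3 : 2 * (Real.log (M / ‖g c‖) + 1) * ‖s - c‖ / (r - ‖s - c‖)
      ≤ 2 * (Real.log (M / ‖g c‖) + 1) * r' / (r - r') := by
    gcongr
  have h4 := (abs_le.1 (Complex.abs_re_le_norm (L s - L c))).1
  linarith

/-- A lower bound for an entire function away from its zeros, which are assumed to be simple. -/
theorem norm_ge_of_dist_zeros {f : ℂ → ℂ} {c s : ℂ} {M m d : ℝ} (hf : Differentiable ℂ f)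
    (hm : 0 < m) (hmc : m ≤ ‖f c‖) (hM : ∀ z ∈ Metric.sphere c (7 / 4), ‖f z‖ ≤ M)
    (Z : Finset ℂ) (hZ : ∀ z, z ∈ Z ↔ z ∈ Metric.closedBall c (8 / 5) ∧ f z = 0)
    (hsimple : ∀ z ∈ Z, deriv f z ≠ 0) (hs : ‖s - c‖ ≤ 3 / 2) (hd : 0 < d)
    (hds : ∀ z ∈ Z, d ≤ ‖s - z‖) :
    m * (d / 2) ^ Z.card * Real.exp (-(30 * (Real.log (M / m) + 3 * Z.card + 1))) ≤ ‖f s‖ := by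
  classical
  obtain ⟨g, hg, hfg⟩ := exists_eq_prod_sub_mul hf Z fun z hz => ((hZ z).1 hz).2
  have hball : ∀ z ∈ Metric.closedBall c (7 / 4), ‖g z‖ ≤ M * 7 ^ Z.card := by
    intro z hz
    have h1 : ∀ w ∈ frontier (Metric.ball c (7 / 4)), ‖g w‖ ≤ M * 7 ^ Z.card := by
      intro w hw
      rw [frontier_ball c (by norm_num)] at hw
      have h2 := hM w hw
      rw [hfg, norm_mul, norm_prod] at h2
      have h3 : (1 / 7 : ℝ) ^ Z.card ≤ ∏ ρ ∈ Z, ‖w - ρ‖ := by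
        rw [← Finset.prod_const]
        refine Finset.prod_le_prod (fun _ _ => by norm_num) fun ρ hρ => ?_
        have h4 := ((hZ ρ).1 hρ).1
        rw [mem_closedBall_iff_norm] at h4
        rw [mem_sphere_iff_norm] at hw
        have h5 : ‖w - c‖ ≤ ‖w - ρ‖ + ‖ρ - c‖ := norm_sub_le_norm_sub_add_norm_sub _ _ _
        linarith
      have h6 : (1 / 7 : ℝ) ^ Z.card * ‖g w‖ ≤ M :=
        (mul_le_mul_of_nonneg_right h3 (norm_nonneg _)).trans h2
      rw [one_div, inv_pow, inv_mul_le_iff₀ (by positivity)] at h6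
      linarith
    refine Complex.norm_le_of_forall_mem_frontier_norm_le Metric.isBounded_ball
      hg.diffContOnCl h1 ?_
    rwa [closure_ball c (by norm_num)]
  have hprodc : ∏ ρ ∈ Z, ‖c - ρ‖ ≤ 2 ^ Z.card := by
    rw [← Finset.prod_const]
    refine Finset.prod_le_prod (fun _ _ => norm_nonneg _) fun ρ hρ => ?_
    have h4 := ((hZ ρ).1 hρ).1
    rw [mem_closedBall_iff_norm, norm_sub_rev] at h4
    linarith
  have hgc : m / 2 ^ Z.card ≤ ‖g c‖ := by
    rw [div_le_iff₀ (by positivity), mul_comm]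
    rw [hfg, norm_mul, norm_prod] at hmc
    exact hmc.trans (mul_le_mul_of_nonneg_right hprodc (norm_nonneg _))
  have hgc0 : 0 < ‖g c‖ := lt_of_lt_of_le (by positivity) hgc
  have h0 : ∀ z ∈ Metric.ball c (8 / 5), g z ≠ 0 := by
    intro z hz hgz
    have hfz : f z = 0 := by rw [hfg, hgz, mul_zero]
    have hzZ : z ∈ Z := (hZ z).2 ⟨Metric.ball_subset_closedBall hz, hfz⟩
    refine hsimple z hzZ ?_
    have hP : DifferentiableAt ℂ (fun s => ∏ ρ ∈ Z, (s - ρ)) z := by fun_prop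
    have hfe : f = fun s => (∏ ρ ∈ Z, (s - ρ)) * g s := funext hfg
    rw [hfe, deriv_fun_mul hP (hg z), hgz, Finset.prod_eq_zero hzZ (sub_self z)]
    simp
  have h7 := norm_ge_of_ne_zero_on_ball (c := c) (s := s) (r := 8 / 5) (r' := 3 / 2) hg
    (by norm_num) hs (by norm_num) h0 fun z hz => hball z (Metric.ball_subset_closedBall
      (Metric.ball_subset_ball (by norm_num) hz))
  have hM0 : 0 < M := by
    have := hgc0.trans_le (hball c (Metric.mem_closedBall_self (by norm_num)))
    exact pos_of_mul_pos_left this (by positivity)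
  have hlog : Real.log (M * 7 ^ Z.card / ‖g c‖) ≤ Real.log (M / m) + 3 * Z.card := by
    have h8 : M * 7 ^ Z.card / ‖g c‖ ≤ M / m * 14 ^ Z.card := by
      rw [div_le_iff₀ hgc0]
      calc M * 7 ^ Z.card = M / m * 14 ^ Z.card * (m / 2 ^ Z.card) := by
            rw [show (14 : ℝ) = 7 * 2 by norm_num, mul_pow]; field_simp
        _ ≤ _ := by gcongr
    refine (Real.log_le_log (by positivity) h8).trans ?_
    rw [Real.log_mul (by positivity) (by positivity), Real.log_pow]
    have h14 : Real.log 14 ≤ 3 := by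
      rw [Real.log_le_iff_le_exp (by norm_num)]
      have h1 := Real.exp_one_gt_d9
      rw [show (3 : ℝ) = 1 + 1 + 1 by norm_num, Real.exp_add, Real.exp_add]
      have h2 : (2.7 : ℝ) ≤ Real.exp 1 := by linarith
      have h3 : (2.7 * 2.7 : ℝ) ≤ Real.exp 1 * Real.exp 1 := by gcongr
      nlinarith
    have : (Z.card : ℝ) * Real.log 14 ≤ Z.card * 3 := by gcongr
    linarith
  have hprods : d ^ Z.card ≤ ∏ ρ ∈ Z, ‖s - ρ‖ := by
    rw [← Finset.prod_const]
    exact Finset.prod_le_prod (fun _ _ => hd.le) hds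
  rw [hfg s, norm_mul, norm_prod]
  calc m * (d / 2) ^ Z.card * Real.exp (-(30 * (Real.log (M / m) + 3 * Z.card + 1)))
      = d ^ Z.card * (m / 2 ^ Z.card
        * Real.exp (-(30 * (Real.log (M / m) + 3 * Z.card + 1)))) := by rw [div_pow]; ring
    _ ≤ (∏ ρ ∈ Z, ‖s - ρ‖) * (‖g c‖ * Real.exp (-(2 * (Real.log (M * 7 ^ Z.card / ‖g c‖) + 1)
        * (3 / 2) / (8 / 5 - 3 / 2)))) := by
      gcongr
      norm_num
      linarith
    _ ≤ _ := by gcongr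

/-- The zeros of `ζ` in the critical strip lie on the critical line. -/
def ZetaZerosOnLine : Prop :=
  ∀ ρ : ℂ, riemannZeta ρ = 0 → 0 < ρ.re → ρ.re < 1 → ρ.re = 1 / 2

/-- The zeros of `ζ` in the critical strip are simple. -/
def ZetaZerosSimple : Prop :=
  ∀ ρ : ℂ, riemannZeta ρ = 0 → 0 < ρ.re → ρ.re < 1 → deriv riemannZeta ρ ≠ 0

/-- The ordinates of the zeros of `ζ` on the critical line. -/
def zetaOrd : Set ℝ := {γ | riemannZeta (1 / 2 + γ * Complex.I) = 0}

theorem zetaInv_conj (s : ℂ) : zetaInv ((starRingEnd ℂ) s) = (starRingEnd ℂ) (zetaInv s) := by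
  by_cases hs : s = 1
  · simp [hs, zetaInv]
  · have hs' : (starRingEnd ℂ) s ≠ 1 := fun h => hs (by simpa using congrArg (starRingEnd ℂ) h)
    rw [zetaInv_eq_inv hs, zetaInv_eq_inv hs', riemannZeta_conj, map_inv₀]

theorem neg_mem_zetaOrd {γ : ℝ} (h : γ ∈ zetaOrd) : -γ ∈ zetaOrd := by
  have h1 : (1 / 2 + ((-γ : ℝ) : ℂ) * Complex.I) = (starRingEnd ℂ) (1 / 2 + γ * Complex.I) := by
    simp [Complex.conj_ofReal, Complex.conj_ofNat]
  show riemannZeta (1 / 2 + ((-γ : ℝ) : ℂ) * Complex.I) = 0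
  rw [h1, riemannZeta_conj, show riemannZeta (1 / 2 + γ * Complex.I) = 0 from h, map_zero]

theorem half_add_ne_one (γ : ℝ) : (1 / 2 + γ * Complex.I : ℂ) ≠ 1 := by
  intro h
  have := congrArg Complex.re h
  norm_num at this

theorem riemannZeta₁_eq_zero_of_mem {γ : ℝ} (h : γ ∈ zetaOrd) :
    riemannZeta₁ (1 / 2 + γ * Complex.I) = 0 := by
  rw [riemannZeta₁_eq_of_ne_one (half_add_ne_one γ),
    show riemannZeta (1 / 2 + γ * Complex.I) = 0 from h, mul_zero]

theorem deriv_riemannZeta₁_of_mem {γ : ℝ} (h : γ ∈ zetaOrd) :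
    deriv riemannZeta₁ (1 / 2 + γ * Complex.I)
      = (1 / 2 + γ * Complex.I - 1) * deriv riemannZeta (1 / 2 + γ * Complex.I) := by
  have h1 : riemannZeta₁ =ᶠ[𝓝 (1 / 2 + γ * Complex.I : ℂ)] fun s => (s - 1) * riemannZeta s := by
    filter_upwards [isOpen_ne.mem_nhds (half_add_ne_one γ)] with s hs
    exact riemannZeta₁_eq_of_ne_one hs
  rw [h1.deriv_eq, deriv_fun_mul (by fun_prop)
    (differentiableAt_riemannZeta (half_add_ne_one γ)),
    show riemannZeta (1 / 2 + γ * Complex.I) = 0 from h]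
  simp

theorem re_eq_half_of_riemannZeta₁_eq_zero (hRH : ZetaZerosOnLine) {s : ℂ}
    (hs : riemannZeta₁ s = 0) (hre : -1 < s.re) : s.re = 1 / 2 ∧ s.im ∈ zetaOrd := by
  have h1 : s ≠ 1 := by rintro rfl; rw [riemannZeta₁_one] at hs; exact one_ne_zero hs
  have hz : riemannZeta s = 0 := by
    rw [riemannZeta₁_eq_of_ne_one h1] at hs
    exact (mul_eq_zero.1 hs).resolve_left (sub_ne_zero.2 h1)
  have hlt : s.re < 1 := by
    by_contra! h
    exact riemannZeta_ne_zero_of_one_le_re h hz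
  have hpos : 0 < s.re := by
    by_contra! h
    have h0 : s ≠ 0 := by
      rintro rfl; rw [riemannZeta_zero] at hz; norm_num at hz
    have hn : ∀ n : ℕ, s ≠ -n := by
      rintro n rfl
      simp at hre
      rcases n.eq_zero_or_pos with h2 | h2
      · exact h0 (by simp [h2])
      · have : (1 : ℝ) ≤ n := by exact_mod_cast h2
        linarith
    have h3 := riemannZeta_one_sub hn h1
    rw [hz, mul_zero] at h3
    exact riemannZeta_ne_zero_of_one_le_re (by simp; exact h) h3
  have hh := hRH s hz hpos hlt
  refine ⟨hh, ?_⟩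
  have h4 : (1 / 2 + (s.im : ℂ) * Complex.I) = s := by
    apply Complex.ext
    · simp [hh]
    · simp
  show riemannZeta (1 / 2 + (s.im : ℂ) * Complex.I) = 0
  rw [h4, hz]

theorem deriv_ne_zero_of_mem (hs : ZetaZerosSimple) {γ : ℝ} (h : γ ∈ zetaOrd) :
    deriv riemannZeta (1 / 2 + γ * Complex.I) ≠ 0 :=
  hs _ h (by norm_num) (by norm_num)

theorem norm_riemannZeta₁_le_of_mem_closedBall {v : ℝ} {z : ℂ}
    (hz : z ∈ Metric.closedBall (2 + v * Complex.I) (7 / 4)) :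
    ‖riemannZeta₁ z‖ ≤ 125 * (1 + |v|) ^ 2 := by
  rw [mem_closedBall_iff_norm] at hz
  have hre : 1 / 4 ≤ z.re := by
    have := (abs_le.1 ((Complex.abs_re_le_norm _).trans hz)).1
    simp at this
    linarith
  have hn : ‖z‖ ≤ 2 + |v| + 7 / 4 := by
    have h1 : ‖(2 + v * Complex.I : ℂ)‖ ≤ 2 + |v| := by
      refine (norm_add_le _ _).trans ?_
      simp
    have h2 : ‖z‖ ≤ ‖z - (2 + v * Complex.I)‖ + ‖(2 + v * Complex.I : ℂ)‖ :=
      norm_le_norm_sub_add _ _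
    linarith
  refine (norm_riemannZeta₁_le hre).trans ?_
  have h3 : 1 + ‖z‖ ≤ 5 * (1 + |v|) := by linarith [abs_nonneg v]
  have h4 : (1 + ‖z‖) ^ 2 ≤ (5 * (1 + |v|)) ^ 2 := by gcongr
  linarith

theorem exists_le_norm_riemannZeta₁ :
    ∃ m : ℝ, 0 < m ∧ ∀ v : ℝ, m ≤ ‖riemannZeta₁ (2 + v * Complex.I)‖ := by
  obtain ⟨K, hK, h⟩ := exists_norm_zetaInv_le_of_le_re (a := 3 / 2) (by norm_num)
  refine ⟨K⁻¹, inv_pos.2 hK, fun v => ?_⟩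
  have h1 := h (2 + v * Complex.I) (by norm_num)
  rw [zetaInv, norm_div] at h1
  have h2 : 1 ≤ ‖(2 + v * Complex.I - 1 : ℂ)‖ := by
    have := Complex.abs_re_le_norm (2 + v * Complex.I - 1 : ℂ)
    norm_num at this
    exact this
  have hne : (2 + v * Complex.I : ℂ) ≠ 1 := by
    intro h3; rw [h3] at h2; norm_num at h2
  have h3 : riemannZeta₁ (2 + v * Complex.I) ≠ 0 := by
    rw [riemannZeta₁_eq_of_ne_one hne]
    exact mul_ne_zero (sub_ne_zero.2 hne) (riemannZeta_ne_zero_of_one_le_re (by norm_num))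
  have h4 : 0 < ‖riemannZeta₁ (2 + v * Complex.I)‖ := norm_pos_iff.2 h3
  rw [div_le_iff₀ h4] at h1
  rw [inv_le_iff_one_le_mul₀' hK]
  linarith

theorem exists_card_zeros_le :
    ∃ A : ℝ, 1 ≤ A ∧ ∀ (v : ℝ) (S : Finset ℂ),
      (∀ z ∈ S, z ∈ Metric.closedBall (2 + v * Complex.I) (8 / 5) ∧ riemannZeta₁ z = 0) →
      (S.card : ℝ) ≤ A * (1 + |v|) ^ (1 / 4 : ℝ) := by
  obtain ⟨m, hm, h⟩ := exists_le_norm_riemannZeta₁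
  have hlog : 0 < Real.log ((7 / 4) / (8 / 5)) := Real.log_pos (by norm_num)
  refine ⟨max 1 ((125 / m) ^ (1 / 8 : ℝ) / (1 / 8) / Real.log ((7 / 4) / (8 / 5))),
    le_max_left _ _, fun v S hS => ?_⟩
  have hv : 1 ≤ 1 + |v| := by linarith [abs_nonneg v]
  have h1 := card_zeros_le_of_norm_le (c := 2 + v * Complex.I) (r := 8 / 5) (R := 7 / 4)
    (M := 125 * (1 + |v|) ^ 2) differentiable_riemannZeta₁ (by norm_num) (by norm_num)
    (by nlinarith) (norm_pos_iff.1 (hm.trans_le (h v)))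
    (fun z hz => norm_riemannZeta₁_le_of_mem_closedBall (Metric.sphere_subset_closedBall hz)) S hS
  refine h1.trans (le_trans ?_ (mul_le_mul_of_nonneg_right (le_max_right _ _) (by positivity)))
  rw [div_mul_eq_mul_div]
  gcongr
  have hn := hm.trans_le (h v)
  calc Real.log (125 * (1 + |v|) ^ 2 / ‖riemannZeta₁ (2 + v * Complex.I)‖)
      ≤ Real.log (125 / m * (1 + |v|) ^ 2) := by
        apply Real.log_le_log (by positivity)
        rw [div_mul_eq_mul_div]
        gcongr
        exact h v
    _ ≤ (125 / m * (1 + |v|) ^ 2) ^ (1 / 8 : ℝ) / (1 / 8) :=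
        Real.log_le_rpow_div (by positivity) (by norm_num)
    _ = _ := by
        rw [Real.mul_rpow (by positivity) (by positivity), ← Real.rpow_natCast (1 + |v|) 2,
          ← Real.rpow_mul (by positivity)]
        norm_num
        ring

theorem half_add_mem_closedBall {v γ : ℝ} (h : |γ - v| ≤ 1 / 2) :
    (1 / 2 + γ * Complex.I : ℂ) ∈ Metric.closedBall (2 + v * Complex.I) (8 / 5) := by
  rw [mem_closedBall_iff_norm, ← abs_of_pos (show (0 : ℝ) < 8 / 5 by norm_num),
    ← abs_norm, ← sq_le_sq, ← Complex.normSq_eq_norm_sq, Complex.normSq_apply]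
  have := sq_le_sq' (abs_le.1 h).1 (abs_le.1 h).2
  simp
  nlinarith

theorem exists_card_zetaOrd_le :
    ∃ A : ℝ, 1 ≤ A ∧ ∀ (v : ℝ) (S : Finset ℝ), (∀ γ ∈ S, γ ∈ zetaOrd ∧ |γ - v| ≤ 1 / 2) →
      (S.card : ℝ) ≤ A * (1 + |v|) ^ (1 / 4 : ℝ) := by
  classical
  obtain ⟨A, hA, h⟩ := exists_card_zeros_le
  refine ⟨A, hA, fun v S hS => ?_⟩
  have hinj : Function.Injective fun γ : ℝ => (1 / 2 + γ * Complex.I : ℂ) := by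
    intro a b hab
    simpa using hab
  have h1 := h v (S.image fun γ : ℝ => (1 / 2 + γ * Complex.I : ℂ)) fun z hz => by
    obtain ⟨γ, hγ, rfl⟩ := Finset.mem_image.1 hz
    exact ⟨half_add_mem_closedBall (hS γ hγ).2, riemannZeta₁_eq_zero_of_mem (hS γ hγ).1⟩
  rwa [Finset.card_image_of_injective _ hinj] at h1

theorem Set.finite_of_forall_finset_card_le {α : Type*} {s : Set α} {B : ℝ}
    (h : ∀ S : Finset α, ↑S ⊆ s → (S.card : ℝ) ≤ B) : s.Finite := by
  by_contra hs
  obtain ⟨S, hS, hc⟩ := Set.Infinite.exists_subset_card_eq hs (⌊B⌋₊ + 1)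
  have h1 := h S hS
  rw [hc] at h1
  push_cast at h1
  linarith [Nat.lt_floor_add_one B]

theorem finite_zetaOrd_inter (v : ℝ) : {γ | γ ∈ zetaOrd ∧ |γ - v| ≤ 1 / 2}.Finite := by
  obtain ⟨A, -, h⟩ := exists_card_zetaOrd_le
  exact Set.finite_of_forall_finset_card_le fun S hS => h v S fun γ hγ => hS hγ

theorem exists_forall_le_abs_sub {S : Finset ℝ} {a b d : ℝ} (hd : 0 ≤ d)
    (hlt : S.card * (2 * d) < b - a) : ∃ T ∈ Set.Icc a b, ∀ γ ∈ S, d ≤ |T - γ| := by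
  by_contra! h
  have hsub : Set.Icc a b ⊆ ⋃ γ ∈ S, Metric.ball γ d := by
    intro T hT
    obtain ⟨γ, hγ, h1⟩ := h T hT
    exact Set.mem_biUnion hγ (by rwa [Metric.mem_ball, Real.dist_eq])
  have h1 := (measure_mono hsub).trans (measure_biUnion_finset_le (μ := volume) S _)
  simp only [Real.volume_Icc, Real.volume_ball, Finset.sum_const, nsmul_eq_mul] at h1
  rw [← ENNReal.ofReal_natCast, ← ENNReal.ofReal_mul (by positivity),
    ENNReal.ofReal_le_ofReal_iff (by positivity)] at h1
  linarith

theorem exists_norm_zetaInv_le_of_dist (hRH : ZetaZerosOnLine) (hs : ZetaZerosSimple) {B : ℝ}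
    (hB : 0 < B) :
    ∃ C : ℝ, 0 < C ∧ ∀ (T d σ x : ℝ), 1 + |T| ≤ x → 0 < d → d ≤ 1 → 2 / d ≤ B * x →
      (∀ γ ∈ zetaOrd, d ≤ |T - γ|) → 1 / 2 ≤ σ → σ ≤ 2 →
        ‖zetaInv (σ + T * Complex.I)‖ ≤ Real.exp (C * x) := by
  obtain ⟨m, hm, hmv⟩ := exists_le_norm_riemannZeta₁
  obtain ⟨A, hA, hcard⟩ := exists_card_zeros_le
  refine ⟨1 + m⁻¹ + A * (B ^ (3 / 4 : ℝ) / (3 / 4))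
    + 30 * ((125 / m) ^ (1 / 2 : ℝ) / (1 / 2) + 3 * A + 1), by positivity, ?_⟩
  intro T d σ x hx hd hd1 hdB hdist hσ1 hσ2
  have hx1 : 1 ≤ x := by linarith [abs_nonneg T]
  set c : ℂ := 2 + T * Complex.I with hc
  set s : ℂ := σ + T * Complex.I with hsdef
  have hfin : {z : ℂ | z ∈ Metric.closedBall c (8 / 5) ∧ riemannZeta₁ z = 0}.Finite :=
    Set.finite_of_forall_finset_card_le fun S hS => hcard T S fun z hz => hS hz
  have hmem : ∀ z, z ∈ hfin.toFinset ↔ z ∈ Metric.closedBall c (8 / 5) ∧ riemannZeta₁ z = 0 := by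
    intro z; rw [Set.Finite.mem_toFinset]; rfl
  set Z := hfin.toFinset with hZdef
  have hline : ∀ z ∈ Z, ∃ γ ∈ zetaOrd, z = 1 / 2 + γ * Complex.I := by
    intro z hz
    obtain ⟨h1, h2⟩ := (hmem z).1 hz
    rw [mem_closedBall_iff_norm] at h1
    have h3 := (abs_le.1 ((Complex.abs_re_le_norm _).trans h1)).1
    simp [hc] at h3
    obtain ⟨h4, h5⟩ := re_eq_half_of_riemannZeta₁_eq_zero hRH h2 (by linarith)
    refine ⟨z.im, h5, Complex.ext ?_ ?_⟩
    · simp [h4]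
    · simp
  have hk : (Z.card : ℝ) ≤ A * x ^ (1 / 4 : ℝ) :=
    (hcard T Z fun z hz => (hmem z).1 hz).trans (by gcongr)
  have hx14 : x ^ (1 / 4 : ℝ) ≤ x := by
    conv_rhs => rw [← Real.rpow_one x]
    exact Real.rpow_le_rpow_of_exponent_le hx1 (by norm_num)
  have hk' : (Z.card : ℝ) ≤ A * x := hk.trans (by gcongr)
  have hlow := norm_ge_of_dist_zeros (c := c) (s := s) (M := 125 * (1 + |T|) ^ 2) (m := m)
    (d := d) differentiable_riemannZeta₁ hm (hmv T)
    (fun z hz => norm_riemannZeta₁_le_of_mem_closedBall (Metric.sphere_subset_closedBall hz))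
    Z hmem
    (fun z hz => by
      obtain ⟨γ, hγ, rfl⟩ := hline z hz
      rw [deriv_riemannZeta₁_of_mem hγ]
      exact mul_ne_zero (sub_ne_zero.2 (half_add_ne_one γ)) (deriv_ne_zero_of_mem hs hγ))
    (by
      have : s - c = ((σ - 2 : ℝ) : ℂ) := by rw [hsdef, hc]; push_cast; ring
      rw [this, Complex.norm_real, Real.norm_eq_abs, abs_le]
      constructor <;> linarith) hd
    (fun z hz => by
      obtain ⟨γ, hγ, rfl⟩ := hline z hz
      have h1 := Complex.abs_im_le_norm (s - (1 / 2 + γ * Complex.I))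
      simp [hsdef] at h1
      have h2 := hdist γ hγ
      simp
      linarith)
  have hs1 : ‖s - 1‖ ≤ Real.exp x := by
    have : s - 1 = ((σ - 1 : ℝ) : ℂ) + T * Complex.I := by rw [hsdef]; push_cast; ring
    rw [this]
    refine (norm_add_le _ _).trans ?_
    rw [norm_mul, Complex.norm_I, Complex.norm_real, Complex.norm_real, mul_one,
      Real.norm_eq_abs, Real.norm_eq_abs]
    have h1 : |σ - 1| ≤ 1 := abs_le.2 ⟨by linarith, by linarith⟩
    linarith [Real.add_one_le_exp x]
  have hpow : (2 / d) ^ Z.card ≤ Real.exp (A * (B ^ (3 / 4 : ℝ) / (3 / 4)) * x) := by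
    have h2d : 1 ≤ 2 / d := by rw [one_le_div hd]; linarith
    rw [← Real.rpow_natCast, Real.rpow_def_of_pos (by positivity)]
    apply Real.exp_le_exp.2
    have h1 : Real.log (2 / d) ≤ B ^ (3 / 4 : ℝ) / (3 / 4) * x ^ (3 / 4 : ℝ) := by
      refine (Real.log_le_log (by positivity) hdB).trans ?_
      refine (Real.log_le_rpow_div (by positivity) (show (0 : ℝ) < 3 / 4 by norm_num)).trans ?_
      rw [Real.mul_rpow hB.le (by linarith)]
      apply le_of_eq; ring
    calc Real.log (2 / d) * Z.card
        ≤ (B ^ (3 / 4 : ℝ) / (3 / 4) * x ^ (3 / 4 : ℝ)) * (A * x ^ (1 / 4 : ℝ)) := by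
          gcongr
      _ = A * (B ^ (3 / 4 : ℝ) / (3 / 4)) * (x ^ (3 / 4 : ℝ) * x ^ (1 / 4 : ℝ)) := by ring
      _ = _ := by
          rw [← Real.rpow_add (by linarith)]
          norm_num
  have hlog : Real.log (125 * (1 + |T|) ^ 2 / m) ≤ (125 / m) ^ (1 / 2 : ℝ) / (1 / 2) * x := by
    have h1 : 125 * (1 + |T|) ^ 2 / m ≤ 125 / m * x ^ 2 := by
      rw [div_mul_eq_mul_div]; gcongr
    refine (Real.log_le_log (by positivity) h1).trans ?_
    refine (Real.log_le_rpow_div (by positivity) (show (0 : ℝ) < 1 / 2 by norm_num)).trans ?_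
    rw [Real.mul_rpow (by positivity) (by positivity), ← Real.rpow_natCast x 2,
      ← Real.rpow_mul (by positivity)]
    norm_num
    apply le_of_eq; ring
  have hinv : m⁻¹ ≤ Real.exp (m⁻¹ * x) := by
    have h1 := Real.add_one_le_exp (m⁻¹ * x)
    have h2 : m⁻¹ * 1 ≤ m⁻¹ * x := by gcongr
    linarith
  have hlow0 : 0 < m * (d / 2) ^ Z.card
      * Real.exp (-(30 * (Real.log (125 * (1 + |T|) ^ 2 / m) + 3 * Z.card + 1))) := by positivity
  rw [zetaInv, norm_div]
  calc ‖s - 1‖ / ‖riemannZeta₁ s‖ ≤ Real.exp x / (m * (d / 2) ^ Z.card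
      * Real.exp (-(30 * (Real.log (125 * (1 + |T|) ^ 2 / m) + 3 * Z.card + 1)))) := by gcongr
    _ = Real.exp x * m⁻¹ * (2 / d) ^ Z.card
        * Real.exp (30 * (Real.log (125 * (1 + |T|) ^ 2 / m) + 3 * Z.card + 1)) := by
      rw [Real.exp_neg, div_pow, div_pow]
      field_simp
    _ ≤ Real.exp x * Real.exp (m⁻¹ * x) * Real.exp (A * (B ^ (3 / 4 : ℝ) / (3 / 4)) * x)
        * Real.exp (30 * ((125 / m) ^ (1 / 2 : ℝ) / (1 / 2) * x + 3 * (A * x) + x)) := by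
      gcongr
    _ = _ := by
      rw [← Real.exp_add, ← Real.exp_add, ← Real.exp_add]
      congr 1
      ring

theorem exists_good_height (hRH : ZetaZerosOnLine) (hs : ZetaZerosSimple) :
    ∃ C : ℝ, 0 < C ∧ ∀ n : ℕ, 1 ≤ n → ∃ T : ℝ, n ≤ T ∧ T ≤ n + 1 ∧
      (∀ γ ∈ zetaOrd, 1 / (C * (n + 2)) ≤ |T - γ|) ∧
      ∀ σ : ℝ, -(1 / 2) ≤ σ → σ ≤ 2 →
        ‖zetaInv (σ + T * Complex.I)‖ ≤ Real.exp (C * (n + 2)) := by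
  obtain ⟨A, hA, hcard⟩ := exists_card_zetaOrd_le
  obtain ⟨C₁, hC₁, hbd⟩ := exists_norm_zetaInv_le_of_dist hRH hs
    (show 0 < 2 * (8 * A) by positivity)
  obtain ⟨K, hK, hrefl⟩ := exists_norm_zetaInv_le_reflect
  refine ⟨8 * A + (C₁ + (K + 2)), by positivity, fun n hn => ?_⟩
  have hn1 : (1 : ℝ) ≤ n := by exact_mod_cast hn
  set d : ℝ := 1 / (8 * A * (n + 2)) with hd
  have hd0 : 0 < d := by positivity
  have hd4 : d ≤ 1 / 4 := by
    rw [hd, div_le_div_iff₀ (by positivity) (by norm_num)]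
    nlinarith
  set G := (finite_zetaOrd_inter (n + 1 / 2)).toFinset with hG
  have hGm : ∀ γ, γ ∈ G ↔ γ ∈ zetaOrd ∧ |γ - (n + 1 / 2)| ≤ 1 / 2 := by
    intro γ; rw [hG, Set.Finite.mem_toFinset]; rfl
  have hGc : (G.card : ℝ) ≤ A * (n + 2) := by
    refine (hcard _ G fun γ hγ => (hGm γ).1 hγ).trans ?_
    rw [abs_of_nonneg (by positivity)]
    gcongr
    calc (1 + ((n : ℝ) + 1 / 2)) ^ (1 / 4 : ℝ) ≤ (1 + ((n : ℝ) + 1 / 2)) ^ (1 : ℝ) :=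
          Real.rpow_le_rpow_of_exponent_le (by linarith) (by norm_num)
      _ ≤ _ := by rw [Real.rpow_one]; linarith
  obtain ⟨T, ⟨hT1, hT2⟩, hT⟩ := exists_forall_le_abs_sub (S := G) (a := n + 1 / 4)
    (b := n + 3 / 4) hd0.le (by
      calc (G.card : ℝ) * (2 * d) ≤ A * (n + 2) * (2 * d) := by gcongr
        _ = 1 / 4 := by rw [hd]; field_simp; norm_num
        _ < _ := by linarith)
  have hdist : ∀ γ ∈ zetaOrd, d ≤ |T - γ| := by
    intro γ hγ
    by_cases h : |γ - (n + 1 / 2)| ≤ 1 / 2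
    · exact hT γ ((hGm γ).2 ⟨hγ, h⟩)
    · push Not at h
      have h1 : |γ - (n + 1 / 2)| ≤ |T - γ| + |T - (n + 1 / 2)| := by
        rw [abs_sub_comm T γ]; exact abs_sub_le _ _ _
      have h2 : |T - (n + 1 / 2)| ≤ 1 / 4 := abs_le.2 ⟨by linarith, by linarith⟩
      linarith
  have hT0 : 0 < T := by linarith
  have hright : ∀ σ : ℝ, 1 / 2 ≤ σ → σ ≤ 2 →
      ‖zetaInv (σ + T * Complex.I)‖ ≤ Real.exp (C₁ * (n + 2)) := by
    intro σ h1 h2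
    refine hbd T d σ (n + 2) (by rw [abs_of_pos hT0]; linarith) hd0 (by linarith) ?_ hdist h1 h2
    rw [hd]
    apply le_of_eq
    field_simp
  refine ⟨T, by linarith, by linarith, fun γ hγ => ?_, fun σ h1 h2 => ?_⟩
  · refine le_trans ?_ (hdist γ hγ)
    rw [hd]
    gcongr
    linarith
  · rcases le_total (1 / 2) σ with h3 | h3
    · refine (hright σ h3 h2).trans (Real.exp_le_exp.2 ?_)
      gcongr
      nlinarith
    · have hconj : (1 - (σ + T * Complex.I) : ℂ)
          = (starRingEnd ℂ) (((1 - σ : ℝ) : ℂ) + T * Complex.I) := by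
        simp [Complex.conj_ofReal]; ring
      have hz : riemannZeta (1 - (σ + T * Complex.I)) ≠ 0 := by
        intro h0
        have hne : (1 - (σ + T * Complex.I) : ℂ) ≠ 1 := by
          intro h4
          have := congrArg Complex.im h4
          simp at this
          linarith
        have h5 : riemannZeta₁ (1 - (σ + T * Complex.I)) = 0 := by
          rw [riemannZeta₁_eq_of_ne_one hne, h0, mul_zero]
        have h6 := (re_eq_half_of_riemannZeta₁_eq_zero hRH h5 (by simp; linarith)).2
        have h7 := hdist _ (neg_mem_zetaOrd h6)
        simp at h7
        linarith
      have h4 := hrefl (σ + T * Complex.I) (by simp; exact abs_le.2 ⟨by linarith, by linarith⟩)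
        (by simp; rw [abs_of_pos hT0]; linarith) hz
      rw [hconj, zetaInv_conj, RCLike.norm_conj] at h4
      simp only [Complex.add_im, Complex.ofReal_im, Complex.mul_im, Complex.ofReal_re,
        Complex.I_im, Complex.I_re, mul_one, mul_zero, add_zero, zero_add, abs_of_pos hT0] at h4
      refine h4.trans ?_
      have h5 := hright (1 - σ) (by linarith) (by linarith)
      have h6 : K ≤ Real.exp (K * (n + 2)) := by
        have := Real.add_one_le_exp (K * (n + 2))
        nlinarith
      calc K * Real.exp (2 * T) * ‖zetaInv (((1 - σ : ℝ) : ℂ) + T * Complex.I)‖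
          ≤ Real.exp (K * (n + 2)) * Real.exp (2 * (n + 2)) * Real.exp (C₁ * (n + 2)) := by
            gcongr
            linarith
        _ = Real.exp ((K + 2 + C₁) * (n + 2)) := by
            rw [← Real.exp_add, ← Real.exp_add]; congr 1; ring
        _ ≤ _ := by
            apply Real.exp_le_exp.2
            exact mul_le_mul_of_nonneg_right (by linarith) (by positivity)

theorem isLittleO_sub_inv_of_tendsto {f : ℂ → ℂ} {c : ℂ}
    (h : Tendsto (fun z => (z - c) * f z) (𝓝[≠] c) (𝓝 0)) :
    (fun z => f z - f c) =o[𝓝[≠] c] fun z => (z - c)⁻¹ := by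
  rw [Asymptotics.isLittleO_iff_tendsto']
  · have h1 : Tendsto (fun z => (z - c) * f c) (𝓝[≠] c) (𝓝 0) := by
      have h2 : Continuous fun z : ℂ => (z - c) * f c := by fun_prop
      have h3 := (h2.tendsto c).mono_left (nhdsWithin_le_nhds (s := {c}ᶜ))
      simpa using h3
    have h4 := h.sub h1
    rw [sub_zero] at h4
    refine h4.congr fun z => ?_
    rw [div_inv_eq_mul]
    ring
  · filter_upwards [self_mem_nhdsWithin] with z hz h0
    exact absurd (inv_eq_zero.1 h0) (sub_ne_zero.2 hz)

/-- Removal of finitely many removable singularities. -/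
theorem exists_differentiableOn_of_tendsto_zero {f : ℂ → ℂ} {V Z : Set ℂ} (hV : IsOpen V)
    (hZ : Z.Finite) (hf : ∀ z ∈ V, z ∉ Z → DifferentiableAt ℂ f z)
    (h0 : ∀ c ∈ Z, c ∈ V → Tendsto (fun z => (z - c) * f z) (𝓝[≠] c) (𝓝 0)) :
    ∃ h : ℂ → ℂ, DifferentiableOn ℂ h V ∧ ∀ z, z ∉ Z → h z = f z := by
  classical
  refine ⟨fun z => if z ∈ Z then limUnder (𝓝[≠] z) f else f z, fun z hz => ?_,
    fun z hz => if_neg hz⟩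
  apply DifferentiableAt.differentiableWithinAt
  by_cases hzZ : z ∈ Z
  · have hU : V ∩ (Z \ {z})ᶜ ∈ 𝓝 z :=
      (hV.inter (hZ.subset Set.sdiff_subset).isClosed.isOpen_compl).mem_nhds
        ⟨hz, fun h => h.2 rfl⟩
    have hd := Complex.differentiableOn_update_limUnder_of_isLittleO hU (f := f)
      (fun x hx => (hf x hx.1.1 fun hxZ => hx.1.2 ⟨hxZ, hx.2⟩).differentiableWithinAt)
      (isLittleO_sub_inv_of_tendsto (h0 z hzZ hz))
    refine (hd.differentiableAt hU).congr_of_eventuallyEq ?_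
    filter_upwards [hU] with x hx
    by_cases hxz : x = z
    · subst hxz; simp [hzZ]
    · have : x ∉ Z := fun h => hx.2 ⟨h, hxz⟩
      simp [hxz, this]
  · refine (hf z hz hzZ).congr_of_eventuallyEq ?_
    filter_upwards [hZ.isClosed.isOpen_compl.mem_nhds hzZ] with x hx
    exact if_neg hx

/-- Subtraction of the principal parts at finitely many simple poles. -/
theorem exists_differentiableOn_sub_poles {f : ℂ → ℂ} {V : Set ℂ} (hV : IsOpen V)
    {p : ℝ → ℂ} (hp : Function.Injective p) (S : Finset ℝ)
    (hf : ∀ z ∈ V, (∀ i ∈ S, z ≠ p i) → DifferentiableAt ℂ f z) (c : ℝ → ℂ) (k : ℝ → ℂ → ℂ)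
    (hk : ∀ i, Differentiable ℂ (k i)) (hk1 : ∀ i, k i (p i) = 1)
    (hc : ∀ i ∈ S, Tendsto (fun z => (z - p i) * f z) (𝓝[≠] p i) (𝓝 (c i))) :
    ∃ h : ℂ → ℂ, DifferentiableOn ℂ h V ∧
      ∀ z, (∀ i ∈ S, z ≠ p i) → h z = f z - ∑ i ∈ S, c i * k i z / (z - p i) := by
  classical
  obtain ⟨h, hh, hh'⟩ := exists_differentiableOn_of_tendsto_zero hV (S.image p).finite_toSet
    (f := fun z => f z - ∑ i ∈ S, c i * k i z / (z - p i))
    (fun z hz hzS => by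
      have hne : ∀ i ∈ S, z ≠ p i := fun i hi h => hzS (by rw [h]; simp; exact ⟨i, hi, rfl⟩)
      refine (hf z hz hne).sub (DifferentiableAt.fun_sum fun i hi => ?_)
      exact (((hk i) z).const_mul _).div (by fun_prop) (sub_ne_zero.2 (hne i hi)))
    (fun z hz _ => by
      obtain ⟨i, hi, rfl⟩ : ∃ i ∈ S, p i = z := by simpa using hz
      have h1 : ∀ j ∈ S, Tendsto (fun z => (z - p i) * (c j * k j z / (z - p j))) (𝓝[≠] p i)
          (𝓝 (if j = i then c i else 0)) := by
        intro j _
        by_cases hji : j = i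
        · subst hji
          rw [if_pos rfl]
          have h2 : Tendsto (fun z => c j * k j z) (𝓝[≠] p j) (𝓝 (c j)) := by
            have h3 := (((hk j).continuous.tendsto (p j)).const_mul (c j)).mono_left
              (nhdsWithin_le_nhds (s := {p j}ᶜ))
            rwa [hk1, mul_one] at h3
          refine h2.congr' ?_
          filter_upwards [self_mem_nhdsWithin] with z hz
          rw [mul_div_cancel₀]
          exact sub_ne_zero.2 hz
        · rw [if_neg hji]
          have hne : p i - p j ≠ 0 := sub_ne_zero.2 fun h => hji (hp h).symm
          have h2 : Tendsto (fun z => (z - p i) * (c j * k j z / (z - p j))) (𝓝 (p i))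
              (𝓝 ((p i - p i) * (c j * k j (p i) / (p i - p j)))) := by
            refine (tendsto_id.sub_const _).mul (Tendsto.div ?_ (tendsto_id.sub_const _) hne)
            exact ((hk j).continuous.tendsto (p i)).const_mul (c j)
          rw [sub_self, zero_mul] at h2
          exact h2.mono_left nhdsWithin_le_nhds
      have h2 := (hc i hi).sub (tendsto_finsetSum S h1)
      rw [Finset.sum_ite_eq' S i, if_pos hi, sub_self] at h2
      refine h2.congr fun z => ?_
      rw [mul_sub, Finset.mul_sum])
  refine ⟨h, hh, fun z hz => hh' z fun hzS => ?_⟩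
  obtain ⟨i, hi, h1⟩ : ∃ i ∈ S, p i = z := by simpa using hzS
  exact hz i hi h1.symm

theorem tendsto_mul_zetaInv (hs : ZetaZerosSimple) {γ : ℝ} (hγ : γ ∈ zetaOrd) :
    Tendsto (fun s => (s - (1 / 2 + γ * Complex.I)) * zetaInv s)
      (𝓝[≠] (1 / 2 + γ * Complex.I)) (𝓝 (deriv riemannZeta (1 / 2 + γ * Complex.I))⁻¹) := by
  set ρ : ℂ := 1 / 2 + γ * Complex.I with hρ
  have h1 := (differentiableAt_riemannZeta (half_add_ne_one γ)).hasDerivAt.tendsto_slope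
  rw [← hρ] at h1
  have h2 := h1.inv₀ (deriv_ne_zero_of_mem hs hγ)
  refine h2.congr' ?_
  filter_upwards [self_mem_nhdsWithin,
    mem_nhdsWithin_of_mem_nhds (isOpen_ne.mem_nhds (half_add_ne_one γ))] with s hs1 hs2
  rw [slope_def_field, show riemannZeta ρ = 0 from hγ, sub_zero, inv_div, zetaInv_eq_inv hs2,
    div_eq_mul_inv]

theorem differentiableAt_zetaInv {s : ℂ} (hs : riemannZeta₁ s ≠ 0) :
    DifferentiableAt ℂ zetaInv s :=
  DifferentiableAt.div (by fun_prop) (differentiable_riemannZeta₁ s) hs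

/-- The point `1 / 2 + iγ` of the critical line. -/
noncomputable def critPt (γ : ℝ) : ℂ := 1 / 2 + γ * Complex.I

theorem critPt_re (γ : ℝ) : (critPt γ).re = 1 / 2 := by simp [critPt]

theorem critPt_im (γ : ℝ) : (critPt γ).im = γ := by simp [critPt]

theorem critPt_injective : Function.Injective critPt := fun a b h => by
  simpa [critPt] using h

/-- The residue of `1 / ζ` at `1 / 2 + iγ`. -/
noncomputable def zetaRes (γ : ℝ) : ℂ := (deriv riemannZeta (1 / 2 + γ * Complex.I))⁻¹

theorem finite_zetaOrd_Icc (T : ℝ) : {γ | γ ∈ zetaOrd ∧ |γ| ≤ T}.Finite := by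
  refine ((Set.finite_Icc (-⌈T⌉) ⌈T⌉).biUnion fun k _ =>
    finite_zetaOrd_inter (k : ℝ)).subset fun γ hγ => ?_
  obtain ⟨h1, h2⟩ := hγ
  have h3 := abs_le.1 h2
  refine Set.mem_biUnion (x := round γ) ⟨?_, ?_⟩ ⟨h1, abs_sub_round γ⟩
  · rw [← round_intCast (α := ℝ) (-⌈T⌉)]
    have : ((-⌈T⌉ : ℤ) : ℝ) ≤ γ := by push_cast; linarith [Int.le_ceil T]
    rw [round_eq, round_eq]
    exact Int.floor_mono (by linarith)
  · rw [← round_intCast (α := ℝ) (⌈T⌉)]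
    rw [round_eq, round_eq]
    exact Int.floor_mono (by linarith [Int.le_ceil T])

theorem tendsto_exp_neg_sq_nat (b c : ℝ) :
    Tendsto (fun n : ℕ => Real.exp (-(n : ℝ) ^ 2 / 2 + b * n + c)) atTop (𝓝 0) := by
  refine Real.tendsto_exp_atBot.comp ?_
  have h1 : Tendsto (fun x : ℝ => x * (b - x / 2)) atTop atBot := by
    refine tendsto_id.atTop_mul_atBot₀ ?_
    have : Tendsto (fun x : ℝ => x / 2) atTop atTop := tendsto_id.atTop_div_const (by norm_num)
    exact tendsto_atBot_add_const_left _ b (tendsto_neg_atTop_atBot.comp this)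
  have h2 := (tendsto_atBot_add_const_right _ c h1).comp tendsto_natCast_atTop_atTop
  refine h2.congr fun n => ?_
  simp only [Function.comp]
  ring

theorem norm_cexp_sq (z : ℂ) : ‖Complex.exp (z ^ 2)‖ = Real.exp (z.re ^ 2 - z.im ^ 2) := by
  rw [Complex.norm_exp]
  congr 1
  simp [pow_two]

/-- The maximum principle on a rectangle. -/
theorem norm_le_of_rectangle {h : ℂ → ℂ} {a b T M : ℝ} {V : Set ℂ} (hh : DifferentiableOn ℂ h V)
    (hV : {z : ℂ | a ≤ z.re ∧ z.re ≤ b ∧ |z.im| ≤ T} ⊆ V)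
    (hside : ∀ z : ℂ, (z.re = a ∨ z.re = b) → |z.im| ≤ T → ‖h z‖ ≤ M)
    (htop : ∀ z : ℂ, a ≤ z.re → z.re ≤ b → |z.im| = T → ‖h z‖ ≤ M)
    {w : ℂ} (hw : a < w.re ∧ w.re < b ∧ |w.im| < T) : ‖h w‖ ≤ M := by
  set U : Set ℂ := {z : ℂ | a < z.re ∧ z.re < b ∧ |z.im| < T} with hU
  have hUo : IsOpen U := by
    refine (isOpen_lt continuous_const Complex.continuous_re).inter
      ((isOpen_lt Complex.continuous_re continuous_const).inter
        (isOpen_lt (continuous_abs.comp Complex.continuous_im) continuous_const))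
  have hcl : closure U ⊆ {z : ℂ | a ≤ z.re ∧ z.re ≤ b ∧ |z.im| ≤ T} := by
    refine closure_minimal (fun z hz => ⟨hz.1.le, hz.2.1.le, hz.2.2.le⟩) ?_
    refine (isClosed_le continuous_const Complex.continuous_re).inter
      ((isClosed_le Complex.continuous_re continuous_const).inter
        (isClosed_le (continuous_abs.comp Complex.continuous_im) continuous_const))
  have hbd : Bornology.IsBounded U := by
    refine (Metric.isBounded_closedBall (x := (0 : ℂ)) (r := |a| + |b| + T)).subset fun z hz => ?_
    rw [mem_closedBall_zero_iff]
    refine (Complex.norm_le_abs_re_add_abs_im z).trans ?_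
    have h1 : |z.re| ≤ |a| + |b| := by
      rw [abs_le]
      constructor
      · linarith [hz.1, neg_abs_le a, abs_nonneg b]
      · linarith [hz.2.1, le_abs_self b, abs_nonneg a]
    linarith [hz.2.2]
  refine Complex.norm_le_of_forall_mem_frontier_norm_le hbd
    (hh.mono (hcl.trans hV)).diffContOnCl (fun z hz => ?_) (subset_closure hw)
  rw [frontier, hUo.interior_eq] at hz
  obtain ⟨h1, h2, h3⟩ := hcl hz.1
  by_cases ht : |z.im| = T
  · exact htop z h1 h2 ht
  · refine hside z ?_ h3
    by_contra! hne
    exact hz.2 ⟨lt_of_le_of_ne h1 hne.1.symm, lt_of_le_of_ne h2 hne.2, lt_of_le_of_ne h3 ht⟩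

theorem norm_cexp_sub_sq_le {z w : ℂ} (h1 : -(1 / 2) ≤ z.re) (h2 : z.re ≤ 2)
    (h3 : 1 / 2 ≤ w.re) (h4 : w.re ≤ 3 / 2) :
    ‖Complex.exp ((z - w) ^ 2)‖ ≤ Real.exp 4 * Real.exp (-(z.im - w.im) ^ 2) := by
  rw [norm_cexp_sq, ← Real.exp_add, Complex.sub_re, Complex.sub_im]
  apply Real.exp_le_exp.2
  nlinarith

/-- The weight of the zero `1/2 + iγ` in the local bound for `1 / ζ(1/2 + δ + i t₀)`. -/
noncomputable def zetaWeight (δ t₀ γ : ℝ) : ℝ :=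
  ‖zetaRes γ‖ * Real.exp (-(t₀ - γ) ^ 2 / 2) * (1 + 1 / ‖(δ : ℂ) + (t₀ - γ) * Complex.I‖)

theorem norm_mul_exp_le_zetaWeight (δ t₀ γ : ℝ) :
    ‖zetaRes γ‖ * Real.exp (-(t₀ - γ) ^ 2 / 2) ≤ zetaWeight δ t₀ γ := by
  rw [zetaWeight]
  refine le_mul_of_one_le_right (by positivity) ?_
  have : 0 ≤ 1 / ‖(δ : ℂ) + (t₀ - γ) * Complex.I‖ := by positivity
  linarith

theorem norm_zetaInv_le_of_height (hRH : ZetaZerosOnLine) (hs : ZetaZerosSimple)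
    {K₀ δ t₀ T d Mh B : ℝ}
    (hK₀ : ∀ z : ℂ, (z.re = -(1 / 2) ∨ z.re = 2) → ‖zetaInv z‖ ≤ K₀)
    (hδ : 0 < δ) (hδ1 : δ ≤ 1) (hT : |t₀| < T) (hd : 0 < d)
    (hdist : ∀ γ ∈ zetaOrd, d ≤ |T - γ|)
    (hMh : ∀ σ : ℝ, -(1 / 2) ≤ σ → σ ≤ 2 → ‖zetaInv (σ + T * Complex.I)‖ ≤ Mh)
    (hB : ∀ S : Finset ℝ, ↑S ⊆ zetaOrd → ∑ γ ∈ S, zetaWeight δ t₀ γ ≤ B) :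
    ‖zetaInv (1 / 2 + δ + t₀ * Complex.I)‖ ≤ Real.exp 8 * (K₀ + 2 * B)
      + Real.exp 8 * Real.exp (-(T - |t₀|) ^ 2)
        * (Mh + B / d * Real.exp ((|t₀| + T) ^ 2 / 2)) := by
  set S : Finset ℝ := (finite_zetaOrd_Icc T).toFinset with hS
  have hSm : ∀ γ, γ ∈ S ↔ γ ∈ zetaOrd ∧ |γ| ≤ T := by
    intro γ; rw [hS, Set.Finite.mem_toFinset]; rfl
  have hBS := hB S fun γ hγ => ((hSm γ).1 hγ).1
  have hB0 : 0 ≤ B := by simpa using hB ∅ (by simp)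
  have hK₀0 : 0 ≤ K₀ := (norm_nonneg _).trans (hK₀ 2 (by simp))
  have hMh0 : 0 ≤ Mh := (norm_nonneg _).trans (hMh 0 (by norm_num) (by norm_num))
  have hT0 : 0 < T := (abs_nonneg _).trans_lt hT
  have hE : Real.exp 4 * Real.exp 4 = Real.exp 8 := by rw [← Real.exp_add]; norm_num
  set w : ℂ := 1 / 2 + δ + t₀ * Complex.I with hw
  have hwre : w.re = 1 / 2 + δ := by simp [hw]
  have hwim : w.im = t₀ := by simp [hw]
  set V : Set ℂ := {z | -1 < z.re} ∩ ({z | riemannZeta₁ z ≠ 0} ∪ {z | |z.im| < T}) with hV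
  have hVo : IsOpen V :=
    (isOpen_lt continuous_const Complex.continuous_re).inter
      ((isOpen_ne_fun differentiable_riemannZeta₁.continuous continuous_const).union
        (isOpen_lt (continuous_abs.comp Complex.continuous_im) continuous_const))
  have hnotord : ∀ y : ℝ, |y| = T → ∀ γ ∈ zetaOrd, d ≤ |y - γ| := by
    intro y hy γ hγ
    rcases abs_eq hT0.le |>.1 hy with rfl | rfl
    · exact hdist γ hγ
    · have := hdist _ (neg_mem_zetaOrd hγ)
      rwa [show -T - γ = -(T - -γ) by ring, abs_neg]
  obtain ⟨h₀, hh₀, heq⟩ := exists_differentiableOn_sub_poles (f := zetaInv) hVo critPt_injective S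
    (fun z hz hne => by
      apply differentiableAt_zetaInv
      intro h0
      obtain ⟨h1, h2⟩ := re_eq_half_of_riemannZeta₁_eq_zero hRH h0 hz.1
      have h3 : |z.im| < T := hz.2.resolve_left fun h => h h0
      exact hne z.im ((hSm _).2 ⟨h2, h3.le⟩)
        (Complex.ext (by rw [critPt_re, h1]) (by rw [critPt_im])))
    zetaRes (fun γ z => Complex.exp ((z - critPt γ) ^ 2)) (fun γ => by fun_prop) (by simp)
    (fun γ hγ => tendsto_mul_zetaInv hs ((hSm γ).1 hγ).1)
  have hprod : ∀ z : ℂ, (∀ i ∈ S, z ≠ critPt i) → ‖Complex.exp ((z - w) ^ 2) * h₀ z‖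
      ≤ ‖Complex.exp ((z - w) ^ 2)‖ * ‖zetaInv z‖ + ‖Complex.exp ((z - w) ^ 2)‖ *
        ∑ γ ∈ S, ‖zetaRes γ‖ * ‖Complex.exp ((z - critPt γ) ^ 2)‖ / ‖z - critPt γ‖ := by
    intro z hz
    rw [heq z hz, norm_mul, ← mul_add]
    gcongr
    refine (norm_sub_le _ _).trans ?_
    gcongr
    refine (norm_sum_le _ _).trans (le_of_eq ?_)
    exact Finset.sum_congr rfl fun γ _ => by rw [norm_div, norm_mul]
  have hmain : ‖Complex.exp ((w - w) ^ 2) * h₀ w‖ ≤ Real.exp 8 * (K₀ + B)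
      + Real.exp 8 * Real.exp (-(T - |t₀|) ^ 2)
        * (Mh + B / d * Real.exp ((|t₀| + T) ^ 2 / 2)) := by
    refine norm_le_of_rectangle (h := fun z => Complex.exp ((z - w) ^ 2) * h₀ z)
      (a := -(1 / 2)) (b := 2) (T := T) (V := V)
      (DifferentiableOn.mul (Differentiable.differentiableOn (by fun_prop)) hh₀)
      ?_ ?_ ?_ ⟨by rw [hwre]; linarith, by rw [hwre]; linarith, by rwa [hwim]⟩
    · rintro z ⟨h1, -, h3⟩
      refine ⟨show -1 < z.re by linarith, ?_⟩
      rcases h3.lt_or_eq with h4 | h4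
      · exact Or.inr h4
      · refine Or.inl fun h0 => ?_
        have h5 := (re_eq_half_of_riemannZeta₁_eq_zero hRH h0 (by linarith)).2
        have h6 := hnotord _ h4 _ h5
        rw [sub_self, abs_zero] at h6
        linarith
    · intro z hz hzT
      have hre : ∀ γ, 1 ≤ ‖z - critPt γ‖ := by
        intro γ
        refine le_trans ?_ (Complex.abs_re_le_norm _)
        rw [Complex.sub_re, critPt_re]
        rcases hz with h | h <;> rw [h] <;> norm_num [abs_le]
      have hz1 : -(1 / 2) ≤ z.re := by rcases hz with h | h <;> norm_num [h]
      have hz2 : z.re ≤ 2 := by rcases hz with h | h <;> norm_num [h]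
      refine (hprod z fun i _ h => ?_).trans ?_
      · have := hre i
        rw [h, sub_self, norm_zero] at this
        linarith
      have hew := norm_cexp_sub_sq_le (w := w) hz1 hz2 (by rw [hwre]; linarith)
        (by rw [hwre]; linarith)
      rw [hwim] at hew
      have hew' : ‖Complex.exp ((z - w) ^ 2)‖ ≤ Real.exp 8 := by
        refine hew.trans ?_
        rw [← hE]
        gcongr
        nlinarith [sq_nonneg (z.im - t₀)]
      have hterm : ∀ γ ∈ S, ‖Complex.exp ((z - w) ^ 2)‖ *
          (‖zetaRes γ‖ * ‖Complex.exp ((z - critPt γ) ^ 2)‖ / ‖z - critPt γ‖)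
          ≤ Real.exp 8 * zetaWeight δ t₀ γ := by
        intro γ _
        have hep := norm_cexp_sub_sq_le (w := critPt γ) hz1 hz2 (by rw [critPt_re])
          (by rw [critPt_re]; norm_num)
        rw [critPt_im] at hep
        have h1 : ‖zetaRes γ‖ * ‖Complex.exp ((z - critPt γ) ^ 2)‖ / ‖z - critPt γ‖
            ≤ ‖zetaRes γ‖ * (Real.exp 4 * Real.exp (-(z.im - γ) ^ 2)) :=
          (div_le_self (by positivity) (hre γ)).trans (by gcongr)
        calc _ ≤ (Real.exp 4 * Real.exp (-(z.im - t₀) ^ 2))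
              * (‖zetaRes γ‖ * (Real.exp 4 * Real.exp (-(z.im - γ) ^ 2))) := by gcongr
          _ = Real.exp 8 * (‖zetaRes γ‖ * (Real.exp (-(z.im - t₀) ^ 2 + -(z.im - γ) ^ 2))) := by
            rw [← hE, Real.exp_add]; ring
          _ ≤ Real.exp 8 * (‖zetaRes γ‖ * Real.exp (-(t₀ - γ) ^ 2 / 2)) := by
            gcongr
            nlinarith [sq_nonneg ((z.im - t₀) + (z.im - γ))]
          _ ≤ _ := by
            gcongr
            exact norm_mul_exp_le_zetaWeight δ t₀ γ
      have hpos : 0 ≤ Real.exp 8 * Real.exp (-(T - |t₀|) ^ 2)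
        * (Mh + B / d * Real.exp ((|t₀| + T) ^ 2 / 2)) := by positivity
      have h1 : ‖Complex.exp ((z - w) ^ 2)‖ * ‖zetaInv z‖ ≤ Real.exp 8 * K₀ := by
        gcongr
        exact hK₀ z hz
      rw [Finset.mul_sum]
      have h2 := (Finset.sum_le_sum hterm).trans_eq (Finset.mul_sum _ _ _).symm
      have h3 : Real.exp 8 * ∑ γ ∈ S, zetaWeight δ t₀ γ ≤ Real.exp 8 * B := by gcongr
      linarith
    · intro z hz1 hz2 hzT
      have him : ∀ γ ∈ S, d ≤ ‖z - critPt γ‖ := by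
        intro γ hγ
        refine le_trans ?_ (Complex.abs_im_le_norm _)
        rw [Complex.sub_im, critPt_im]
        exact hnotord _ hzT γ ((hSm γ).1 hγ).1
      refine (hprod z fun i hi h => ?_).trans ?_
      · have := him i hi
        rw [h, sub_self, norm_zero] at this
        linarith
      have hew := norm_cexp_sub_sq_le (w := w) hz1 hz2 (by rw [hwre]; linarith)
        (by rw [hwre]; linarith)
      rw [hwim] at hew
      have hew' : ‖Complex.exp ((z - w) ^ 2)‖ ≤ Real.exp 4 * Real.exp (-(T - |t₀|) ^ 2) := by
        refine hew.trans ?_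
        refine mul_le_mul_of_nonneg_left (Real.exp_le_exp.2 (neg_le_neg ?_)) (Real.exp_pos _).le
        rw [sq_le_sq, abs_of_pos (by linarith)]
        have := abs_sub_abs_le_abs_sub z.im t₀
        rwa [hzT] at this
      have hzeta : ‖zetaInv z‖ ≤ Mh := by
        have h1 := hMh z.re hz1 hz2
        rcases abs_eq hT0.le |>.1 hzT with h2 | h2
        · rwa [← h2, Complex.re_add_im] at h1
        · have h3 : (starRingEnd ℂ) z = z.re + T * Complex.I :=
            Complex.ext (by simp) (by simp [h2])
          rwa [← h3, zetaInv_conj, RCLike.norm_conj] at h1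
      have hsum : ∑ γ ∈ S, ‖zetaRes γ‖ * ‖Complex.exp ((z - critPt γ) ^ 2)‖ / ‖z - critPt γ‖
          ≤ Real.exp 4 * (B / d * Real.exp ((|t₀| + T) ^ 2 / 2)) := by
        have h1 : ∀ γ ∈ S, ‖zetaRes γ‖ * ‖Complex.exp ((z - critPt γ) ^ 2)‖ / ‖z - critPt γ‖
            ≤ Real.exp 4 / d * Real.exp ((|t₀| + T) ^ 2 / 2) * zetaWeight δ t₀ γ := by
          intro γ hγ
          have hep := norm_cexp_sub_sq_le (w := critPt γ) hz1 hz2 (by rw [critPt_re])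
            (by rw [critPt_re]; norm_num)
          have hep' : ‖Complex.exp ((z - critPt γ) ^ 2)‖ ≤ Real.exp 4 := by
            refine hep.trans (mul_le_of_le_one_right (by positivity) ?_)
            apply Real.exp_le_one_iff.2
            nlinarith [sq_nonneg (z.im - (critPt γ).im)]
          have h2 : 1 ≤ Real.exp ((|t₀| + T) ^ 2 / 2) * Real.exp (-(t₀ - γ) ^ 2 / 2) := by
            rw [← Real.exp_add]
            apply Real.one_le_exp
            have h3 : |t₀ - γ| ≤ |t₀| + T := (abs_sub _ _).trans (by
              have := ((hSm γ).1 hγ).2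
              linarith)
            have h4 : (t₀ - γ) ^ 2 ≤ (|t₀| + T) ^ 2 :=
              sq_le_sq.2 (by rwa [abs_of_nonneg (a := |t₀| + T) (by positivity)])
            linarith
          calc _ ≤ ‖zetaRes γ‖ * Real.exp 4 / d := by
                gcongr
                exact him γ hγ
            _ = Real.exp 4 / d * (‖zetaRes γ‖ * 1) := by ring
            _ ≤ Real.exp 4 / d * (‖zetaRes γ‖
                * (Real.exp ((|t₀| + T) ^ 2 / 2) * Real.exp (-(t₀ - γ) ^ 2 / 2))) := by gcongr
            _ = Real.exp 4 / d * Real.exp ((|t₀| + T) ^ 2 / 2)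
                * (‖zetaRes γ‖ * Real.exp (-(t₀ - γ) ^ 2 / 2)) := by ring
            _ ≤ _ := by
              gcongr
              exact norm_mul_exp_le_zetaWeight δ t₀ γ
        refine (Finset.sum_le_sum h1).trans ?_
        rw [← Finset.mul_sum]
        calc _ ≤ Real.exp 4 / d * Real.exp ((|t₀| + T) ^ 2 / 2) * B := by gcongr
          _ = _ := by ring
      have hpos : 0 ≤ Real.exp 8 * (K₀ + B) := by positivity
      have hE4 : Real.exp 4 ≤ Real.exp 8 := Real.exp_le_exp.2 (by norm_num)
      calc _ ≤ (Real.exp 4 * Real.exp (-(T - |t₀|) ^ 2)) * Mh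
            + (Real.exp 4 * Real.exp (-(T - |t₀|) ^ 2))
              * (Real.exp 4 * (B / d * Real.exp ((|t₀| + T) ^ 2 / 2))) := by gcongr
        _ = Real.exp 4 * (Real.exp (-(T - |t₀|) ^ 2) * Mh)
            + Real.exp 8 * (Real.exp (-(T - |t₀|) ^ 2)
              * (B / d * Real.exp ((|t₀| + T) ^ 2 / 2))) := by rw [← hE]; ring
        _ ≤ Real.exp 8 * (Real.exp (-(T - |t₀|) ^ 2) * Mh)
            + Real.exp 8 * (Real.exp (-(T - |t₀|) ^ 2)
              * (B / d * Real.exp ((|t₀| + T) ^ 2 / 2))) := by gcongr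
        _ = 0 + Real.exp 8 * Real.exp (-(T - |t₀|) ^ 2)
              * (Mh + B / d * Real.exp ((|t₀| + T) ^ 2 / 2)) := by ring
        _ ≤ _ := by gcongr
  rw [sub_self, zero_pow two_ne_zero, Complex.exp_zero, one_mul, heq w (fun i _ h => by
    have := congrArg Complex.re h
    rw [hwre, critPt_re] at this
    linarith)] at hmain
  have hsumw : ‖∑ γ ∈ S, zetaRes γ * Complex.exp ((w - critPt γ) ^ 2) / (w - critPt γ)‖
      ≤ Real.exp 8 * B := by
    refine (norm_sum_le _ _).trans ?_
    have h1 : ∀ γ ∈ S, ‖zetaRes γ * Complex.exp ((w - critPt γ) ^ 2) / (w - critPt γ)‖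
        ≤ Real.exp 8 * zetaWeight δ t₀ γ := by
      intro γ _
      have h2 : w - critPt γ = (δ : ℂ) + (t₀ - γ) * Complex.I := by rw [hw, critPt]; ring
      have h3 : ‖Complex.exp (((δ : ℂ) + (t₀ - γ) * Complex.I) ^ 2)‖
          ≤ Real.exp 8 * Real.exp (-(t₀ - γ) ^ 2 / 2) := by
        rw [norm_cexp_sq, ← Real.exp_add]
        apply Real.exp_le_exp.2
        simp
        nlinarith [sq_nonneg (t₀ - γ)]
      rw [norm_div, norm_mul, h2, zetaWeight]
      calc _ ≤ ‖zetaRes γ‖ * (Real.exp 8 * Real.exp (-(t₀ - γ) ^ 2 / 2))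
            / ‖(δ : ℂ) + (t₀ - γ) * Complex.I‖ := by gcongr
        _ = Real.exp 8 * (‖zetaRes γ‖ * Real.exp (-(t₀ - γ) ^ 2 / 2)
            * (1 / ‖(δ : ℂ) + (t₀ - γ) * Complex.I‖)) := by ring
        _ ≤ _ := by gcongr; linarith
    refine (Finset.sum_le_sum h1).trans ?_
    rw [← Finset.mul_sum]
    gcongr
  have h4 := norm_le_norm_sub_add (zetaInv w)
    (∑ γ ∈ S, zetaRes γ * Complex.exp ((w - critPt γ) ^ 2) / (w - critPt γ))
  linarith

theorem exists_norm_zetaInv_le_sum (hRH : ZetaZerosOnLine) (hs : ZetaZerosSimple) :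
    ∃ K > 0, ∀ δ t₀ B : ℝ, 0 < δ → δ ≤ 1 →
      (∀ S : Finset ℝ, ↑S ⊆ zetaOrd → ∑ γ ∈ S, zetaWeight δ t₀ γ ≤ B) →
      ‖zetaInv (1 / 2 + δ + t₀ * Complex.I)‖ ≤ K * (1 + B) := by
  obtain ⟨K₁, hK₁, hK₁b⟩ := exists_norm_zetaInv_left_le
  obtain ⟨K₂, hK₂, hK₂b⟩ := exists_norm_zetaInv_le_of_le_re (a := 2) (by norm_num)
  obtain ⟨C, hC, hgood⟩ := exists_good_height hRH hs
  have hK₀ : ∀ z : ℂ, (z.re = -(1 / 2) ∨ z.re = 2) → ‖zetaInv z‖ ≤ K₁ + K₂ := by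
    rintro z (h | h)
    · have h1 := hK₁b z.im
      rw [show -(1 / 2 : ℂ) + z.im * Complex.I = z from
        Complex.ext (by simp [h]) (by simp)] at h1
      linarith
    · have := hK₂b z h.ge
      linarith
  refine ⟨Real.exp 8 * (K₁ + K₂ + 2), by positivity, fun δ t₀ B hδ hδ1 hB => ?_⟩
  have hB0 : 0 ≤ B := by simpa using hB ∅ (by simp)
  have hbound : ∀ n : ℕ, 1 ≤ n → |t₀| < n →
      ‖zetaInv (1 / 2 + δ + t₀ * Complex.I)‖ ≤ Real.exp 8 * (K₁ + K₂ + 2 * B)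
        + Real.exp 8 * (Real.exp (-(n : ℝ) ^ 2 / 2 + (2 * |t₀| + C) * n + 2 * C)
          + B * C * Real.exp (-(n : ℝ) ^ 2 / 2 + (3 * |t₀| + 1) * n + (3 * |t₀| + 2))) := by
    intro n hn htn
    obtain ⟨T, hT1, hT2, hdist, hMh⟩ := hgood n hn
    have hn0 : (0 : ℝ) < n := by exact_mod_cast hn
    refine (norm_zetaInv_le_of_height hRH hs hK₀ hδ hδ1 (htn.trans_le hT1)
      (show 0 < 1 / (C * ((n : ℝ) + 2)) by positivity) hdist hMh hB).trans ?_
    rw [mul_assoc]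
    gcongr
    rw [mul_add]
    have ht := abs_nonneg t₀
    refine add_le_add ?_ ?_
    · rw [← Real.exp_add]
      apply Real.exp_le_exp.2
      have h1 : ((n : ℝ) - |t₀|) ^ 2 ≤ (T - |t₀|) ^ 2 := by
        apply pow_le_pow_left₀ <;> linarith
      nlinarith
    · have h2 : (n : ℝ) + 2 ≤ Real.exp (n + 2) := by
        have := Real.add_one_le_exp ((n : ℝ) + 2)
        linarith
      calc _ = B * C * ((n : ℝ) + 2)
            * (Real.exp (-(T - |t₀|) ^ 2) * Real.exp ((|t₀| + T) ^ 2 / 2)) := by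
            field_simp
        _ ≤ B * C * Real.exp (n + 2)
            * (Real.exp (-(T - |t₀|) ^ 2) * Real.exp ((|t₀| + T) ^ 2 / 2)) := by gcongr
        _ = B * C * Real.exp ((n + 2) + (-(T - |t₀|) ^ 2 + (|t₀| + T) ^ 2 / 2)) := by
            rw [Real.exp_add ((n : ℝ) + 2), Real.exp_add (-(T - |t₀|) ^ 2)]; ring
        _ ≤ _ := by
            refine mul_le_mul_of_nonneg_left (Real.exp_le_exp.2 ?_) (by positivity)
            have h3 : (n : ℝ) ^ 2 ≤ T ^ 2 := by apply pow_le_pow_left₀ <;> linarith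
            have h4 : |t₀| * T ≤ |t₀| * (n + 1) := by gcongr
            nlinarith
  have hlim : Tendsto (fun n : ℕ => Real.exp 8 * (K₁ + K₂ + 2 * B)
        + Real.exp 8 * (Real.exp (-(n : ℝ) ^ 2 / 2 + (2 * |t₀| + C) * n + 2 * C)
          + B * C * Real.exp (-(n : ℝ) ^ 2 / 2 + (3 * |t₀| + 1) * n + (3 * |t₀| + 2)))) atTop
      (𝓝 (Real.exp 8 * (K₁ + K₂ + 2 * B) + Real.exp 8 * (0 + B * C * 0))) :=
    ((((tendsto_exp_neg_sq_nat _ _).add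
      ((tendsto_exp_neg_sq_nat _ _).const_mul _)).const_mul _).const_add _)
  have hle := ge_of_tendsto hlim (by
    filter_upwards [eventually_ge_atTop 1, eventually_gt_atTop ⌈|t₀|⌉₊] with n h1 h2
    exact hbound n h1 ((Nat.le_ceil _).trans_lt (by exact_mod_cast h2)))
  refine hle.trans ?_
  have h8 := Real.exp_pos 8
  have : K₁ + K₂ + 2 * B ≤ (K₁ + K₂ + 2) * (1 + B) := by nlinarith
  calc _ = Real.exp 8 * (K₁ + K₂ + 2 * B) := by ring
    _ ≤ Real.exp 8 * ((K₁ + K₂ + 2) * (1 + B)) := by gcongr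
    _ = _ := by ring

/-- The bound `J_{-1}(T) ≤ C T ^ θ` for the inverse second moment of `ζ'` at the zeros. -/
def InvMomentBound (θ C : ℝ) : Prop :=
  ∀ T : ℝ, 1 ≤ T →
    (∑' γ : {γ : ℝ // 0 < γ ∧ γ ≤ T ∧ riemannZeta (1 / 2 + γ * Complex.I) = 0},
      1 / ‖deriv riemannZeta (1 / 2 + (γ : ℝ) * Complex.I)‖ ^ 2) ≤ C * T ^ θ

theorem norm_zetaRes_neg (γ : ℝ) : ‖zetaRes (-γ)‖ = ‖zetaRes γ‖ := by
  have h1 : (starRingEnd ℂ) ∘ riemannZeta ∘ (starRingEnd ℂ) = riemannZeta := by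
    funext s
    simp [riemannZeta_conj]
  have h2 := deriv_conj_conj (f := riemannZeta)
  rw [h1] at h2
  have h3 := congrFun h2 (1 / 2 + γ * Complex.I)
  have h4 : (starRingEnd ℂ) (1 / 2 + γ * Complex.I) = 1 / 2 + ((-γ : ℝ) : ℂ) * Complex.I := by
    simp [Complex.conj_ofReal, Complex.conj_ofNat]
  rw [Function.comp_apply, Function.comp_apply, h4] at h3
  rw [zetaRes, zetaRes, h3, norm_inv, norm_inv, RCLike.norm_conj]

theorem sum_zetaRes_sq_le_of_pos {θ C T : ℝ} (hJ : InvMomentBound θ C) (hT : 1 ≤ T)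
    {S : Finset ℝ} (hS : ∀ γ ∈ S, γ ∈ zetaOrd ∧ 0 < γ ∧ γ ≤ T) :
    ∑ γ ∈ S, ‖zetaRes γ‖ ^ 2 ≤ C * T ^ θ := by
  classical
  refine le_trans ?_ (hJ T hT)
  have hfin : Finite {γ : ℝ // 0 < γ ∧ γ ≤ T ∧ riemannZeta (1 / 2 + γ * Complex.I) = 0} := by
    refine Set.Finite.to_subtype ((finite_zetaOrd_Icc T).subset ?_)
    rintro γ ⟨h1, h2, h3⟩
    exact ⟨h3, by rwa [abs_of_pos h1]⟩
  rw [← Finset.sum_subtype_of_mem (p := fun γ : ℝ =>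
    0 < γ ∧ γ ≤ T ∧ riemannZeta (1 / 2 + γ * Complex.I) = 0) (fun γ => ‖zetaRes γ‖ ^ 2)
    (fun γ hγ => ⟨(hS γ hγ).2.1, (hS γ hγ).2.2, (hS γ hγ).1⟩)]
  rw [Finset.sum_congr rfl fun (γ : {γ : ℝ // 0 < γ ∧ γ ≤ T ∧
    riemannZeta (1 / 2 + γ * Complex.I) = 0}) _ => show ‖zetaRes γ‖ ^ 2
      = 1 / ‖deriv riemannZeta (1 / 2 + (γ : ℝ) * Complex.I)‖ ^ 2 by
      rw [zetaRes, norm_inv, inv_pow]; exact inv_eq_one_div _]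
  exact Summable.sum_le_tsum _ (fun _ _ => by positivity) (Summable.of_finite)

theorem ne_zero_of_mem_zetaOrd {γ : ℝ} (h : γ ∈ zetaOrd) : γ ≠ 0 := by
  rintro rfl
  exact riemannZeta_half_ne_zero (by simpa [zetaOrd] using h)

theorem sum_zetaRes_sq_le {θ C T : ℝ} (hJ : InvMomentBound θ C) (hT : 1 ≤ T)
    {S : Finset ℝ} (hS : ∀ γ ∈ S, γ ∈ zetaOrd ∧ |γ| ≤ T) :
    ∑ γ ∈ S, ‖zetaRes γ‖ ^ 2 ≤ 2 * C * T ^ θ := by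
  classical
  rw [← Finset.sum_filter_add_sum_filter_not S (fun γ => 0 < γ)]
  have h1 := sum_zetaRes_sq_le_of_pos hJ hT (S := S.filter fun γ => 0 < γ) (fun γ hγ => by
    rw [Finset.mem_filter] at hγ
    exact ⟨(hS γ hγ.1).1, hγ.2, (le_abs_self _).trans (hS γ hγ.1).2⟩)
  have h2 := sum_zetaRes_sq_le_of_pos hJ hT
    (S := (S.filter fun γ => ¬ 0 < γ).map (Equiv.neg ℝ).toEmbedding) (fun γ hγ => by
      simp only [Finset.mem_map_equiv, Equiv.neg_symm, Equiv.neg_apply, Finset.mem_filter] at hγ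
      have h := hS _ hγ.1
      have h3 := ne_zero_of_mem_zetaOrd h.1
      refine ⟨neg_neg γ ▸ neg_mem_zetaOrd h.1, ?_, ?_⟩
      · refine lt_of_le_of_ne ?_ (fun h0 => h3 (by rw [← h0, neg_zero]))
        have := hγ.2
        linarith
      · have := (le_abs_self _).trans h.2
        rw [abs_neg] at h
        exact (le_abs_self _).trans h.2)
  rw [Finset.sum_map] at h2
  simp only [Equiv.coe_toEmbedding, Equiv.neg_apply, norm_zetaRes_neg] at h2
  linarith

theorem exists_sum_zetaRes_sq_le {θ C : ℝ} (hθ : θ < 3 / 2) (hJ : InvMomentBound θ C) :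
    ∃ A : ℝ, 0 ≤ A ∧ ∀ S : Finset ℝ, ↑S ⊆ zetaOrd →
      ∑ γ ∈ S, ‖zetaRes γ‖ ^ 2 * (1 + |γ|) ^ (-(3 / 2) : ℝ) ≤ A := by
  classical
  have hC : 0 ≤ C := by
    have := sum_zetaRes_sq_le hJ (le_refl 1) (S := ∅) (by simp)
    rw [Finset.sum_empty, Real.one_rpow] at this
    linarith
  set q : ℝ := 2 ^ (θ - 3 / 2) with hq
  have hq0 : 0 < q := by positivity
  have hq1 : q < 1 := Real.rpow_lt_one_of_one_lt_of_neg (by norm_num) (by linarith)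
  have hgeo := summable_geometric_of_lt_one hq0.le hq1
  set c : ℝ := 2 * C * (1 / 2) ^ (-(3 / 2) : ℝ) with hc
  have hc0 : 0 ≤ c := by positivity
  refine ⟨c * ∑' k : ℕ, q ^ k, mul_nonneg hc0 (tsum_nonneg fun k => by positivity),
    fun S hS => ?_⟩
  set κ : ℝ → ℕ := fun γ => Nat.clog 2 ⌈|γ|⌉₊ with hκ
  have hκ1 : ∀ γ, |γ| ≤ 2 ^ κ γ := fun γ => (Nat.le_ceil _).trans (by
    have := Nat.le_pow_clog one_lt_two ⌈|γ|⌉₊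
    exact_mod_cast this)
  have hκ2 : ∀ γ, (2 : ℝ) ^ κ γ * (1 / 2) ≤ 1 + |γ| := by
    intro γ
    have h0 := abs_nonneg γ
    rcases le_or_gt ⌈|γ|⌉₊ 1 with h | h
    · have : κ γ = 0 := Nat.clog_of_right_le_one h 2
      rw [this]
      linarith [pow_zero (2 : ℝ)]
    · have h1 := Nat.pow_pred_clog_lt_self one_lt_two h
      have h2 : κ γ = (κ γ).pred + 1 :=
        (Nat.succ_pred_eq_of_pos (Nat.clog_pos one_lt_two h)).symm
      have h3 : (2 : ℝ) ^ (κ γ).pred < ⌈|γ|⌉₊ := by exact_mod_cast h1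
      have h4 := Nat.ceil_lt_add_one h0
      rw [h2, pow_succ]
      linarith
  have hterm : ∀ γ ∈ S, ‖zetaRes γ‖ ^ 2 * (1 + |γ|) ^ (-(3 / 2) : ℝ)
      ≤ ‖zetaRes γ‖ ^ 2 * ((2 : ℝ) ^ κ γ * (1 / 2)) ^ (-(3 / 2) : ℝ) := fun γ _ =>
    mul_le_mul_of_nonneg_left
      (Real.rpow_le_rpow_of_nonpos (by positivity) (hκ2 γ) (by norm_num)) (by positivity)
  refine (Finset.sum_le_sum hterm).trans ?_
  rw [← Finset.sum_fiberwise_of_maps_to (fun γ hγ => Finset.mem_image_of_mem κ hγ)]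
  have hfib : ∀ k ∈ S.image κ, ∑ γ ∈ S with κ γ = k,
      ‖zetaRes γ‖ ^ 2 * ((2 : ℝ) ^ κ γ * (1 / 2)) ^ (-(3 / 2) : ℝ) ≤ c * q ^ k := by
    intro k _
    have h1 := sum_zetaRes_sq_le hJ (T := 2 ^ k) (one_le_pow₀ one_le_two)
      (S := S.filter fun γ => κ γ = k) (fun γ hγ => by
        rw [Finset.mem_filter] at hγ
        exact ⟨hS hγ.1, hγ.2 ▸ hκ1 γ⟩)
    calc _ = (∑ γ ∈ S with κ γ = k, ‖zetaRes γ‖ ^ 2)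
          * ((2 : ℝ) ^ k * (1 / 2)) ^ (-(3 / 2) : ℝ) := by
          rw [Finset.sum_mul]
          refine Finset.sum_congr rfl fun γ hγ => ?_
          rw [(Finset.mem_filter.1 hγ).2]
      _ ≤ (2 * C * ((2 : ℝ) ^ k) ^ θ) * ((2 : ℝ) ^ k * (1 / 2)) ^ (-(3 / 2) : ℝ) := by gcongr
      _ = c * q ^ k := by
          rw [Real.mul_rpow (by positivity) (by positivity), hc, hq, ← Real.rpow_natCast 2 k,
            ← Real.rpow_mul_natCast (by norm_num) _ k, ← Real.rpow_mul (by norm_num),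
            ← Real.rpow_mul (by norm_num),
            show (θ - 3 / 2) * (k : ℝ) = k * θ + k * (-(3 / 2)) by ring,
            Real.rpow_add (by norm_num)]
          ring
  refine (Finset.sum_le_sum hfib).trans ?_
  rw [← Finset.mul_sum]
  gcongr
  exact hgeo.sum_le_tsum _ fun k _ => by positivity

theorem exp_neg_sq_div_two_le (x : ℝ) : Real.exp (-x ^ 2 / 2) ≤ 16 / (4 + x ^ 2) ^ 2 := by
  have h1 : (1 + x ^ 2 / 4) ^ 2 ≤ Real.exp (x ^ 2 / 2) := by
    have := Real.add_one_le_exp (x ^ 2 / 4)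
    rw [show x ^ 2 / 2 = x ^ 2 / 4 + x ^ 2 / 4 by ring, Real.exp_add, ← sq]
    gcongr
    linarith
  rw [neg_div, Real.exp_neg]
  calc _ ≤ ((1 + x ^ 2 / 4) ^ 2)⁻¹ := inv_anti₀ (by positivity) h1
    _ = _ := by field_simp; ring

theorem summable_inv_one_add_abs_sq : Summable fun m : ℤ => ((1 + |(m : ℝ)|) ^ 2)⁻¹ := by
  have h : Summable fun n : ℕ => ((1 + (n : ℝ)) ^ 2)⁻¹ := by
    have := (summable_nat_add_iff 1).2 (Real.summable_nat_pow_inv.2 one_lt_two)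
    refine this.congr fun n => ?_
    push_cast
    rw [add_comm]
  refine Summable.of_nat_of_neg ?_ ?_ <;> simpa using h

theorem exists_sum_exp_neg_sq_zetaOrd_le :
    ∃ D : ℝ, 0 < D ∧ ∀ (t : ℝ) (S : Finset ℝ), ↑S ⊆ zetaOrd →
      ∑ γ ∈ S, Real.exp (-(t - γ) ^ 2 / 2) ≤ D * (1 + |t|) ^ (1 / 4 : ℝ) := by
  classical
  obtain ⟨A, hA, hcard⟩ := exists_card_zetaOrd_le
  have hpos : 0 < ∑' m : ℤ, ((1 + |(m : ℝ)|) ^ 2)⁻¹ :=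
    summable_inv_one_add_abs_sq.tsum_pos (fun m => by positivity) 0 (by simp)
  refine ⟨64 * A * ∑' m : ℤ, ((1 + |(m : ℝ)|) ^ 2)⁻¹, by positivity, fun t S hS => ?_⟩
  set κ : ℝ → ℤ := fun γ => round (γ - t) with hκ
  rw [← Finset.sum_fiberwise_of_maps_to (fun γ hγ => Finset.mem_image_of_mem κ hγ)]
  have hfib : ∀ m ∈ S.image κ, ∑ γ ∈ S with κ γ = m, Real.exp (-(t - γ) ^ 2 / 2)
      ≤ 64 * A * (1 + |t|) ^ (1 / 4 : ℝ) * ((1 + |(m : ℝ)|) ^ 2)⁻¹ := by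
    intro m _
    have h1 : ∀ γ ∈ S.filter (fun γ => κ γ = m), |γ - (t + m)| ≤ 1 / 2 := by
      intro γ hγ
      have := abs_sub_round (γ - t)
      rw [← (Finset.mem_filter.1 hγ).2, ← sub_sub]
      exact this
    have h2 := hcard (t + m) (S.filter fun γ => κ γ = m)
      fun γ hγ => ⟨hS (Finset.mem_filter.1 hγ).1, h1 γ hγ⟩
    have h3 : ∀ γ ∈ S.filter (fun γ => κ γ = m),
        Real.exp (-(t - γ) ^ 2 / 2) ≤ 64 / (1 + |(m : ℝ)|) ^ 4 := by
      intro γ hγ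
      refine (exp_neg_sq_div_two_le _).trans ?_
      have h4 : 1 + |(m : ℝ)| ≤ 3 / 2 + |t - γ| := by
        have h5 := h1 γ hγ
        have h6 : |(m : ℝ)| ≤ |t - γ| + |γ - (t + m)| := by
          rw [← abs_neg (m : ℝ), show -(m : ℝ) = (t - γ) + (γ - (t + m)) by ring]
          exact abs_add_le _ _
        linarith
      have h7 : (1 + |(m : ℝ)|) ^ 2 ≤ 2 * (4 + (t - γ) ^ 2) := by
        have h8 : (1 + |(m : ℝ)|) ^ 2 ≤ (3 / 2 + |t - γ|) ^ 2 := by gcongr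
        nlinarith [sq_abs (t - γ), sq_nonneg (3 / 2 - |t - γ|)]
      rw [div_le_div_iff₀ (by positivity) (by positivity)]
      have h9 : ((1 + |(m : ℝ)|) ^ 2) ^ 2 ≤ (2 * (4 + (t - γ) ^ 2)) ^ 2 := by gcongr
      nlinarith
    refine (Finset.sum_le_card_nsmul _ _ _ h3).trans ?_
    rw [nsmul_eq_mul]
    have h10 : (1 + |t + m|) ^ (1 / 4 : ℝ)
        ≤ (1 + |t|) ^ (1 / 4 : ℝ) * (1 + |(m : ℝ)|) ^ (1 / 4 : ℝ) := by
      rw [← Real.mul_rpow (by positivity) (by positivity)]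
      refine Real.rpow_le_rpow (by positivity) ?_ (by norm_num)
      nlinarith [abs_add_le t m, abs_nonneg t, abs_nonneg (m : ℝ)]
    have h11 : (1 + |(m : ℝ)|) ^ (1 / 4 : ℝ) ≤ (1 + |(m : ℝ)|) ^ 2 := by
      rw [← Real.rpow_natCast]
      exact Real.rpow_le_rpow_of_exponent_le (by linarith [abs_nonneg (m : ℝ)]) (by norm_num)
    calc _ ≤ (A * ((1 + |t|) ^ (1 / 4 : ℝ) * (1 + |(m : ℝ)|) ^ 2))
          * (64 / (1 + |(m : ℝ)|) ^ 4) := by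
          gcongr
          refine h2.trans ?_
          gcongr
          exact h10.trans (by gcongr)
      _ = _ := by field_simp
  refine (Finset.sum_le_sum hfib).trans ?_
  rw [← Finset.mul_sum]
  have := summable_inv_one_add_abs_sq.sum_le_tsum (S.image κ) fun k _ => by positivity
  calc _ ≤ 64 * A * (1 + |t|) ^ (1 / 4 : ℝ) * ∑' m : ℤ, ((1 + |(m : ℝ)|) ^ 2)⁻¹ := by gcongr
    _ = _ := by ring

/-- The squared weight of the zero `1/2 + iγ` at `1/2 + δ + it`. -/
noncomputable def zetaSqWeight (δ t γ : ℝ) : ℝ :=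
  ‖zetaRes γ‖ ^ 2 * Real.exp (-(t - γ) ^ 2 / 2) * (1 + 1 / ‖(δ : ℂ) + (t - γ) * Complex.I‖) ^ 2

theorem zetaSqWeight_nonneg (δ t γ : ℝ) : 0 ≤ zetaSqWeight δ t γ := by
  rw [zetaSqWeight]; positivity

theorem exists_norm_zetaInv_sq_le (hRH : ZetaZerosOnLine) (hs : ZetaZerosSimple) :
    ∃ K > 0, ∀ δ t W : ℝ, 0 < δ → δ ≤ 1 →
      (∀ S : Finset ℝ, ↑S ⊆ zetaOrd → ∑ γ ∈ S, zetaSqWeight δ t γ ≤ W) →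
      ‖zetaInv (1 / 2 + δ + t * Complex.I)‖ ^ 2 ≤ K * (1 + (1 + |t|) ^ (1 / 4 : ℝ) * W) := by
  obtain ⟨K, hK, hKb⟩ := exists_norm_zetaInv_le_sum hRH hs
  obtain ⟨D, hD, hDb⟩ := exists_sum_exp_neg_sq_zetaOrd_le
  refine ⟨2 * K ^ 2 * (1 + D), by positivity, fun δ t W hδ hδ1 hW => ?_⟩
  have hW0 : 0 ≤ W := by simpa using hW ∅ (by simp)
  set B : ℝ := Real.sqrt (D * (1 + |t|) ^ (1 / 4 : ℝ) * W) with hB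
  have hB2 : B ^ 2 = D * (1 + |t|) ^ (1 / 4 : ℝ) * W := Real.sq_sqrt (by positivity)
  have h1 := hKb δ t B hδ hδ1 fun S hS => by
    apply Real.le_sqrt_of_sq_le
    have h2 : (∑ γ ∈ S, zetaWeight δ t γ) ^ 2
        ≤ (∑ γ ∈ S, Real.exp (-(t - γ) ^ 2 / 2)) * ∑ γ ∈ S, zetaSqWeight δ t γ := by
      refine Finset.sum_sq_le_sum_mul_sum_of_sq_le_mul S (fun _ _ => by positivity)
        (fun γ _ => zetaSqWeight_nonneg δ t γ) fun γ _ => le_of_eq ?_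
      rw [zetaWeight, zetaSqWeight]
      ring
    refine h2.trans ?_
    have h3 := Finset.sum_nonneg fun γ (_ : γ ∈ S) => zetaSqWeight_nonneg δ t γ
    gcongr
    · exact hDb t S hS
    · exact hW S hS
  have hX : 0 ≤ (1 + |t|) ^ (1 / 4 : ℝ) * W := by positivity
  calc _ ≤ (K * (1 + B)) ^ 2 := by gcongr
    _ ≤ 2 * K ^ 2 * (1 + B ^ 2) := by nlinarith [mul_nonneg (sq_nonneg K) (sq_nonneg (1 - B))]
    _ = 2 * K ^ 2 * (1 + D * ((1 + |t|) ^ (1 / 4 : ℝ) * W)) := by rw [hB2]; ring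
    _ ≤ 2 * K ^ 2 * ((1 + D) * (1 + (1 + |t|) ^ (1 / 4 : ℝ) * W)) := by
        gcongr
        nlinarith
    _ = _ := by ring

theorem exp_neg_sq_le_rpow_mul (t γ : ℝ) : Real.exp (-(t - γ) ^ 2 / 2)
    ≤ (1 + |t|) ^ (3 / 2 : ℝ) * (1 + |γ|) ^ (-(3 / 2) : ℝ) * (32 / (1 + (t - γ) ^ 2)) := by
  set x := t - γ with hx
  have h1 : (1 + |γ|) ^ (3 / 2 : ℝ) ≤ (1 + |t|) ^ (3 / 2 : ℝ) * (1 + |x|) ^ (3 / 2 : ℝ) := by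
    rw [← Real.mul_rpow (by positivity) (by positivity)]
    refine Real.rpow_le_rpow (by positivity) ?_ (by norm_num)
    have : |γ| ≤ |t| + |x| := by
      rw [show γ = t - x by rw [hx]; ring]
      exact abs_sub _ _
    nlinarith [abs_nonneg t, abs_nonneg x]
  have h2 : (1 + |x|) ^ (3 / 2 : ℝ) ≤ 2 * (1 + x ^ 2) := by
    calc _ ≤ (1 + |x|) ^ (2 : ℝ) :=
          Real.rpow_le_rpow_of_exponent_le (by linarith [abs_nonneg x]) (by norm_num)
      _ = (1 + |x|) ^ 2 := Real.rpow_two _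
      _ ≤ _ := by nlinarith [sq_abs x, sq_nonneg (1 - |x|)]
  have h3 : 1 ≤ (1 + |t|) ^ (3 / 2 : ℝ) * (1 + |γ|) ^ (-(3 / 2) : ℝ) * (2 * (1 + x ^ 2)) := by
    have h4 : 0 < (1 + |γ|) ^ (3 / 2 : ℝ) := by positivity
    rw [Real.rpow_neg (by positivity), mul_right_comm, ← div_eq_mul_inv, le_div_iff₀ h4, one_mul]
    exact h1.trans (by gcongr)
  calc _ ≤ 16 / (4 + x ^ 2) ^ 2 := exp_neg_sq_div_two_le x
    _ ≤ 16 / (1 + x ^ 2) ^ 2 := by gcongr; norm_num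
    _ = 1 * (16 / (1 + x ^ 2) ^ 2) := by ring
    _ ≤ ((1 + |t|) ^ (3 / 2 : ℝ) * (1 + |γ|) ^ (-(3 / 2) : ℝ) * (2 * (1 + x ^ 2)))
        * (16 / (1 + x ^ 2) ^ 2) := by gcongr
    _ = _ := by field_simp; ring

theorem exists_norm_zetaInv_growth (hRH : ZetaZerosOnLine) (hs : ZetaZerosSimple) {θ C : ℝ}
    (hθ : θ < 3 / 2) (hJ : InvMomentBound θ C) :
    ∃ K > 0, ∀ δ t : ℝ, 0 < δ → δ ≤ 1 →
      ‖zetaInv (1 / 2 + δ + t * Complex.I)‖ ≤ K * (1 + 1 / δ) * (1 + |t|) := by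
  obtain ⟨K, hK, hKb⟩ := exists_norm_zetaInv_sq_le hRH hs
  obtain ⟨A, hA, hAb⟩ := exists_sum_zetaRes_sq_le hθ hJ
  refine ⟨Real.sqrt (K * (1 + 32 * A)), by positivity, fun δ t hδ hδ1 => ?_⟩
  have h1 := hKb δ t (32 * A * (1 + |t|) ^ (3 / 2 : ℝ) * (1 + 1 / δ) ^ 2) hδ hδ1 fun S hS => by
    have h2 : ∀ γ ∈ S, zetaSqWeight δ t γ ≤ 32 * (1 + |t|) ^ (3 / 2 : ℝ) * (1 + 1 / δ) ^ 2
        * (‖zetaRes γ‖ ^ 2 * (1 + |γ|) ^ (-(3 / 2) : ℝ)) := by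
      intro γ _
      have h3 : δ ≤ ‖(δ : ℂ) + (t - γ) * Complex.I‖ := by
        refine (le_abs_self δ).trans ((le_of_eq ?_).trans (Complex.abs_re_le_norm _))
        simp
      have h4 : Real.exp (-(t - γ) ^ 2 / 2)
          ≤ (1 + |t|) ^ (3 / 2 : ℝ) * (1 + |γ|) ^ (-(3 / 2) : ℝ) * 32 := by
        refine (exp_neg_sq_le_rpow_mul t γ).trans ?_
        gcongr
        exact div_le_self (by norm_num) (by nlinarith [sq_nonneg (t - γ)])
      calc _ ≤ ‖zetaRes γ‖ ^ 2 * ((1 + |t|) ^ (3 / 2 : ℝ) * (1 + |γ|) ^ (-(3 / 2) : ℝ) * 32)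
            * (1 + 1 / δ) ^ 2 := by
            rw [zetaSqWeight]; gcongr
        _ = _ := by ring
    refine (Finset.sum_le_sum h2).trans ?_
    rw [← Finset.mul_sum]
    calc _ ≤ 32 * (1 + |t|) ^ (3 / 2 : ℝ) * (1 + 1 / δ) ^ 2 * A := by
          gcongr; exact hAb S hS
      _ = _ := by ring
  refine abs_le_of_sq_le_sq' ?_ (by positivity) |>.2
  rw [mul_assoc, mul_pow, Real.sq_sqrt (by positivity)]
  refine h1.trans ?_
  have ht1 : 1 ≤ 1 + |t| := by linarith [abs_nonneg t]
  have hδ2 : 1 ≤ 1 + 1 / δ := by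
    have : 0 ≤ 1 / δ := by positivity
    linarith
  have h5 : (1 + |t|) ^ (1 / 4 : ℝ) * (1 + |t|) ^ (3 / 2 : ℝ) ≤ (1 + |t|) ^ 2 := by
    rw [← Real.rpow_add (by positivity), ← Real.rpow_two]
    exact Real.rpow_le_rpow_of_exponent_le ht1 (by norm_num)
  have h6 : 1 ≤ ((1 + 1 / δ) * (1 + |t|)) ^ 2 :=
    one_le_pow₀ (one_le_mul_of_one_le_of_one_le hδ2 ht1)
  calc _ = K * (1 + 32 * A * (1 + 1 / δ) ^ 2
        * ((1 + |t|) ^ (1 / 4 : ℝ) * (1 + |t|) ^ (3 / 2 : ℝ))) := by ring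
    _ ≤ K * (((1 + 1 / δ) * (1 + |t|)) ^ 2 + 32 * A * (1 + 1 / δ) ^ 2 * (1 + |t|) ^ 2) := by gcongr
    _ = _ := by ring

theorem lintegral_ofReal_div_sq_add_sq {δ : ℝ} (hδ : 0 < δ) :
    ∫⁻ x : ℝ, ENNReal.ofReal (δ / (δ ^ 2 + x ^ 2)) = ENNReal.ofReal Real.pi := by
  have h1 : ∀ x : ℝ, δ / (δ ^ 2 + x ^ 2) = δ⁻¹ * (1 + (x / δ) ^ 2)⁻¹ := by
    intro x; field_simp
  have hint : Integrable fun x : ℝ => δ⁻¹ * (1 + (x / δ) ^ 2)⁻¹ :=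
    (integrable_inv_one_add_sq.comp_div hδ.ne').const_mul _
  simp_rw [h1]
  rw [← ofReal_integral_eq_lintegral_ofReal hint (Eventually.of_forall fun x => by positivity),
    integral_const_mul, Measure.integral_comp_div (fun x : ℝ => (1 + x ^ 2)⁻¹),
    integral_univ_inv_one_add_sq, abs_of_pos hδ, smul_eq_mul, inv_mul_cancel_left₀ hδ.ne']

/-- A kernel of mass `128 * π` majorizing the contribution of a single zero. -/
noncomputable def poleKernel (δ x : ℝ) : ℝ :=
  64 * (1 / (1 ^ 2 + x ^ 2)) + 64 * (δ / (δ ^ 2 + x ^ 2))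

theorem measurable_poleKernel (δ : ℝ) : Measurable (poleKernel δ) := by
  unfold poleKernel; fun_prop

theorem lintegral_poleKernel {δ : ℝ} (hδ : 0 < δ) :
    ∫⁻ x : ℝ, ENNReal.ofReal (poleKernel δ x) = ENNReal.ofReal (128 * Real.pi) := by
  have h1 : ∀ x : ℝ, ENNReal.ofReal (poleKernel δ x)
      = ENNReal.ofReal 64 * ENNReal.ofReal (1 / (1 ^ 2 + x ^ 2))
        + ENNReal.ofReal 64 * ENNReal.ofReal (δ / (δ ^ 2 + x ^ 2)) := by
    intro x
    rw [poleKernel, ENNReal.ofReal_add (by positivity) (by positivity),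
      ENNReal.ofReal_mul (by norm_num), ENNReal.ofReal_mul (by norm_num)]
  simp_rw [h1]
  rw [lintegral_add_left (by fun_prop), lintegral_const_mul _ (by fun_prop),
    lintegral_const_mul _ (by fun_prop), lintegral_ofReal_div_sq_add_sq one_pos,
    lintegral_ofReal_div_sq_add_sq hδ, ← ENNReal.ofReal_mul (by norm_num),
    ← ENNReal.ofReal_add (by positivity) (by positivity)]
  congr 1
  ring

theorem norm_ofReal_add_mul_I_sq (δ x : ℝ) :
    ‖(δ : ℂ) + x * Complex.I‖ ^ 2 = δ ^ 2 + x ^ 2 := by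
  rw [← Complex.normSq_eq_norm_sq, Complex.normSq_add_mul_I]

theorem mul_zetaSqWeight_le {δ t T γ : ℝ} (hδ : 0 < δ) (hδ1 : δ ≤ 1) (hT : 0 ≤ T)
    (ht : T ≤ |t|) :
    δ * (1 + |t|) ^ (-2 : ℝ) * (1 + |t|) ^ (1 / 4 : ℝ) * zetaSqWeight δ t γ
      ≤ (1 + T) ^ (-(1 / 4) : ℝ) * (‖zetaRes γ‖ ^ 2 * (1 + |γ|) ^ (-(3 / 2) : ℝ)
        * poleKernel δ (t - γ)) := by
  set x := t - γ with hx
  have hn : ‖(δ : ℂ) + (t - γ) * Complex.I‖ ^ 2 = δ ^ 2 + x ^ 2 := by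
    rw [← norm_ofReal_add_mul_I_sq, hx]; push_cast; rfl
  have h1 : δ * (1 + 1 / ‖(δ : ℂ) + (t - γ) * Complex.I‖) ^ 2
      ≤ 2 + 2 * (δ / (δ ^ 2 + x ^ 2)) := by
    rw [← hn]
    set m := ‖(δ : ℂ) + (t - γ) * Complex.I‖
    have h2 : (1 + 1 / m) ^ 2 ≤ 2 + 2 * (1 / m ^ 2) := by
      have : 1 / m ^ 2 = (1 / m) ^ 2 := by rw [div_pow, one_pow]
      rw [this]
      nlinarith [sq_nonneg (1 - 1 / m)]
    calc _ ≤ δ * (2 + 2 * (1 / m ^ 2)) := by gcongr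
      _ = 2 * δ + 2 * (δ / m ^ 2) := by ring
      _ ≤ _ := by linarith
  have h3 : (1 + |t|) ^ (-2 : ℝ) * (1 + |t|) ^ (1 / 4 : ℝ) * (1 + |t|) ^ (3 / 2 : ℝ)
      ≤ (1 + T) ^ (-(1 / 4) : ℝ) := by
    rw [← Real.rpow_add (by positivity), ← Real.rpow_add (by positivity),
      show (-2 : ℝ) + 1 / 4 + 3 / 2 = -(1 / 4) by norm_num]
    exact Real.rpow_le_rpow_of_nonpos (by linarith) (by linarith) (by norm_num)
  have h4 : 32 / (1 + x ^ 2) * (2 + 2 * (δ / (δ ^ 2 + x ^ 2))) ≤ poleKernel δ x := by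
    have h5 : 0 ≤ δ / (δ ^ 2 + x ^ 2) := by positivity
    have h6 : 1 / (1 + x ^ 2) * (δ / (δ ^ 2 + x ^ 2)) ≤ δ / (δ ^ 2 + x ^ 2) :=
      mul_le_of_le_one_left h5 (div_le_one_of_le₀ (by nlinarith) (by positivity))
    rw [poleKernel, one_pow]
    calc _ = 64 * (1 / (1 + x ^ 2)) + 64 * (1 / (1 + x ^ 2) * (δ / (δ ^ 2 + x ^ 2))) := by ring
      _ ≤ _ := by gcongr
  calc _ = (1 + |t|) ^ (-2 : ℝ) * (1 + |t|) ^ (1 / 4 : ℝ) * ‖zetaRes γ‖ ^ 2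
        * Real.exp (-(t - γ) ^ 2 / 2)
        * (δ * (1 + 1 / ‖(δ : ℂ) + (t - γ) * Complex.I‖) ^ 2) := by rw [zetaSqWeight]; ring
    _ ≤ (1 + |t|) ^ (-2 : ℝ) * (1 + |t|) ^ (1 / 4 : ℝ) * ‖zetaRes γ‖ ^ 2
        * ((1 + |t|) ^ (3 / 2 : ℝ) * (1 + |γ|) ^ (-(3 / 2) : ℝ) * (32 / (1 + x ^ 2)))
        * (2 + 2 * (δ / (δ ^ 2 + x ^ 2))) := by
        gcongr
        exact exp_neg_sq_le_rpow_mul t γ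
    _ = ((1 + |t|) ^ (-2 : ℝ) * (1 + |t|) ^ (1 / 4 : ℝ) * (1 + |t|) ^ (3 / 2 : ℝ))
        * (‖zetaRes γ‖ ^ 2 * (1 + |γ|) ^ (-(3 / 2) : ℝ)
          * (32 / (1 + x ^ 2) * (2 + 2 * (δ / (δ ^ 2 + x ^ 2))))) := by ring
    _ ≤ _ := by gcongr

theorem countable_zetaOrd : zetaOrd.Countable := by
  have : zetaOrd ⊆ ⋃ n : ℕ, {γ | γ ∈ zetaOrd ∧ |γ| ≤ n} := fun γ hγ =>
    Set.mem_iUnion.2 ⟨⌈|γ|⌉₊, hγ, Nat.le_ceil _⟩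
  exact (Set.countable_iUnion fun n : ℕ => (finite_zetaOrd_Icc n).countable).mono this

theorem enorm_zetaInv_sq_le (hRH : ZetaZerosOnLine) (hs : ZetaZerosSimple) :
    ∃ K > 0, ∀ δ t : ℝ, 0 < δ → δ ≤ 1 →
      ‖zetaInv (1 / 2 + δ + t * Complex.I)‖ₑ ^ 2 ≤ ENNReal.ofReal K
        * (1 + ENNReal.ofReal ((1 + |t|) ^ (1 / 4 : ℝ))
          * ∑' γ : zetaOrd, ENNReal.ofReal (zetaSqWeight δ t γ)) := by
  classical
  obtain ⟨K, hK, hKb⟩ := exists_norm_zetaInv_sq_le hRH hs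
  refine ⟨K, hK, fun δ t hδ hδ1 => ?_⟩
  have hP : 0 < (1 + |t|) ^ (1 / 4 : ℝ) := by positivity
  rcases eq_or_ne (∑' γ : zetaOrd, ENNReal.ofReal (zetaSqWeight δ t γ)) ∞ with htop | htop
  · rw [htop, ENNReal.mul_top (by simpa using hP), add_top, ENNReal.mul_top (by simpa using hK)]
    exact le_top
  · have h1 := hKb δ t (∑' γ : zetaOrd, ENNReal.ofReal (zetaSqWeight δ t γ)).toReal hδ hδ1
      fun S hS => by
        rw [← ENNReal.ofReal_le_iff_le_toReal htop,
          ENNReal.ofReal_sum_of_nonneg fun γ _ => zetaSqWeight_nonneg δ t γ,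
          ← Finset.sum_subtype_of_mem (p := fun γ => γ ∈ zetaOrd)
            (fun γ => ENNReal.ofReal (zetaSqWeight δ t γ)) (fun γ hγ => hS hγ)]
        exact ENNReal.sum_le_tsum _
    rw [← ofReal_norm, ← ENNReal.ofReal_pow (norm_nonneg _)]
    refine (ENNReal.ofReal_le_ofReal h1).trans (le_of_eq ?_)
    rw [ENNReal.ofReal_mul hK.le, ENNReal.ofReal_add zero_le_one
      (mul_nonneg hP.le ENNReal.toReal_nonneg), ENNReal.ofReal_mul hP.le,
      ENNReal.ofReal_toReal htop, ENNReal.ofReal_one]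

theorem exists_tsum_zetaRes_sq_le {θ C : ℝ} (hθ : θ < 3 / 2) (hJ : InvMomentBound θ C) :
    ∃ A : ℝ, 0 ≤ A ∧ ∑' γ : zetaOrd, ENNReal.ofReal
      (‖zetaRes γ‖ ^ 2 * (1 + |(γ : ℝ)|) ^ (-(3 / 2) : ℝ)) ≤ ENNReal.ofReal A := by
  obtain ⟨A, hA, hAb⟩ := exists_sum_zetaRes_sq_le hθ hJ
  refine ⟨A, hA, ?_⟩
  rw [ENNReal.tsum_eq_iSup_sum]
  refine iSup_le fun S => ?_
  rw [← ENNReal.ofReal_sum_of_nonneg fun γ _ => by positivity]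
  have := hAb (S.map (Function.Embedding.subtype _)) (by
    intro γ hγ
    rw [Finset.mem_coe, Finset.mem_map] at hγ
    obtain ⟨x, -, rfl⟩ := hγ
    exact x.2)
  rw [Finset.sum_map] at this
  exact ENNReal.ofReal_le_ofReal this

theorem exists_lintegral_zetaInv_tail_le (hRH : ZetaZerosOnLine) (hs : ZetaZerosSimple) {θ C : ℝ}
    (hθ : θ < 3 / 2) (hJ : InvMomentBound θ C) :
    ∃ K > 0, ∀ δ T : ℝ, 0 < δ → δ ≤ 1 → 0 ≤ T →
      ENNReal.ofReal δ * ∫⁻ t in {t : ℝ | T ≤ |t|}, ENNReal.ofReal ((1 + |t|) ^ (-2 : ℝ))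
        * ‖zetaInv (1 / 2 + δ + t * Complex.I)‖ₑ ^ 2
        ≤ ENNReal.ofReal (K * (δ + (1 + T) ^ (-(1 / 4) : ℝ))) := by
  obtain ⟨K, hK, hKb⟩ := enorm_zetaInv_sq_le hRH hs
  obtain ⟨A, hA, hAb⟩ := exists_tsum_zetaRes_sq_le hθ hJ
  have : Countable zetaOrd := countable_zetaOrd.to_subtype
  refine ⟨K * (Real.pi + A * (128 * Real.pi)), by positivity, fun δ T hδ hδ1 hT => ?_⟩
  set a : ℝ → ℝ := fun γ => ‖zetaRes γ‖ ^ 2 * (1 + |γ|) ^ (-(3 / 2) : ℝ) with ha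
  set τ : ℝ := (1 + T) ^ (-(1 / 4) : ℝ) with hτ
  have hτ0 : 0 ≤ τ := by positivity
  have hpt : ∀ t ∈ {t : ℝ | T ≤ |t|}, ENNReal.ofReal δ * (ENNReal.ofReal ((1 + |t|) ^ (-2 : ℝ))
      * ‖zetaInv (1 / 2 + δ + t * Complex.I)‖ₑ ^ 2)
      ≤ ENNReal.ofReal K * (ENNReal.ofReal δ * ENNReal.ofReal ((1 + t ^ 2)⁻¹)
        + ENNReal.ofReal τ * ∑' γ : zetaOrd, ENNReal.ofReal (a γ)
          * ENNReal.ofReal (poleKernel δ (t - γ))) := by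
    intro t ht
    have hP : 0 ≤ (1 + |t|) ^ (1 / 4 : ℝ) := by positivity
    have hQ : 0 ≤ (1 + |t|) ^ (-2 : ℝ) := by positivity
    calc _ ≤ ENNReal.ofReal δ * (ENNReal.ofReal ((1 + |t|) ^ (-2 : ℝ)) * (ENNReal.ofReal K
        * (1 + ENNReal.ofReal ((1 + |t|) ^ (1 / 4 : ℝ))
          * ∑' γ : zetaOrd, ENNReal.ofReal (zetaSqWeight δ t γ)))) := by
          gcongr
          exact hKb δ t hδ hδ1
      _ = ENNReal.ofReal K * (ENNReal.ofReal δ * ENNReal.ofReal ((1 + |t|) ^ (-2 : ℝ))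
          + ∑' γ : zetaOrd, ENNReal.ofReal δ * ENNReal.ofReal ((1 + |t|) ^ (-2 : ℝ))
            * ENNReal.ofReal ((1 + |t|) ^ (1 / 4 : ℝ)) * ENNReal.ofReal (zetaSqWeight δ t γ)) := by
          rw [ENNReal.tsum_mul_left]; ring
      _ ≤ _ := by
          rw [← ENNReal.tsum_mul_left]
          refine mul_le_mul' le_rfl (add_le_add (mul_le_mul' le_rfl
            (ENNReal.ofReal_le_ofReal ?_)) (ENNReal.tsum_le_tsum fun γ => ?_))
          · rw [Real.rpow_neg (by positivity), Real.rpow_two]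
            apply inv_anti₀ (by positivity)
            nlinarith [sq_abs t, abs_nonneg t]
          · rw [← ENNReal.ofReal_mul hδ.le, ← ENNReal.ofReal_mul (by positivity),
              ← ENNReal.ofReal_mul (by positivity), ← ENNReal.ofReal_mul (by positivity),
              ← ENNReal.ofReal_mul (by positivity)]
            exact ENNReal.ofReal_le_ofReal (mul_zetaSqWeight_le hδ hδ1 hT ht)
  rw [← lintegral_const_mul' _ _ ENNReal.ofReal_ne_top]
  refine (setLIntegral_mono' (measurableSet_le measurable_const measurable_norm) hpt).trans ?_
  refine (setLIntegral_le_lintegral _ _).trans ?_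
  have hmk : ∀ γ : ℝ, Measurable fun t : ℝ => ENNReal.ofReal (poleKernel δ (t - γ)) := fun γ =>
    ((measurable_poleKernel δ).comp (measurable_id.sub_const γ)).ennreal_ofReal
  have hk : ∀ γ : ℝ, ∫⁻ t : ℝ, ENNReal.ofReal (poleKernel δ (t - γ))
      = ENNReal.ofReal (128 * Real.pi) := fun γ => by
    rw [lintegral_sub_right_eq_self (fun t : ℝ => ENNReal.ofReal (poleKernel δ t)) γ,
      lintegral_poleKernel hδ]
  have hpi : ∫⁻ t : ℝ, ENNReal.ofReal ((1 + t ^ 2)⁻¹) = ENNReal.ofReal Real.pi := by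
    simpa [one_div] using lintegral_ofReal_div_sq_add_sq one_pos
  rw [lintegral_const_mul' _ _ ENNReal.ofReal_ne_top, lintegral_add_left (by fun_prop),
    lintegral_const_mul' _ _ ENNReal.ofReal_ne_top, lintegral_const_mul' _ _ ENNReal.ofReal_ne_top,
    lintegral_tsum fun γ : zetaOrd => ((hmk γ).const_mul _).aemeasurable, hpi]
  simp_rw [lintegral_const_mul' _ _ ENNReal.ofReal_ne_top, hk]
  rw [ENNReal.tsum_mul_right]
  calc _ ≤ ENNReal.ofReal K * (ENNReal.ofReal δ * ENNReal.ofReal Real.pi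
        + ENNReal.ofReal τ * (ENNReal.ofReal A * ENNReal.ofReal (128 * Real.pi))) := by gcongr
    _ = ENNReal.ofReal (K * (δ * Real.pi + τ * (A * (128 * Real.pi)))) := by
        rw [ENNReal.ofReal_mul hK.le, ENNReal.ofReal_add (by positivity) (by positivity),
          ENNReal.ofReal_mul hδ.le, ENNReal.ofReal_mul hτ0, ENNReal.ofReal_mul hA]
    _ ≤ _ := by
        rw [mul_assoc]
        apply ENNReal.ofReal_le_ofReal
        have h1 : 0 ≤ τ * Real.pi := by positivity
        have h2 : 0 ≤ δ * (A * (128 * Real.pi)) := by positivity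
        gcongr
        linarith

theorem integral_sum_floor_exp_mul {c : ℕ → ℂ} {β : ℂ} (hc : c 0 = 0) (hβ : 0 < β.re)
    (hsum : Summable fun n : ℕ => ‖c n‖ * Real.exp (-β.re * Real.log n)) :
    ∫ y in Set.Ioi (0 : ℝ), (∑ n ∈ Finset.Icc 1 ⌊Real.exp y⌋₊, c n) * Complex.exp (-β * y)
      = (∑' n : ℕ, c n * Complex.exp (-β * Real.log n)) / β := by
  have hβ' : (-β).re < 0 := by simpa using hβ
  have hlog : ∀ n : ℕ, Set.Ici (Real.log n) ∩ Set.Ici 0 = Set.Ici (Real.log n) := fun n =>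
    Set.inter_eq_left.2 (Set.Ici_subset_Ici.2 (Real.log_natCast_nonneg n))
  set F : ℕ → ℝ → ℂ := fun n => (Set.Ici (Real.log n)).indicator
    fun y => c n * Complex.exp (-β * y) with hF
  have hint0 : ∀ n : ℕ, IntegrableOn (fun y : ℝ => c n * Complex.exp (-β * y))
      (Set.Ici (Real.log n)) := fun n =>
    (integrableOn_Ici_iff_integrableOn_Ioi).2 ((integrableOn_exp_mul_complex_Ioi hβ' _).const_mul _)
  have hint : ∀ n, Integrable (F n) (volume.restrict (Set.Ici 0)) := by
    intro n
    rw [hF, integrable_indicator_iff measurableSet_Ici, IntegrableOn,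
      Measure.restrict_restrict measurableSet_Ici, hlog]
    exact hint0 n
  have hval : ∀ n, ∫ y in Set.Ici (0 : ℝ), F n y
      = c n * Complex.exp (-β * Real.log n) / β := by
    intro n
    rw [hF, integral_indicator measurableSet_Ici, Measure.restrict_restrict measurableSet_Ici,
      hlog, integral_Ici_eq_integral_Ioi, integral_const_mul, integral_exp_mul_complex_Ioi hβ',
      neg_div_neg_eq, mul_div_assoc]
  have hnorm : ∀ n, ∫ y in Set.Ici (0 : ℝ), ‖F n y‖
      = ‖c n‖ * Real.exp (-β.re * Real.log n) / β.re := by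
    intro n
    have h1 : ∀ y, ‖F n y‖
        = (Set.Ici (Real.log n)).indicator (fun y => ‖c n‖ * Real.exp (-β.re * y)) y := by
      intro y
      rw [hF, norm_indicator_eq_indicator_norm]
      congr 1
      funext x
      rw [norm_mul, Complex.norm_exp]
      simp
    simp_rw [h1]
    rw [integral_indicator measurableSet_Ici, Measure.restrict_restrict measurableSet_Ici,
      hlog, integral_Ici_eq_integral_Ioi, integral_const_mul, integral_exp_mul_Ioi (by linarith),
      neg_div_neg_eq, mul_div_assoc]
  have hS := hasSum_integral_of_summable_integral_norm hint (by
    simp_rw [hnorm]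
    exact hsum.div_const _)
  simp_rw [hval] at hS
  have htsum : ∀ y : ℝ, ∑' n, F n y
      = (∑ n ∈ Finset.Icc 1 ⌊Real.exp y⌋₊, c n) * Complex.exp (-β * y) := by
    intro y
    rw [tsum_eq_sum (s := Finset.Icc 1 ⌊Real.exp y⌋₊), Finset.sum_mul]
    · refine Finset.sum_congr rfl fun n hn => ?_
      rw [Finset.mem_Icc] at hn
      refine Set.indicator_of_mem ?_ _
      have h0 : (0 : ℝ) < n := by exact_mod_cast hn.1
      rw [Set.mem_Ici, Real.log_le_iff_le_exp h0]
      exact (Nat.le_floor_iff (Real.exp_pos y).le).1 hn.2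
    · intro n hn
      rcases Nat.eq_zero_or_pos n with rfl | hn0
      · simp [hF, hc]
      · refine Set.indicator_of_notMem ?_ _
        have h0 : (0 : ℝ) < n := by exact_mod_cast hn0
        rw [Set.mem_Ici, Real.log_le_iff_le_exp h0, ← Nat.le_floor_iff (Real.exp_pos y).le]
        exact fun h => hn (Finset.mem_Icc.2 ⟨hn0, h⟩)
  simp_rw [htsum] at hS
  rw [← integral_Ici_eq_integral_Ioi, ← hS.tsum_eq, tsum_div_const]

/-- The constant subtracted from `M_α` in `E₂`. -/
noncomputable def mertensConst (α : ℝ) : ℝ := if α ≤ 1 / 2 then 0 else (zetaInv α).re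

theorem ofReal_re_zetaInv (α : ℝ) : ((zetaInv α).re : ℂ) = zetaInv α := by
  rw [← Complex.conj_eq_iff_re, ← zetaInv_conj, Complex.conj_ofReal]

theorem E₂_eq (α y : ℝ) :
    E₂ α y = Real.exp (y * (α - 1 / 2)) * (Mweight α (Real.exp y) - mertensConst α) := by
  rw [E₂, mertensConst]
  split_ifs with h1 h2
  · rw [sub_zero]
  · rw [h2, zetaInv]
    simp
  · rw [zetaInv_eq_inv (by exact_mod_cast h2)]
    simp only [one_div]

theorem abs_Mweight_le {α x : ℝ} (hα : 0 ≤ α) (hx : 0 ≤ x) : |Mweight α x| ≤ x := by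
  rw [Mweight]
  refine (Finset.abs_sum_le_sum_abs _ _).trans ?_
  have h : ∀ n ∈ Finset.Icc 1 ⌊x⌋₊, |(ArithmeticFunction.moebius n : ℝ) / (n : ℝ) ^ α| ≤ 1 := by
    intro n hn
    have hn1 : (1 : ℝ) ≤ n := by exact_mod_cast (Finset.mem_Icc.1 hn).1
    rw [abs_div, abs_of_nonneg (a := (n : ℝ) ^ α) (by positivity)]
    have h1 : |(ArithmeticFunction.moebius n : ℝ)| ≤ 1 := by
      exact_mod_cast ArithmeticFunction.abs_moebius_le_one
    exact div_le_one_of_le₀ (h1.trans (Real.one_le_rpow hn1 hα)) (by positivity)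
  refine (Finset.sum_le_card_nsmul _ _ _ h).trans ?_
  simpa using Nat.floor_le hx

theorem abs_E₂_le {α : ℝ} (h0 : 0 ≤ α) (h1 : α ≤ 1) {u : ℝ} (hu : 0 < u) :
    |E₂ α u| ≤ (1 + |mertensConst α|) * Real.exp (2 * u) := by
  rw [E₂_eq, abs_mul, abs_of_pos (Real.exp_pos _)]
  have h2 := abs_Mweight_le h0 (Real.exp_pos u).le
  have h3 : 1 ≤ Real.exp u := Real.one_le_exp hu.le
  have h4 := abs_nonneg (mertensConst α)
  calc _ ≤ Real.exp u * (Real.exp u + |mertensConst α|) := by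
        gcongr
        · nlinarith
        · exact (abs_sub _ _).trans (by gcongr)
    _ ≤ Real.exp u * ((1 + |mertensConst α|) * Real.exp u) := by
        gcongr
        nlinarith
    _ = _ := by rw [two_mul, Real.exp_add]; ring

theorem measurable_E₂ (α : ℝ) : Measurable (E₂ α) := by
  have h : E₂ α = fun y => Real.exp (y * (α - 1 / 2))
      * (Mweight α (Real.exp y) - mertensConst α) := funext (E₂_eq α)
  rw [h]
  have h1 : Measurable fun y => Mweight α (Real.exp y) :=
    (measurable_from_nat (f := fun k : ℕ =>
      ∑ n ∈ Finset.Icc 1 k, (ArithmeticFunction.moebius n : ℝ) / (n : ℝ) ^ α)).comp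
      (Nat.measurable_floor.comp Real.measurable_exp)
  exact (by fun_prop : Measurable fun y : ℝ => Real.exp (y * (α - 1 / 2))).mul (h1.sub_const _)

theorem ae_continuousAt_E₂ (α : ℝ) : ∀ᵐ u : ℝ, 0 < u → ContinuousAt (E₂ α) u := by
  have hc : (Set.range fun n : ℕ => Real.log n).Countable := Set.countable_range _
  filter_upwards [hc.ae_notMem volume] with u hu _
  have hne : ((⌊Real.exp u⌋₊ : ℕ) : ℝ) ≠ Real.exp u := fun h =>
    hu ⟨⌊Real.exp u⌋₊, by simp only [h, Real.log_exp]⟩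
  have h1 : ((⌊Real.exp u⌋₊ : ℕ) : ℝ) < Real.exp u :=
    lt_of_le_of_ne (Nat.floor_le (Real.exp_pos u).le) hne
  have h2 := Nat.lt_floor_add_one (Real.exp u)
  have hev : ∀ᶠ v in 𝓝 u, Mweight α (Real.exp v) = Mweight α (Real.exp u) := by
    filter_upwards [Real.continuous_exp.continuousAt.eventually (lt_mem_nhds h1),
      Real.continuous_exp.continuousAt.eventually (gt_mem_nhds h2)] with v h3 h4
    rw [Mweight, Mweight, (Nat.floor_eq_iff (Real.exp_pos v).le).2 ⟨h3.le, h4⟩]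
  have h3 : ContinuousAt (fun v => Real.exp (v * (α - 1 / 2))
      * (Mweight α (Real.exp u) - mertensConst α)) u := by fun_prop
  refine h3.congr ?_
  filter_upwards [hev] with v hv
  rw [E₂_eq, hv]

theorem integral_E₂_mul_cexp {α : ℝ} (h0 : 0 ≤ α) (h1 : α ≤ 1) {z : ℂ} (hz : 2 < z.re) :
    ∫ u in Set.Ioi (0 : ℝ), (E₂ α u : ℂ) * Complex.exp (-z * u)
      = (zetaInv (1 / 2 + z) - mertensConst α) / (1 / 2 + z - α) := by
  set β : ℂ := 1 / 2 + z - α with hβ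
  have hβre : β.re = 1 / 2 + z.re - α := by simp [hβ]
  have hβ0 : 1 < β.re := by rw [hβre]; linarith
  set c : ℕ → ℂ := fun n => (((ArithmeticFunction.moebius n : ℝ) / (n : ℝ) ^ α : ℝ) : ℂ) with hc
  have hs : 1 < (1 / 2 + z).re := by
    simp only [Complex.add_re, one_div, Complex.inv_re, Complex.re_ofNat, Complex.normSq_ofNat]
    linarith
  have hterm : ∀ n : ℕ, c n * Complex.exp (-β * Real.log n)
      = LSeries.term (fun n => (ArithmeticFunction.moebius n : ℂ)) (1 / 2 + z) n := by
    intro n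
    rw [LSeries.term_def]
    split_ifs with hn
    · simp [hc, hn]
    · have hn' : (n : ℂ) ≠ 0 := by exact_mod_cast hn
      rw [show -β = (α : ℂ) - (1 / 2 + z) by rw [hβ]; ring, Complex.natCast_log,
        mul_comm _ (Complex.log n),
        ← Complex.cpow_def_of_ne_zero hn', Complex.cpow_sub _ _ hn', hc]
      have h3 : (((n : ℝ) ^ α : ℝ) : ℂ) = (n : ℂ) ^ (α : ℂ) := by
        rw [Complex.ofReal_cpow (by positivity)]; simp
      have h4 : (n : ℂ) ^ (α : ℂ) ≠ 0 := by rw [Complex.cpow_ne_zero_iff]; exact Or.inl hn'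
      push_cast [h3]
      field_simp
  have hsumm : Summable fun n : ℕ => ‖c n * Complex.exp (-β * Real.log n)‖ := by
    simp_rw [hterm]
    exact (ArithmeticFunction.LSeriesSummable_moebius_iff.2 hs).norm
  have hsumm' : Summable fun n : ℕ => ‖c n‖ * Real.exp (-β.re * Real.log n) := by
    refine hsumm.congr fun n => ?_
    rw [norm_mul, Complex.norm_exp, Complex.re_mul_ofReal, Complex.neg_re]
  have hmain := integral_sum_floor_exp_mul (c := c) (by simp [hc]) (zero_lt_one.trans hβ0) hsumm'
  simp_rw [hterm] at hmain
  have hβ' : (-β).re < 0 := by rw [Complex.neg_re]; linarith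
  have hconst : ∫ u in Set.Ioi (0 : ℝ), (mertensConst α : ℂ) * Complex.exp (-β * u)
      = mertensConst α / β := by
    rw [integral_const_mul, integral_exp_mul_complex_Ioi hβ']
    simp [div_eq_mul_inv]
  have hkey : ∀ u : ℝ, (E₂ α u : ℂ) * Complex.exp (-z * u)
      = (∑ n ∈ Finset.Icc 1 ⌊Real.exp u⌋₊, c n) * Complex.exp (-β * u)
        - (mertensConst α : ℂ) * Complex.exp (-β * u) := by
    intro u
    have h3 : Complex.exp (-β * u) = Complex.exp (u * (α - 1 / 2)) * Complex.exp (-z * u) := by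
      rw [← Complex.exp_add, hβ]; congr 1; ring
    rw [E₂_eq, Mweight, h3, hc]
    push_cast
    ring
  have hi2 : IntegrableOn (fun u : ℝ => (mertensConst α : ℂ) * Complex.exp (-β * u)) (Set.Ioi 0) :=
    (integrableOn_exp_mul_complex_Ioi hβ' 0).const_mul _
  have hi1 : IntegrableOn (fun u : ℝ => (E₂ α u : ℂ) * Complex.exp (-z * u)) (Set.Ioi 0) :=
    integrableOn_mul_cexp_neg_mul (h := fun u => (E₂ α u : ℂ)) (A := 2)
      (C := 1 + |mertensConst α|) (measurable_E₂ α).complex_ofReal (fun u hu => by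
        rw [Complex.norm_real]; exact abs_E₂_le h0 h1 hu) hz
  have hi3 : IntegrableOn (fun u : ℝ => (∑ n ∈ Finset.Icc 1 ⌊Real.exp u⌋₊, c n)
      * Complex.exp (-β * u)) (Set.Ioi 0) := by
    refine (hi1.add hi2).congr (Eventually.of_forall fun u => ?_)
    simp only [Pi.add_apply, hkey, sub_add_cancel]
  simp_rw [hkey]
  rw [integral_sub hi3 hi2, hconst, hmain, zetaInv_eq_LSeries hs, LSeries, sub_div]

/-- The meromorphic continuation of the Laplace transform of `E₂ α`. -/
noncomputable def laplaceE₂ (α : ℝ) (z : ℂ) : ℂ :=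
  if α ≤ 1 / 2 then zetaInv (1 / 2 + z) / (1 / 2 + z - α) else dslope zetaInv α (1 / 2 + z)

theorem laplaceE₂_eq {α : ℝ} {z : ℂ} (hz : 1 / 2 + z ≠ α) :
    laplaceE₂ α z = (zetaInv (1 / 2 + z) - mertensConst α) / (1 / 2 + z - α) := by
  unfold laplaceE₂ mertensConst
  split_ifs with h
  · simp
  · rw [dslope_of_ne _ hz, slope_def_field, ofReal_re_zetaInv]

theorem isOpen_riemannZeta₁_ne_zero : IsOpen {s : ℂ | riemannZeta₁ s ≠ 0} :=
  isOpen_ne_fun differentiable_riemannZeta₁.continuous continuous_const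

theorem riemannZeta₁_ne_zero_of_half_lt (hRH : ZetaZerosOnLine) {s : ℂ} (hs : 1 / 2 < s.re) :
    riemannZeta₁ s ≠ 0 := fun h => by
  have := (re_eq_half_of_riemannZeta₁_eq_zero hRH h (by linarith)).1
  linarith

theorem differentiableAt_laplaceE₂ (hRH : ZetaZerosOnLine) {α : ℝ} {z : ℂ}
    (hz : riemannZeta₁ (1 / 2 + z) ≠ 0) (hα : α ≤ 1 / 2 → 1 / 2 + z ≠ α) :
    DifferentiableAt ℂ (laplaceE₂ α) z := by
  have hid : DifferentiableAt ℂ (fun w : ℂ => 1 / 2 + w) z := by fun_prop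
  by_cases h : α ≤ 1 / 2
  · have h1 : laplaceE₂ α = fun w => zetaInv (1 / 2 + w) / (1 / 2 + w - α) := by
      funext w
      simp only [laplaceE₂, if_pos h]
    rw [h1]
    exact ((differentiableAt_zetaInv hz).comp z hid).div (by fun_prop) (sub_ne_zero.2 (hα h))
  · have h1 : laplaceE₂ α = fun w => dslope zetaInv α (1 / 2 + w) := by
      funext w
      simp only [laplaceE₂, if_neg h]
    rw [h1]
    have hmem : riemannZeta₁ (α : ℂ) ≠ 0 :=
      riemannZeta₁_ne_zero_of_half_lt hRH (by rw [Complex.ofReal_re]; linarith)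
    have h2 : DifferentiableOn ℂ (dslope zetaInv α) {s : ℂ | riemannZeta₁ s ≠ 0} :=
      (Complex.differentiableOn_dslope (isOpen_riemannZeta₁_ne_zero.mem_nhds hmem)).2
        fun s hs => (differentiableAt_zetaInv hs).differentiableWithinAt
    exact (h2.differentiableAt (isOpen_riemannZeta₁_ne_zero.mem_nhds hz)).comp z hid

theorem differentiableOn_laplaceE₂ (hRH : ZetaZerosOnLine) (α : ℝ) :
    DifferentiableOn ℂ (laplaceE₂ α) {z | 0 < z.re} := fun z hz => by
  rw [Set.mem_ofPred_eq] at hz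
  have hre : 1 / 2 < ((1 / 2 + z : ℂ)).re := by simp; linarith
  refine (differentiableAt_laplaceE₂ hRH (riemannZeta₁_ne_zero_of_half_lt hRH hre)
    fun h h1 => ?_).differentiableWithinAt
  rw [h1, Complex.ofReal_re] at hre
  linarith

theorem laplaceE₂_eq_integral {α : ℝ} (h0 : 0 ≤ α) (h1 : α ≤ 1) {z : ℂ} (hz : 2 < z.re) :
    laplaceE₂ α z = ∫ u in Set.Ioi (0 : ℝ), (E₂ α u : ℂ) * Complex.exp (-z * u) := by
  rw [integral_E₂_mul_cexp h0 h1 hz, laplaceE₂_eq]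
  intro h
  have := congrArg Complex.re h
  simp at this
  linarith

theorem half_norm_le_norm_sub {α : ℝ} (h0 : 0 ≤ α) (h1 : α ≤ 1) {z : ℂ} (hz : 1 ≤ ‖z‖) :
    ‖z‖ / 2 ≤ ‖1 / 2 + z - α‖ := by
  have h2 : ‖(((1 / 2 - α : ℝ)) : ℂ)‖ ≤ 1 / 2 := by
    rw [Complex.norm_real, Real.norm_eq_abs, abs_le]
    constructor <;> linarith
  have h3 : (1 / 2 + z - α : ℂ) = z + ((1 / 2 - α : ℝ) : ℂ) := by
    push_cast
    ring
  rw [h3]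
  have := norm_sub_le_norm_add z (((1 / 2 - α : ℝ)) : ℂ)
  linarith

theorem exists_norm_laplaceE₂_le (hRH : ZetaZerosOnLine) (hs : ZetaZerosSimple) {θ C : ℝ}
    (hθ : θ < 3 / 2) (hJ : InvMomentBound θ C) {α : ℝ} (h0 : 0 ≤ α) (h1 : α ≤ 1) {δ : ℝ}
    (hδ : 0 < δ) : ∃ K, ∀ z : ℂ, δ ≤ z.re → ‖laplaceE₂ α z‖ ≤ K := by
  have hcomp : IsCompact ({z : ℂ | δ ≤ z.re} ∩ Metric.closedBall 0 1) :=
    (isCompact_closedBall 0 1).inter_left (isClosed_le continuous_const Complex.continuous_re)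
  obtain ⟨M, hM⟩ := hcomp.exists_bound_of_continuousOn
    ((differentiableOn_laplaceE₂ hRH α).continuousOn.mono fun z hz => lt_of_lt_of_le hδ hz.1)
  obtain ⟨K₁, hK₁, hb₁⟩ := exists_norm_zetaInv_le_of_le_re (a := 3 / 2) (by norm_num)
  obtain ⟨K₂, hK₂, hb₂⟩ := exists_norm_zetaInv_growth hRH hs hθ hJ
  have hδ' : 0 < 1 / δ := by positivity
  set B : ℝ := K₁ + K₂ * (1 + 1 / δ) * 2 + |mertensConst α| with hB
  have hB0 : 0 ≤ B := by positivity
  refine ⟨max M (2 * B), fun z hz => ?_⟩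
  rcases le_total ‖z‖ 1 with hz1 | hz1
  · exact (hM z ⟨hz, by simpa using hz1⟩).trans (le_max_left _ _)
  refine le_trans ?_ (le_max_right _ _)
  have hzpos : 0 < ‖z‖ := by linarith
  have hlow := half_norm_le_norm_sub h0 h1 hz1
  have hne : (1 / 2 + z : ℂ) ≠ α := fun h => by
    rw [h, sub_self, norm_zero] at hlow
    linarith
  have hzeta : ‖zetaInv (1 / 2 + z)‖ ≤ (K₁ + K₂ * (1 + 1 / δ) * 2) * ‖z‖ := by
    rcases le_total 1 z.re with h | h
    · have h2 := hb₁ (1 / 2 + z) (by simp; linarith)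
      have h3 : 0 ≤ K₂ * (1 + 1 / δ) * 2 := by positivity
      nlinarith
    · have h2 := hb₂ z.re z.im (hδ.trans_le hz) h
      rw [add_assoc, Complex.re_add_im] at h2
      have h3 : 1 / z.re ≤ 1 / δ := one_div_le_one_div_of_le hδ hz
      have h4 : 1 + |z.im| ≤ 2 * ‖z‖ := by linarith [Complex.abs_im_le_norm z]
      calc _ ≤ _ := h2
        _ ≤ K₂ * (1 + 1 / δ) * (2 * ‖z‖) := by gcongr
        _ ≤ _ := by nlinarith
  rw [laplaceE₂_eq hne, norm_div, div_le_iff₀ (by linarith)]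
  calc _ ≤ ‖zetaInv (1 / 2 + z)‖ + ‖(mertensConst α : ℂ)‖ := norm_sub_le _ _
    _ ≤ (K₁ + K₂ * (1 + 1 / δ) * 2) * ‖z‖ + |mertensConst α| * ‖z‖ := by
      rw [Complex.norm_real, Real.norm_eq_abs]
      gcongr
      exact le_mul_of_one_le_right (abs_nonneg _) hz1
    _ = 2 * B * (‖z‖ / 2) := by rw [hB]; ring
    _ ≤ _ := mul_le_mul_of_nonneg_left hlow (by positivity)

theorem exists_tendsto_mul_laplaceE₂ (hs : ZetaZerosSimple) {α γ : ℝ}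
    (hγ : γ ∈ zetaOrd ∨ (α = 1 / 2 ∧ γ = 0)) :
    ∃ c : ℂ, Tendsto (fun z => (z - γ * Complex.I) * laplaceE₂ α z) (𝓝[≠] (γ * Complex.I))
      (𝓝 c) := by
  rcases hγ with hγ | ⟨rfl, rfl⟩
  · have hne : (1 / 2 + γ * Complex.I : ℂ) - α ≠ 0 := fun h => by
      have := congrArg Complex.im h
      simp at this
      exact ne_zero_of_mem_zetaOrd hγ this
    have hcont : Tendsto (fun z : ℂ => 1 / 2 + z - α) (𝓝[≠] (γ * Complex.I))
        (𝓝 (1 / 2 + γ * Complex.I - α)) :=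
      (Continuous.tendsto (by fun_prop) _).mono_left nhdsWithin_le_nhds
    have hmap : Tendsto (fun z : ℂ => 1 / 2 + z) (𝓝[≠] (γ * Complex.I))
        (𝓝[≠] (1 / 2 + γ * Complex.I)) := by
      refine tendsto_nhdsWithin_iff.2
        ⟨(Continuous.tendsto (by fun_prop) _).mono_left nhdsWithin_le_nhds, ?_⟩
      filter_upwards [self_mem_nhdsWithin] with z hz h
      exact hz (add_left_cancel h)
    have h1 := (tendsto_mul_zetaInv hs hγ).comp hmap
    have h2 : Tendsto (fun z : ℂ => (z - γ * Complex.I) * (mertensConst α : ℂ))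
        (𝓝[≠] (γ * Complex.I)) (𝓝 ((γ * Complex.I - γ * Complex.I) * (mertensConst α : ℂ))) :=
      (Continuous.tendsto (by fun_prop) _).mono_left nhdsWithin_le_nhds
    refine ⟨_, ((h1.sub h2).div hcont hne).congr' ?_⟩
    filter_upwards [hcont.eventually_ne hne] with z hz
    rw [laplaceE₂_eq (sub_ne_zero.1 hz)]
    simp only [Pi.div_apply, Function.comp_apply, add_sub_add_left_eq_sub]
    ring
  · refine ⟨zetaInv (1 / 2), ?_⟩
    have hz : riemannZeta₁ (1 / 2) ≠ 0 := by
      rw [riemannZeta₁_eq_of_ne_one (by norm_num)]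
      exact mul_ne_zero (by norm_num) riemannZeta_half_ne_zero
    have h1 : Tendsto (fun z : ℂ => zetaInv (1 / 2 + z)) (𝓝 0) (𝓝 (zetaInv (1 / 2))) := by
      have h2 : Tendsto (fun z : ℂ => 1 / 2 + z) (𝓝 0) (𝓝 (1 / 2)) := by
        simpa using (Continuous.tendsto (f := fun z : ℂ => 1 / 2 + z) (by fun_prop) 0)
      exact (differentiableAt_zetaInv hz).continuousAt.tendsto.comp h2
    simp only [Complex.ofReal_zero, zero_mul, sub_zero]
    refine (h1.mono_left nhdsWithin_le_nhds).congr' ?_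
    filter_upwards [self_mem_nhdsWithin] with z hz
    have hz0 : z ≠ 0 := hz
    simp only [laplaceE₂, le_refl, if_true]
    push_cast
    rw [add_sub_cancel_left, mul_div_cancel₀ _ hz0]

theorem exists_polarPart_laplaceE₂ (hRH : ZetaZerosOnLine) (hs : ZetaZerosSimple) {α T : ℝ}
    (hT : 0 < T) (hTz : ∀ γ ∈ zetaOrd, |γ| ≠ T) :
    ∃ (S : Finset ℝ) (r : ℝ → ℂ) (M R : ℝ), 0 ≤ M ∧ 0 ≤ R ∧
      (∀ δ t : ℝ, 0 < δ → δ ≤ 1 → |t| ≤ T → ‖laplaceE₂ α (δ + t * Complex.I)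
        - ∑ l ∈ S, r l / (δ + t * Complex.I - l * Complex.I)‖ ≤ M) ∧
      ∀ δ t : ℝ, T ≤ |t| → ‖∑ l ∈ S, r l / (δ + t * Complex.I - l * Complex.I)‖ ≤ R / |t| := by
  have hfin : {γ : ℝ | (γ ∈ zetaOrd ∧ |γ| ≤ T) ∨ (α = 1 / 2 ∧ γ = 0)}.Finite :=
    (finite_zetaOrd_Icc T).union ((Set.finite_singleton (0 : ℝ)).subset fun γ hγ => hγ.2)
  set S := hfin.toFinset with hS
  have hmem : ∀ γ : ℝ, γ ∈ S ↔ (γ ∈ zetaOrd ∧ |γ| ≤ T) ∨ (α = 1 / 2 ∧ γ = 0) := fun γ =>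
    hfin.mem_toFinset
  have hlt : ∀ γ ∈ S, |γ| < T := fun γ hγ => by
    rcases (hmem γ).1 hγ with h | h
    · exact lt_of_le_of_ne h.2 (hTz γ h.1)
    · rw [h.2, abs_zero]
      exact hT
  have hres : ∀ γ : ℝ, ∃ c : ℂ, γ ∈ S → Tendsto (fun z => (z - γ * Complex.I) * laplaceE₂ α z)
      (𝓝[≠] (γ * Complex.I)) (𝓝 c) := fun γ => by
    by_cases hγ : γ ∈ S
    · obtain ⟨c, hc⟩ := exists_tendsto_mul_laplaceE₂ hs (α := α)
        (((hmem γ).1 hγ).imp (fun h => h.1) id)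
      exact ⟨c, fun _ => hc⟩
    · exact ⟨0, fun h => absurd h hγ⟩
  choose r hr using hres
  obtain ⟨η, hη0, hη1, hη2⟩ : ∃ η : ℝ, 0 < η ∧ η ≤ 1 / 2 ∧ (α < 1 / 2 → η ≤ 1 / 2 - α) := by
    by_cases h : α < 1 / 2
    · exact ⟨min (1 / 2) (1 / 2 - α), lt_min (by norm_num) (by linarith), min_le_left _ _,
        fun _ => min_le_right _ _⟩
    · exact ⟨1 / 2, by norm_num, le_rfl, fun h' => absurd h' h⟩
  set V : Set ℂ := {z | -η < z.re} ∩ ({z | |z.im| < T} ∪ {z | riemannZeta₁ (1 / 2 + z) ≠ 0})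
  have hV : IsOpen V := (isOpen_lt continuous_const Complex.continuous_re).inter
    ((isOpen_lt (continuous_abs.comp Complex.continuous_im) continuous_const).union
      (isOpen_riemannZeta₁_ne_zero.preimage (continuous_const.add continuous_id)))
  have hdiff : ∀ z ∈ V, (∀ γ ∈ S, z ≠ (γ : ℂ) * Complex.I) →
      DifferentiableAt ℂ (laplaceE₂ α) z := by
    rintro z ⟨hz1, hz2⟩ hzS
    rw [Set.mem_ofPred_eq] at hz1
    refine differentiableAt_laplaceE₂ hRH (fun h => ?_) fun hα h => ?_
    · rcases hz2 with hz2 | hz2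
      · obtain ⟨h1, h2⟩ := re_eq_half_of_riemannZeta₁_eq_zero hRH h (by simp; linarith)
        have h1' : z.re = 0 := by simpa using h1
        have h2' : z.im ∈ zetaOrd := by simpa using h2
        refine hzS z.im ((hmem _).2 (Or.inl ⟨h2', le_of_lt hz2⟩)) ?_
        apply Complex.ext <;> simp [h1']
      · exact hz2 h
    · have h1 : 1 / 2 + z.re = α := by simpa using congrArg Complex.re h
      have h2 : z.im = 0 := by simpa using congrArg Complex.im h
      rcases hα.lt_or_eq with h3 | h3
      · linarith [hη2 h3]
      · refine hzS 0 ((hmem _).2 (Or.inr ⟨h3, rfl⟩)) ?_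
        have h4 : z.re = 0 := by linarith
        apply Complex.ext <;> simp [h2, h4]
  obtain ⟨h, hh, hh'⟩ := exists_differentiableOn_sub_poles hV
    (p := fun γ => (γ : ℂ) * Complex.I) (fun a b hab => by simpa using hab) S hdiff r
    (fun _ _ => 1) (fun _ => differentiable_const _) (fun _ => rfl) hr
  have hcomp : IsCompact (Set.Icc (0 : ℝ) 1 ×ℂ Set.Icc (-T) T) :=
    isCompact_Icc.reProdIm isCompact_Icc
  have hsub : Set.Icc (0 : ℝ) 1 ×ℂ Set.Icc (-T) T ⊆ V := by
    rintro z ⟨hz1, hz2⟩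
    have hz1' : 0 ≤ z.re := hz1.1
    refine ⟨show -η < z.re by linarith, ?_⟩
    have hz3 : |z.im| ≤ T := abs_le.2 hz2
    rcases hz3.lt_or_eq with h1 | h1
    · exact Or.inl h1
    · refine Or.inr fun h2 => ?_
      have h3 := (re_eq_half_of_riemannZeta₁_eq_zero hRH h2 (by simp; linarith)).2
      have h3' : z.im ∈ zetaOrd := by simpa using h3
      exact hTz _ h3' h1
  obtain ⟨M, hM⟩ := hcomp.exists_bound_of_continuousOn (hh.continuousOn.mono hsub)
  refine ⟨S, r, max M 0, ∑ l ∈ S, ‖r l‖ * (T / (T - |l|)), le_max_right _ _,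
    Finset.sum_nonneg fun l hl => mul_nonneg (norm_nonneg _)
      (div_nonneg hT.le (by linarith [hlt l hl])), fun δ t hδ hδ1 ht => ?_, fun δ t ht => ?_⟩
  · have h1 := hM (δ + t * Complex.I) ⟨by simpa using ⟨hδ.le, hδ1⟩, by simpa using abs_le.1 ht⟩
    rw [hh' _ fun γ _ h2 => by simpa [hδ.ne'] using congrArg Complex.re h2] at h1
    simp only [mul_one] at h1
    exact h1.trans (le_max_left _ _)
  · rw [Finset.sum_div]
    refine norm_sum_le_of_le _ fun l hl => ?_
    have htpos : 0 < |t| := hT.trans_le ht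
    have hl' : 0 < T - |l| := by linarith [hlt l hl]
    have h1 : |t| * (T - |l|) / T ≤ ‖(δ + t * Complex.I - l * Complex.I : ℂ)‖ := by
      have h2 := Complex.abs_im_le_norm (δ + t * Complex.I - l * Complex.I : ℂ)
      have h3 : ((δ + t * Complex.I - l * Complex.I : ℂ)).im = t - l := by simp
      rw [h3] at h2
      refine le_trans ?_ ((abs_sub_abs_le_abs_sub t l).trans h2)
      rw [div_le_iff₀ hT]
      nlinarith [abs_nonneg l]
    rw [norm_div]
    calc _ ≤ ‖r l‖ / (|t| * (T - |l|) / T) :=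
          div_le_div_of_nonneg_left (norm_nonneg _) (by positivity) h1
      _ = _ := by field_simp

theorem enorm_sq_eq_ofReal (z : ℂ) : ‖z‖ₑ ^ 2 = ENNReal.ofReal (‖z‖ ^ 2) := by
  rw [ENNReal.ofReal_pow (norm_nonneg z), ofReal_norm]

theorem measurableSet_le_abs (T : ℝ) : MeasurableSet {t : ℝ | T ≤ |t|} :=
  measurableSet_le measurable_const continuous_abs.measurable

theorem lintegral_ofReal_div_one_add_sq {a : ℝ} (ha : 0 ≤ a) :
    ∫⁻ t : ℝ, ENNReal.ofReal (a / (1 + t ^ 2)) = ENNReal.ofReal (a * Real.pi) := by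
  have h := lintegral_ofReal_div_sq_add_sq one_pos
  simp_rw [one_pow] at h
  rw [ENNReal.ofReal_mul ha, ← h, ← lintegral_const_mul' _ _ ENNReal.ofReal_ne_top]
  refine lintegral_congr fun t => ?_
  rw [← ENNReal.ofReal_mul ha, mul_one_div]

theorem lintegral_enorm_sub_sq_le {F G : ℝ → ℂ} {δ T M R a : ℝ} (hδ : 0 ≤ δ) (hT : 1 ≤ T)
    (ha : 0 ≤ a) (hM : ∀ t, |t| ≤ T → ‖F t - G t‖ ≤ M) (hR : ∀ t, T ≤ |t| → ‖G t‖ ≤ R / |t|)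
    (hF : ENNReal.ofReal δ * ∫⁻ t in {t : ℝ | T ≤ |t|}, ‖F t‖ₑ ^ 2 ≤ ENNReal.ofReal a) :
    ENNReal.ofReal δ * ∫⁻ t, ‖F t - G t‖ₑ ^ 2
      ≤ ENNReal.ofReal (δ * (2 * T * M ^ 2 + 4 * R ^ 2 * Real.pi) + 2 * a) := by
  have hfar : ∫⁻ t in {t : ℝ | T ≤ |t|}, ‖F t - G t‖ₑ ^ 2
      ≤ 2 * (∫⁻ t in {t : ℝ | T ≤ |t|}, ‖F t‖ₑ ^ 2) + ENNReal.ofReal (4 * R ^ 2 * Real.pi) := by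
    rw [← lintegral_ofReal_div_one_add_sq (by positivity),
      ← lintegral_const_mul' _ _ ENNReal.ofNat_ne_top]
    refine le_trans ?_ (add_le_add_right (setLIntegral_le_lintegral {t : ℝ | T ≤ |t|} _) _)
    rw [← lintegral_add_right _ (by fun_prop)]
    refine setLIntegral_mono' (measurableSet_le_abs T) fun t ht => ?_
    have ht' : 1 ≤ |t| := hT.trans ht
    have h1 : ‖G t‖ ^ 2 ≤ R ^ 2 / |t| ^ 2 := by
      rw [← div_pow]
      exact pow_le_pow_left₀ (norm_nonneg _) (hR t ht) 2
    have h2 : R ^ 2 / |t| ^ 2 ≤ 2 * R ^ 2 / (1 + t ^ 2) := by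
      rw [div_le_div_iff₀ (by positivity) (by positivity), sq_abs]
      have : 1 ≤ t ^ 2 := by rw [← sq_abs]; nlinarith
      nlinarith [sq_nonneg R]
    have h3 : ‖F t - G t‖ ^ 2 ≤ 2 * ‖F t‖ ^ 2 + 4 * R ^ 2 / (1 + t ^ 2) := by
      have h4 := norm_sub_le (F t) (G t)
      have h5 : ‖F t - G t‖ ^ 2 ≤ (‖F t‖ + ‖G t‖) ^ 2 := pow_le_pow_left₀ (norm_nonneg _) h4 2
      have h6 : 4 * R ^ 2 / (1 + t ^ 2) = 2 * (2 * R ^ 2 / (1 + t ^ 2)) := by ring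
      nlinarith [sq_nonneg (‖F t‖ - ‖G t‖)]
    rw [enorm_sq_eq_ofReal, enorm_sq_eq_ofReal, ← ENNReal.ofReal_ofNat 2,
      ← ENNReal.ofReal_mul (by norm_num), ← ENNReal.ofReal_add (by positivity) (by positivity)]
    exact ENNReal.ofReal_le_ofReal h3
  have hnear : ∫⁻ t in {t : ℝ | T ≤ |t|}ᶜ, ‖F t - G t‖ₑ ^ 2 ≤ ENNReal.ofReal (2 * T * M ^ 2) := by
    have hsub : {t : ℝ | T ≤ |t|}ᶜ ⊆ Set.Icc (-T) T := fun t ht =>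
      abs_le.1 (le_of_lt (not_le.1 ht))
    refine (lintegral_mono_set hsub).trans ((setLIntegral_mono' measurableSet_Icc
      (g := fun _ => ENNReal.ofReal (M ^ 2)) fun t ht => ?_).trans ?_)
    · rw [enorm_sq_eq_ofReal]
      exact ENNReal.ofReal_le_ofReal (pow_le_pow_left₀ (norm_nonneg _) (hM t (abs_le.2 ht)) 2)
    · rw [setLIntegral_const, Real.volume_Icc, ← ENNReal.ofReal_mul (by positivity)]
      exact ENNReal.ofReal_le_ofReal (by linarith)
  rw [← lintegral_add_compl _ (measurableSet_le_abs T)]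
  calc _ ≤ ENNReal.ofReal δ * ((2 * (∫⁻ t in {t : ℝ | T ≤ |t|}, ‖F t‖ₑ ^ 2)
          + ENNReal.ofReal (4 * R ^ 2 * Real.pi)) + ENNReal.ofReal (2 * T * M ^ 2)) :=
        mul_le_mul' le_rfl (add_le_add hfar hnear)
    _ = 2 * (ENNReal.ofReal δ * ∫⁻ t in {t : ℝ | T ≤ |t|}, ‖F t‖ₑ ^ 2)
          + ENNReal.ofReal (δ * (2 * T * M ^ 2 + 4 * R ^ 2 * Real.pi)) := by
        rw [add_assoc, ← ENNReal.ofReal_add (by positivity) (by positivity),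
          ENNReal.ofReal_mul hδ, add_comm (4 * R ^ 2 * Real.pi)]
        ring
    _ ≤ 2 * ENNReal.ofReal a
          + ENNReal.ofReal (δ * (2 * T * M ^ 2 + 4 * R ^ 2 * Real.pi)) :=
        add_le_add (mul_le_mul' le_rfl hF) le_rfl
    _ = _ := by
        rw [← ENNReal.ofReal_ofNat 2, ← ENNReal.ofReal_mul (by norm_num),
          ← ENNReal.ofReal_add (by positivity) (by positivity), add_comm]

theorem norm_laplaceE₂_sq_le {α : ℝ} (h0 : 0 ≤ α) (h1 : α ≤ 1) {δ t : ℝ} (ht : 1 ≤ |t|) :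
    ‖laplaceE₂ α (δ + t * Complex.I)‖ ^ 2
      ≤ 32 * ((1 + |t|) ^ (-2 : ℝ) * ‖zetaInv (1 / 2 + δ + t * Complex.I)‖ ^ 2)
        + 16 * mertensConst α ^ 2 / (1 + t ^ 2) := by
  have him : |t| ≤ ‖(δ + t * Complex.I : ℂ)‖ := by
    simpa using Complex.abs_im_le_norm (δ + t * Complex.I : ℂ)
  have hlow := half_norm_le_norm_sub h0 h1 (ht.trans him)
  have hne : (1 / 2 + (δ + t * Complex.I) : ℂ) ≠ α := fun h => by
    rw [h, sub_self, norm_zero] at hlow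
    linarith
  have htpos : 0 < |t| := by linarith
  rw [laplaceE₂_eq hne, norm_div, div_pow, ← add_assoc]
  set A := ‖zetaInv (1 / 2 + δ + t * Complex.I)‖ with hA
  have hnum : ‖zetaInv (1 / 2 + δ + t * Complex.I) - mertensConst α‖ ^ 2
      ≤ 2 * A ^ 2 + 2 * mertensConst α ^ 2 := by
    have h2 := norm_sub_le (zetaInv (1 / 2 + δ + t * Complex.I)) (mertensConst α : ℂ)
    rw [Complex.norm_real, Real.norm_eq_abs, ← hA] at h2
    have h3 := pow_le_pow_left₀ (norm_nonneg _) h2 2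
    nlinarith [sq_nonneg (A - |mertensConst α|), sq_abs (mertensConst α)]
  have hden : t ^ 2 / 4 ≤ ‖(1 / 2 + δ + t * Complex.I - α : ℂ)‖ ^ 2 := by
    rw [← add_assoc] at hlow
    have h2 : |t| / 2 ≤ ‖(1 / 2 + δ + t * Complex.I - α : ℂ)‖ := by linarith
    have h3 := pow_le_pow_left₀ (by positivity) h2 2
    rw [div_pow, sq_abs] at h3
    linarith
  have ht2 : 1 ≤ t ^ 2 := by rw [← sq_abs]; nlinarith
  have h4 : (1 + |t|) ^ (-2 : ℝ) = 1 / (1 + |t|) ^ 2 := by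
    rw [Real.rpow_neg (by positivity), one_div]
    norm_cast
  rw [h4]
  have h5 : 8 / t ^ 2 ≤ 32 * (1 / (1 + |t|) ^ 2) := by
    rw [mul_one_div, div_le_div_iff₀ (by positivity) (by positivity), ← sq_abs t]
    nlinarith
  have h6 : 8 / t ^ 2 ≤ 16 / (1 + t ^ 2) := by
    rw [div_le_div_iff₀ (by positivity) (by positivity)]
    linarith
  calc _ ≤ (2 * A ^ 2 + 2 * mertensConst α ^ 2) / (t ^ 2 / 4) :=
        div_le_div₀ (by positivity) hnum (by positivity) hden
    _ = 8 / t ^ 2 * A ^ 2 + 8 / t ^ 2 * mertensConst α ^ 2 := by field_simp; ring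
    _ ≤ 32 * (1 / (1 + |t|) ^ 2) * A ^ 2 + 16 / (1 + t ^ 2) * mertensConst α ^ 2 :=
        add_le_add (mul_le_mul_of_nonneg_right h5 (sq_nonneg _))
          (mul_le_mul_of_nonneg_right h6 (sq_nonneg _))
    _ = _ := by ring

theorem exists_lintegral_laplaceE₂_tail_le (hRH : ZetaZerosOnLine) (hs : ZetaZerosSimple)
    {θ C : ℝ} (hθ : θ < 3 / 2) (hJ : InvMomentBound θ C) {α : ℝ} (h0 : 0 ≤ α) (h1 : α ≤ 1) :
    ∃ K > 0, ∀ δ T : ℝ, 0 < δ → δ ≤ 1 → 1 ≤ T →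
      ENNReal.ofReal δ * ∫⁻ t in {t : ℝ | T ≤ |t|}, ‖laplaceE₂ α (δ + t * Complex.I)‖ₑ ^ 2
        ≤ ENNReal.ofReal (K * (δ + (1 + T) ^ (-(1 / 4) : ℝ))) := by
  obtain ⟨K, hK, hKb⟩ := exists_lintegral_zetaInv_tail_le hRH hs hθ hJ
  refine ⟨32 * K + 16 * mertensConst α ^ 2 * Real.pi, by positivity, fun δ T hδ hδ1 hT => ?_⟩
  have hpi := Real.pi_pos
  have hb := hKb δ T hδ hδ1 (by linarith)
  have hint : ∫⁻ t in {t : ℝ | T ≤ |t|}, ‖laplaceE₂ α (δ + t * Complex.I)‖ₑ ^ 2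
      ≤ ENNReal.ofReal 32 * (∫⁻ t in {t : ℝ | T ≤ |t|}, ENNReal.ofReal ((1 + |t|) ^ (-2 : ℝ))
        * ‖zetaInv (1 / 2 + δ + t * Complex.I)‖ₑ ^ 2)
        + ENNReal.ofReal (16 * mertensConst α ^ 2 * Real.pi) := by
    rw [← lintegral_ofReal_div_one_add_sq (by positivity),
      ← lintegral_const_mul' _ _ ENNReal.ofReal_ne_top]
    refine le_trans ?_ (add_le_add_right (setLIntegral_le_lintegral {t : ℝ | T ≤ |t|} _) _)
    rw [← lintegral_add_right _ (by fun_prop)]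
    refine setLIntegral_mono' (measurableSet_le_abs T) fun t ht => ?_
    rw [enorm_sq_eq_ofReal, enorm_sq_eq_ofReal, ← ENNReal.ofReal_mul (by positivity),
      ← ENNReal.ofReal_mul (by norm_num), ← ENNReal.ofReal_add (by positivity) (by positivity)]
    exact ENNReal.ofReal_le_ofReal (norm_laplaceE₂_sq_le h0 h1 (hT.trans ht))
  have hp : 0 ≤ (1 + T) ^ (-(1 / 4) : ℝ) := by positivity
  calc _ ≤ _ := mul_le_mul' le_rfl hint
    _ = ENNReal.ofReal 32 * (ENNReal.ofReal δ * ∫⁻ t in {t : ℝ | T ≤ |t|},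
          ENNReal.ofReal ((1 + |t|) ^ (-2 : ℝ)) * ‖zetaInv (1 / 2 + δ + t * Complex.I)‖ₑ ^ 2)
        + ENNReal.ofReal δ * ENNReal.ofReal (16 * mertensConst α ^ 2 * Real.pi) := by ring
    _ ≤ ENNReal.ofReal 32 * ENNReal.ofReal (K * (δ + (1 + T) ^ (-(1 / 4) : ℝ)))
        + ENNReal.ofReal δ * ENNReal.ofReal (16 * mertensConst α ^ 2 * Real.pi) :=
        add_le_add (mul_le_mul' le_rfl hb) le_rfl
    _ = ENNReal.ofReal (32 * (K * (δ + (1 + T) ^ (-(1 / 4) : ℝ)))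
        + δ * (16 * mertensConst α ^ 2 * Real.pi)) := by
        rw [← ENNReal.ofReal_mul (by norm_num), ← ENNReal.ofReal_mul hδ.le,
          ← ENNReal.ofReal_add (by positivity) (by positivity)]
    _ ≤ _ := ENNReal.ofReal_le_ofReal (by
        have : 0 ≤ 16 * mertensConst α ^ 2 * Real.pi * (1 + T) ^ (-(1 / 4) : ℝ) := by positivity
        linarith)

theorem exists_approx_laplaceE₂ (hRH : ZetaZerosOnLine) (hs : ZetaZerosSimple) {θ C : ℝ}
    (hθ : θ < 3 / 2) (hJ : InvMomentBound θ C) {α : ℝ} (h0 : 0 ≤ α) (h1 : α ≤ 1) {ε : ℝ}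
    (hε : 0 < ε) :
    ∃ (s : Finset ℝ) (r : ℝ → ℂ), ∀ᶠ δ : ℝ in 𝓝[>] 0,
      ENNReal.ofReal δ * ∫⁻ t : ℝ, ‖laplaceE₂ α (δ + t * Complex.I)
        - ∑ l ∈ s, r l / (δ + t * Complex.I - l * Complex.I)‖ₑ ^ 2 ≤ ENNReal.ofReal ε := by
  obtain ⟨K, hK, hKb⟩ := exists_lintegral_laplaceE₂_tail_le hRH hs hθ hJ h0 h1
  obtain ⟨c, hc, hheight⟩ := exists_good_height hRH hs
  have hlim : Tendsto (fun n : ℕ => (1 + (n : ℝ)) ^ (-(1 / 4) : ℝ)) atTop (𝓝 0) :=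
    (tendsto_rpow_neg_atTop (by norm_num : (0 : ℝ) < 1 / 4)).comp
      (tendsto_atTop_add_const_left _ _ tendsto_natCast_atTop_atTop)
  obtain ⟨n, hn, hn1⟩ := ((hlim.eventually_lt_const
    (show 0 < ε / (4 * K) by positivity)).and (eventually_ge_atTop 1)).exists
  obtain ⟨T, hnT, -, hTz, -⟩ := hheight n hn1
  have hn1' : (1 : ℝ) ≤ n := by exact_mod_cast hn1
  have hT : 1 ≤ T := hn1'.trans hnT
  have hpos : 0 < 1 / (c * ((n : ℝ) + 2)) := by positivity
  have hTne : ∀ γ ∈ zetaOrd, γ ≠ T := fun γ hγ h => by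
    have := hTz γ hγ
    rw [h, sub_self, abs_zero] at this
    linarith
  obtain ⟨S, r, M, R, -, -, hM, hR⟩ := exists_polarPart_laplaceE₂ hRH hs (α := α)
    (zero_lt_one.trans_le hT) fun γ hγ h => by
      rcases abs_choice γ with h' | h'
      · exact hTne γ hγ (h'.symm.trans h)
      · exact hTne _ (neg_mem_zetaOrd hγ) (h'.symm.trans h)
  refine ⟨S, r, ?_⟩
  set X := 2 * T * M ^ 2 + 4 * R ^ 2 * Real.pi + 2 * K with hX
  have hX0 : 0 < X := by positivity
  filter_upwards [Ioo_mem_nhdsGT (show 0 < min 1 (ε / (2 * X)) by positivity)] with δ hδ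
  have hδ1 : δ ≤ 1 := hδ.2.le.trans (min_le_left _ _)
  have hδ2 : δ * X ≤ ε / 2 := by
    have := hδ.2.le.trans (min_le_right _ _)
    rw [le_div_iff₀ (by positivity)] at this
    linarith
  have hTp : (1 + T) ^ (-(1 / 4) : ℝ) ≤ ε / (4 * K) :=
    (Real.rpow_le_rpow_of_nonpos (by positivity) (by linarith) (by norm_num)).trans hn.le
  have hTp' : K * (1 + T) ^ (-(1 / 4) : ℝ) ≤ ε / 4 := by
    rw [le_div_iff₀ (by positivity)] at hTp
    linarith
  have hδ0 : 0 < δ := hδ.1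
  refine (lintegral_enorm_sub_sq_le (F := fun t => laplaceE₂ α (δ + t * Complex.I)) hδ0.le hT
    (by positivity) (fun t ht => hM δ t hδ0 hδ1 ht) (fun t ht => hR δ t ht)
    (hKb δ T hδ0 hδ1 hT)).trans (ENNReal.ofReal_le_ofReal ?_)
  rw [hX] at hδ2
  linarith

theorem hasLimitingDist_E₂ (hRH : ZetaZerosOnLine) (hs : ZetaZerosSimple) {θ C : ℝ}
    (hθ : θ < 3 / 2) (hJ : InvMomentBound θ C) {α : ℝ} (h0 : 0 ≤ α) (h1 : α ≤ 1) :
    HasLimitingDist (E₂ α) :=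
  hasLimitingDist_of_laplace (F := laplaceE₂ α) (measurable_E₂ α) zero_le_two
    (fun _ hu => abs_E₂_le h0 h1 hu) (ae_continuousAt_E₂ α) (differentiableOn_laplaceE₂ hRH α)
    (fun _ hδ => exists_norm_laplaceE₂_le hRH hs hθ hJ h0 h1 hδ)
    (fun _ hz => laplaceE₂_eq_integral h0 h1 hz)
    fun _ hε => exists_approx_laplaceE₂ hRH hs hθ hJ h0 h1 hε

theorem statement10
    (hRH : ∀ ρ : ℂ, riemannZeta ρ = 0 → 0 < ρ.re → ρ.re < 1 → ρ.re = 1 / 2)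
    (hsimple : ∀ ρ : ℂ, riemannZeta ρ = 0 → 0 < ρ.re → ρ.re < 1 →
      deriv riemannZeta ρ ≠ 0)
    (θ C : ℝ) (hθ1 : 1 ≤ θ) (hθ2 : θ < 3 - Real.sqrt 3)
    (hJ : ∀ T : ℝ, 1 ≤ T →
      (∑' γ : {γ : ℝ // 0 < γ ∧ γ ≤ T ∧ riemannZeta (1 / 2 + γ * Complex.I) = 0},
        1 / ‖deriv riemannZeta (1 / 2 + (γ : ℝ) * Complex.I)‖ ^ 2) ≤ C * T ^ θ) :
    ∀ α : ℝ, 0 ≤ α → α ≤ 1 → HasLimitingDist (E₂ α) := by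
  have hsqrt : 3 / 2 < Real.sqrt 3 := Real.lt_sqrt_of_sq_lt (by norm_num)
  exact fun α h0 h1 => hasLimitingDist_E₂ hRH hsimple (by linarith) hJ h0 h1
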